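/- For every integer g ≥ 5 and every natural number N, there exists a combinatorial closed orientable surface of genus g with more than N vertices that admits no polyhedral realization in ℝ³. In particular, for each genus g ≥ 5 there are infinitely many pairwise distinct triangulated surfaces of genus g that have no polyhedral embedding in ℝ³. -/

import Mathlib

open Finset

/-- The vertices of a set of triangles. -/
def vertsOf (K : Finset (Finset ℕ)) : Finset ℕ := K.biUnion id

/-- The edges of a set of triangles: all 2-element subsets of its members. -/
def edgesOf (K : Finset (Finset ℕ)) : Finset (Finset ℕ) :=
  K.biUnion fun T => T.powersetCard 2

/-- The three directed edges induced by the cyclic ordering `(t.1, t.2.1, t.2.2)`. -/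
def dedges (t : ℕ × ℕ × ℕ) : Finset (ℕ × ℕ) :=
  {(t.1, t.2.1), (t.2.1, t.2.2), (t.2.2, t.1)}

/-- A combinatorial closed orientable surface of genus `g` on the vertex set `V`:
a nonempty set of triangles on `V` covering `V`, each edge lies in exactly two
triangles, the triangles around each vertex form a single cycle under sharing an
edge through that vertex (formalized as connectivity of that adjacency relation),
the complex is connected, it carries a coherent orientation (a cyclic ordering of
each triangle inducing opposite orderings on each shared edge), and
`|V| - |E| + |F| = 2 - 2g`. -/
def IsCombSurface (V : Finset ℕ) (K : Finset (Finset ℕ)) (g : ℕ) : Prop :=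
  K.Nonempty ∧
  (∀ T ∈ K, T.card = 3 ∧ T ⊆ V) ∧
  (∀ v ∈ V, ∃ T ∈ K, v ∈ T) ∧
  (∀ e : Finset ℕ, e.card = 2 → (∃ T ∈ K, e ⊆ T) →
      (K.filter fun T => e ⊆ T).card = 2) ∧
  (∀ v ∈ V, ∀ T₁ ∈ K, ∀ T₂ ∈ K, v ∈ T₁ → v ∈ T₂ →
      Relation.ReflTransGen
        (fun A B => A ∈ K ∧ B ∈ K ∧ v ∈ A ∧ v ∈ B ∧ (A ∩ B).card = 2) T₁ T₂) ∧
  (∀ T₁ ∈ K, ∀ T₂ ∈ K,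
      Relation.ReflTransGen (fun A B => A ∈ K ∧ B ∈ K ∧ (A ∩ B).card = 2) T₁ T₂) ∧
  (∃ ω : Finset ℕ → ℕ × ℕ × ℕ,
      (∀ T ∈ K, ({(ω T).1, (ω T).2.1, (ω T).2.2} : Finset ℕ) = T) ∧
      (∀ T₁ ∈ K, ∀ T₂ ∈ K, T₁ ≠ T₂ → ∀ a b : ℕ, a ≠ b →
          a ∈ T₁ ∩ T₂ → b ∈ T₁ ∩ T₂ →
          (a, b) ∈ dedges (ω T₁) → (b, a) ∈ dedges (ω T₂))) ∧
  ((V.card : ℤ) - ((edgesOf K).card : ℤ) + (K.card : ℤ) = 2 - 2 * (g : ℤ))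

/-- A face of a set of triangles: a nonempty subset of one of its triangles. -/
def IsFaceOf (K : Finset (Finset ℕ)) (σ : Finset ℕ) : Prop :=
  σ.Nonempty ∧ ∃ T ∈ K, σ ⊆ T

/-- `K` admits a polyhedral realization in ℝ³: a map on the vertices mapping each
triangle to an affinely independent triple, such that the convex hulls of the images
of any two faces intersect exactly in the convex hull of the image of their
intersection. -/
def AdmitsPolyRealization (K : Finset (Finset ℕ)) : Prop :=
  ∃ f : ℕ → EuclideanSpace ℝ (Fin 3),
    (∀ T ∈ K, AffineIndependent ℝ (fun v : {x // x ∈ T} => f v.1)) ∧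
    (∀ σ τ : Finset ℕ, IsFaceOf K σ → IsFaceOf K τ →
      convexHull ℝ (f '' (σ : Set ℕ)) ∩ convexHull ℝ (f '' (τ : Set ℕ)) =
        convexHull ℝ (f '' ((σ ∩ τ : Finset ℕ) : Set ℕ)))

noncomputable section

/-- The relation between the patterns of the six rows of a rank four chirotope on six points,
as a decision diagram over an arbitrary lattice signature: given the values attached to the
patterns of five rows, it returns the values of the patterns of the remaining row. -/
def omRow {α : Type} (m j : α → α → α) (o : α)
      (p0 p1 p2 p3 p4 p5 p6 p7 p8 p9 p11 p12 p13 p14 p15 p16 p17 p18 p19 p20 p22 p23 p24 p25 p26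
      p27 p28 p29 p30 p31 q0 q1 q2 q3 q4 q5 q6 q7 q8 q9 q11 q12 q13 q14 q15 q16 q17 q18 q19 q20
      q22 q23 q24 q25 q26 q27 q28 q29 q30 q31 r0 r1 r2 r3 r4 r5 r6 r7 r8 r9 r11 r12 r13 r14 r15
      r16 r17 r18 r19 r20 r22 r23 r24 r25 r26 r27 r28 r29 r30 r31 s0 s1 s2 s3 s4 s5 s6 s7 s8 s9
      s11 s12 s13 s14 s15 s16 s17 s18 s19 s20 s22 s23 s24 s25 s26 s27 s28 s29 s30 s31 t0 t1 t2 t3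
      t4 t5 t6 t7 t8 t9 t11 t12 t13 t14 t15 t16 t17 t18 t19 t20 t22 t23 t24 t25 t26 t27 t28 t29
      t30 t31 : α) : List α :=
      (fun (c0 c1 c2 c3 c4 c5 c6 c7 c8 c9 c10 c11 c12 c13 c14 c15 c16 c17 c18 c19 c20 c21 c22 c23
      c24 c25 c26 c27 c28 c29 c30 c31 c32 c33 c34 c35 c36 c37 c38 c39 c40 c41 c42 c43 c44 c45 c46
      c47 c48 c49 c50 c51 c52 c53 c54 c55 c56 c57 c58 c59 c60 c61 c62 c63 c64 c65 c66 c67 c68 c69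
      c70 c71 c72 c73 c74 c75 c76 c77 c78 c79 c80 c81 c82 c83 c84 c85 c86 c87 c88 c89 c90 c91 c92
      c93 c94 c95 c96 c97 c98 c99 c100 c101 c102 c103 c104 c105 c106 c107 c108 c109 c110 c111 c112
      c113 c114 c115 c116 c117 c118 c119 c120 c121 c122 c123 c124 c125 c126 c127 c128 c129 c130
      c131 c132 c133 c134 c135 c136 c137 c138 c139 c140 c141 c142 c143 c144 c145 c146 c147 c148
      c149 c150 c151 c152 c153 c154 c155 c156 c157 c158 c159 c160 c161 c162 c163 c164 c165 c166
      c167 c168 c169 c170 c171 c172 c173 c174 c175 c176 c177 c178 c179 c180 c181 c182 c183 c184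
      c185 c186 c187 c188 c189 c190 c191 c192 c193 c194 c195 c196 c197 c198 c199 c200 c201 c202
      c203 c204 c205 c206 c207 c208 c209 c210 c211 c212 c213 c214 c215 c216 c217 c218 c219 c220
      c221 c222 c223 c224 c225 c226 c227 c228 c229 c230 c231 c232 c233 c234 c235 c236 c237 c238
      c239 c240 c241 c242 c243 c244 c245 c246 c247 c248 c249 c250 c251 c252 c253 c254 c255 c256
      c257 c258 c259 c260 c261 c262 c263 c264 c265 c266 c267 c268 c269 c270 c271 c272 c273 c274
      c275 c276 c277 c278 c279 c280 c281 c282 c283 c284 c285 c286 c287 c288 c289 c290 c291 c292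
      c293 c294 c295 c296 c297 c298 c299 c300 c301 c302 c303 c304 c305 c306 c307 c308 c309 c310
      c311 c312 c313 c314 c315 c316 c317 c318 c319 c320 c321 c322 c323 c324 c325 c326 c327 c328
      c329 c330 c331 c332 c333 c334 c335 c336 c337 c338 c339 c340 c341 c342 c343 c344 c345 c346
      c347 c348 c349 c350 c351 c352 c353 c354 c355 c356 c357 c358 c359 c360 c361 c362 c363 c364
      c365 c366 c367 c368 c369 c370 c371 c372 c373 c374 c375 c376 c377 c378 c379 c380 c381 c382
      c383 c384 c385 c386 c387 c388 c389 c390 c391 c392 c393 c394 c395 c396 c397 c398 c399 c400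
      c401 c402 c403 c404 c405 c406 c407 c408 c409 c410 c411 c412 c413 c414 c415 c416 c417 c418
      c419 c420 c421 : α) =>
      (fun (b0 b1 b2 b3 b4 b5 b6 b7 b8 b9 b10 b11 b12 b13 b14 b15 b16 b17 b18 b19 b20 b21 b22 b23
      b24 b25 b26 b27 b28 b29 b30 b31 b32 b33 b34 b35 b36 b37 b38 b39 b40 b41 b42 b43 b44 b45 b46
      b47 b48 b49 b50 b51 b52 b53 b54 b55 b56 b57 b58 b59 b60 b61 b62 b63 b64 b65 b66 b67 b68 b69
      b70 b71 b72 b73 b74 b75 b76 b77 b78 b79 b80 b81 b82 b83 b84 b85 b86 b87 b88 b89 b90 b91 b92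
      b93 b94 b95 b96 b97 b98 b99 b100 b101 b102 b103 b104 b105 b106 b107 b108 b109 b110 b111 b112
      b113 b114 b115 b116 b117 b118 b119 b120 b121 b122 b123 b124 b125 b126 b127 b128 b129 b130
      b131 b132 b133 b134 b135 b136 b137 b138 b139 b140 b141 b142 b143 b144 b145 b146 b147 b148
      b149 b150 b151 b152 b153 b154 b155 b156 b157 b158 b159 b160 b161 b162 b163 b164 b165 b166
      b167 b168 b169 b170 b171 b172 b173 b174 b175 b176 b177 b178 b179 b180 b181 b182 b183 b184
      b185 b186 b187 b188 b189 b190 b191 b192 b193 b194 b195 b196 b197 b198 b199 b200 b201 b202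
      b203 b204 b205 b206 b207 b208 b209 b210 b211 b212 b213 b214 b215 b216 b217 b218 b219 b220
      b221 b222 b223 b224 b225 b226 b227 b228 b229 b230 b231 b232 b233 b234 b235 b236 b237 b238
      b239 b240 b241 b242 b243 b244 b245 b246 b247 b248 b249 b250 b251 b252 b253 b254 b255 b256
      b257 b258 b259 b260 b261 b262 b263 b264 b265 b266 b267 b268 b269 b270 b271 b272 b273 b274
      b275 b276 b277 b278 b279 b280 b281 b282 b283 b284 b285 b286 b287 b288 b289 b290 b291 b292
      b293 b294 b295 b296 b297 b298 b299 b300 b301 b302 b303 b304 b305 b306 b307 b308 b309 b310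
      b311 b312 b313 b314 b315 b316 b317 b318 b319 b320 b321 b322 b323 b324 b325 b326 b327 b328
      b329 b330 b331 b332 b333 b334 b335 b336 b337 b338 b339 b340 b341 b342 b343 b344 b345 b346
      b347 b348 b349 b350 b351 b352 b353 b354 b355 b356 b357 b358 b359 b360 b361 b362 b363 b364
      b365 b366 b367 b368 b369 b370 b371 b372 b373 b374 b375 b376 b377 b378 b379 b380 b381 b382
      b383 b384 b385 b386 b387 b388 b389 b390 b391 b392 b393 b394 b395 b396 b397 b398 b399 b400
      b401 b402 b403 b404 b405 b406 b407 b408 b409 b410 b411 b412 b413 b414 b415 b416 b417 b418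
      b419 b420 b421 b422 b423 b424 b425 b426 b427 b428 b429 b430 b431 b432 b433 b434 b435 b436
      b437 b438 b439 b440 b441 b442 b443 b444 b445 b446 b447 b448 b449 b450 b451 b452 b453 b454
      b455 b456 b457 b458 b459 b460 b461 b462 b463 b464 b465 b466 b467 b468 b469 b470 b471 b472
      b473 b474 b475 b476 b477 b478 b479 b480 b481 b482 b483 b484 b485 b486 b487 b488 b489 b490
      b491 b492 b493 b494 b495 b496 b497 b498 b499 b500 b501 b502 b503 b504 b505 b506 b507 b508
      b509 b510 b511 b512 b513 b514 b515 b516 b517 b518 b519 b520 b521 b522 b523 b524 b525 b526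
      b527 b528 b529 b530 b531 b532 b533 b534 b535 b536 b537 b538 b539 b540 b541 b542 b543 b544
      b545 b546 b547 b548 b549 b550 b551 b552 b553 b554 b555 b556 b557 b558 b559 b560 b561 b562
      b563 b564 b565 b566 b567 b568 b569 b570 b571 b572 b573 b574 b575 b576 b577 b578 b579 b580
      b581 b582 b583 b584 b585 b586 b587 b588 b589 b590 b591 b592 b593 b594 b595 b596 b597 b598
      b599 b600 b601 b602 b603 b604 b605 b606 b607 b608 b609 b610 b611 b612 b613 b614 b615 b616
      b617 b618 b619 b620 b621 b622 b623 b624 b625 b626 b627 b628 b629 b630 b631 b632 b633 b634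
      b635 b636 b637 b638 b639 b640 b641 b642 b643 b644 b645 b646 b647 b648 b649 b650 b651 b652
      b653 b654 b655 b656 b657 b658 b659 b660 b661 b662 b663 b664 b665 b666 b667 b668 b669 b670
      b671 b672 b673 b674 b675 b676 b677 b678 b679 b680 b681 b682 b683 b684 b685 b686 b687 b688
      b689 b690 b691 b692 b693 b694 b695 b696 b697 b698 b699 b700 b701 b702 b703 b704 b705 b706
      b707 b708 b709 b710 b711 b712 b713 b714 b715 b716 b717 b718 b719 b720 b721 b722 b723 b724
      b725 b726 b727 b728 b729 b730 b731 b732 b733 b734 b735 b736 b737 b738 b739 b740 b741 b742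
      b743 b744 b745 b746 b747 b748 b749 b750 b751 b752 b753 b754 b755 b756 b757 b758 b759 b760
      b761 b762 b763 b764 b765 b766 b767 b768 b769 b770 b771 b772 b773 b774 b775 b776 b777 b778
      b779 b780 b781 b782 b783 b784 b785 b786 b787 b788 b789 b790 b791 b792 b793 b794 b795 b796
      b797 b798 b799 b800 b801 b802 b803 b804 b805 b806 b807 b808 b809 b810 b811 b812 b813 b814
      b815 b816 b817 b818 b819 b820 b821 b822 b823 b824 b825 b826 b827 b828 b829 b830 b831 b832
      b833 b834 b835 b836 b837 b838 b839 b840 b841 b842 b843 b844 b845 : α) =>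
      (fun (a0 a1 a2 a3 a4 a5 a6 a7 a8 a9 a10 a11 a12 a13 a14 a15 a16 a17 a18 a19 a20 a21 a22 a23
      a24 a25 a26 a27 a28 a29 a30 a31 a32 a33 a34 a35 a36 a37 a38 a39 a40 a41 a42 a43 a44 a45 a46
      a47 a48 a49 a50 a51 a52 a53 a54 a55 a56 a57 a58 a59 a60 a61 a62 a63 a64 a65 a66 a67 a68 a69
      a70 a71 a72 a73 a74 a75 a76 a77 a78 a79 a80 a81 a82 a83 a84 a85 a86 a87 a88 a89 a90 a91 a92
      a93 a94 a95 a96 a97 a98 a99 a100 a101 a102 a103 a104 a105 a106 a107 a108 a109 a110 a111 a112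
      a113 a114 a115 a116 a117 a118 a119 a120 a121 a122 a123 a124 a125 a126 a127 a128 a129 a130
      a131 a132 a133 a134 a135 a136 a137 a138 a139 a140 a141 a142 a143 a144 a145 a146 a147 a148
      a149 a150 a151 a152 a153 a154 a155 a156 a157 a158 a159 a160 a161 a162 a163 a164 a165 a166
      a167 a168 a169 a170 a171 a172 a173 a174 a175 a176 a177 a178 a179 a180 a181 a182 a183 a184
      a185 a186 a187 a188 a189 a190 a191 a192 a193 a194 a195 a196 a197 a198 a199 a200 a201 a202
      a203 a204 a205 a206 a207 a208 a209 a210 a211 a212 a213 a214 a215 a216 a217 a218 a219 a220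
      a221 a222 a223 a224 a225 a226 a227 a228 a229 a230 a231 a232 a233 a234 a235 a236 a237 a238
      a239 a240 a241 a242 a243 a244 a245 a246 a247 a248 a249 a250 a251 a252 a253 a254 a255 a256
      a257 a258 a259 a260 a261 a262 a263 a264 a265 a266 a267 a268 a269 a270 a271 a272 a273 a274
      a275 a276 a277 a278 a279 a280 a281 a282 a283 a284 a285 a286 a287 a288 a289 a290 a291 a292
      a293 a294 a295 a296 a297 a298 a299 a300 a301 a302 a303 a304 a305 a306 a307 a308 a309 a310
      a311 a312 a313 a314 a315 a316 a317 a318 a319 a320 a321 a322 a323 a324 a325 a326 a327 a328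
      a329 a330 a331 a332 a333 a334 a335 a336 a337 a338 a339 a340 a341 a342 a343 a344 a345 a346
      a347 a348 a349 a350 a351 a352 a353 a354 a355 a356 a357 a358 a359 a360 a361 a362 a363 a364
      a365 a366 a367 a368 a369 a370 a371 a372 a373 a374 a375 a376 a377 a378 a379 a380 a381 a382
      a383 a384 a385 a386 a387 a388 a389 a390 a391 a392 a393 a394 a395 a396 a397 a398 a399 a400
      a401 a402 a403 a404 a405 a406 a407 a408 a409 a410 a411 a412 a413 a414 a415 a416 a417 a418
      a419 a420 a421 : α) =>
      [(j (m p0 a0) (j (m p2 a1) (j (m p4 a2) (j (m p6 a3) (j (m p8 a4) (j (m p12 a5) (j (m p14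
      a6) (j (m p16 a7) (j (m p18 a8) (j (m p20 a9) (j (m p22 a10) (j (m p24 a11) (j (m p26 a12)
      (j (m p28 a13) (m p30 a14))))))))))))))), (j (m p1 a0) (j (m p3 a15) (j (m p5 a16) (j (m p7
      a17) (j (m p9 a18) (j (m p11 a19) (j (m p13 a20) (j (m p15 a21) (j (m p17 a22) (j (m p19
      a23) (j (m p23 a24) (j (m p25 a25) (j (m p27 a26) (j (m p29 a27) (m p31 a14))))))))))))))),
      (j (m p0 a28) (j (m p2 a29) (j (m p4 a30) (j (m p6 a31) (j (m p8 a32) (j (m p12 a33) (j (m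
      p14 a34) (j (m p16 a35) (j (m p18 a36) (j (m p20 a37) (j (m p22 a38) (j (m p24 a39) (j (m
      p26 a40) (j (m p28 a41) (m p30 a42))))))))))))))), (j (m p1 a43) (j (m p3 a29) (j (m p5 a44)
      (j (m p7 a45) (j (m p9 a46) (j (m p11 a47) (j (m p13 a48) (j (m p15 a49) (j (m p17 a50) (j
      (m p19 a51) (j (m p23 a52) (j (m p25 a53) (j (m p27 a54) (j (m p29 a41) (m p31
      a55))))))))))))))), (j (m p0 a56) (j (m p2 a57) (j (m p4 a58) (j (m p6 a59) (j (m p8 a60) (j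
      (m p12 a61) (j (m p14 a62) (j (m p16 a63) (j (m p18 a64) (j (m p20 a65) (j (m p22 a66) (j (m
      p24 a67) (j (m p26 a68) (j (m p28 a69) (m p30 a70))))))))))))))), (j (m p1 a71) (j (m p3
      a72) (j (m p5 a58) (j (m p7 a73) (j (m p9 a74) (j (m p11 a75) (j (m p13 a76) (j (m p15 a77)
      (j (m p17 a78) (j (m p19 a79) (j (m p23 a80) (j (m p25 a81) (j (m p27 a68) (j (m p29 a82) (m
      p31 a83))))))))))))))), (j (m p0 a84) (j (m p2 a85) (j (m p4 a86) (j (m p6 a87) (j (m p8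
      a88) (j (m p12 a89) (j (m p14 a90) (j (m p16 a91) (j (m p18 a92) (j (m p20 a93) (j (m p22
      a94) (j (m p24 a95) (j (m p26 a96) (j (m p28 a97) (m p30 a98))))))))))))))), (j (m p1 a99)
      (j (m p3 a100) (j (m p5 a101) (j (m p7 a87) (j (m p9 a102) (j (m p11 a103) (j (m p13 a104)
      (j (m p15 a105) (j (m p17 a106) (j (m p19 a107) (j (m p23 a108) (j (m p25 a95) (j (m p27
      a109) (j (m p29 a110) (m p31 a111))))))))))))))), (j (m p0 a112) (j (m p2 a113) (j (m p4
      a114) (j (m p6 a115) (j (m p8 a116) (j (m p12 a117) (j (m p14 a118) (j (m p16 a119) (j (m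
      p18 a120) (j (m p20 a121) (j (m p22 a122) (j (m p24 a123) (j (m p26 a124) (j (m p28 a125) (m
      p30 a126))))))))))))))), (j (m p1 a127) (j (m p3 a128) (j (m p5 a129) (j (m p7 a130) (j (m
      p9 a116) (j (m p11 a131) (j (m p13 a132) (j (m p15 a133) (j (m p17 a134) (j (m p19 a135) (j
      (m p23 a122) (j (m p25 a136) (j (m p27 a137) (j (m p29 a138) (m p31 a139))))))))))))))), o,
      (j (m p1 a140) (j (m p3 a141) (j (m p5 a142) (j (m p7 a143) (j (m p9 a144) (j (m p11 a145)
      (j (m p13 a146) (j (m p15 a147) (j (m p17 a148) (j (m p19 a149) (j (m p23 a150) (j (m p25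
      a151) (j (m p27 a152) (j (m p29 a153) (m p31 a154))))))))))))))), (j (m p0 a155) (j (m p2
      a156) (j (m p4 a157) (j (m p6 a158) (j (m p8 a159) (j (m p12 a160) (j (m p14 a161) (j (m p16
      a162) (j (m p18 a163) (j (m p20 a164) (j (m p22 a165) (j (m p24 a166) (j (m p26 a167) (j (m
      p28 a168) (m p30 a169))))))))))))))), (j (m p1 a170) (j (m p3 a171) (j (m p5 a172) (j (m p7
      a173) (j (m p9 a174) (j (m p11 a175) (j (m p13 a160) (j (m p15 a176) (j (m p17 a177) (j (m
      p19 a163) (j (m p23 a178) (j (m p25 a179) (j (m p27 a180) (j (m p29 a181) (m p31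
      a182))))))))))))))), (j (m p0 a183) (j (m p2 a184) (j (m p4 a185) (j (m p6 a186) (j (m p8
      a187) (j (m p12 a188) (j (m p14 a189) (j (m p16 a190) (j (m p18 a191) (j (m p20 a192) (j (m
      p22 a193) (j (m p24 a194) (j (m p26 a195) (j (m p28 a196) (m p30 a197))))))))))))))), (j (m
      p1 a198) (j (m p3 a199) (j (m p5 a200) (j (m p7 a201) (j (m p9 a202) (j (m p11 a203) (j (m
      p13 a204) (j (m p15 a189) (j (m p17 a190) (j (m p19 a205) (j (m p23 a206) (j (m p25 a207) (j
      (m p27 a208) (j (m p29 a209) (m p31 a210))))))))))))))), (j (m p0 a211) (j (m p2 a212) (j (m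
      p4 a213) (j (m p6 a214) (j (m p8 a215) (j (m p12 a216) (j (m p14 a217) (j (m p16 a218) (j (m
      p18 a219) (j (m p20 a220) (j (m p22 a221) (j (m p24 a222) (j (m p26 a223) (j (m p28 a224) (m
      p30 a225))))))))))))))), (j (m p1 a226) (j (m p3 a227) (j (m p5 a228) (j (m p7 a229) (j (m
      p9 a230) (j (m p11 a231) (j (m p13 a232) (j (m p15 a217) (j (m p17 a218) (j (m p19 a233) (j
      (m p23 a234) (j (m p25 a235) (j (m p27 a236) (j (m p29 a237) (m p31 a238))))))))))))))), (j
      (m p0 a239) (j (m p2 a240) (j (m p4 a241) (j (m p6 a242) (j (m p8 a243) (j (m p12 a244) (j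
      (m p14 a245) (j (m p16 a246) (j (m p18 a247) (j (m p20 a248) (j (m p22 a249) (j (m p24 a250)
      (j (m p26 a251) (j (m p28 a252) (m p30 a253))))))))))))))), (j (m p1 a254) (j (m p3 a255) (j
      (m p5 a256) (j (m p7 a257) (j (m p9 a258) (j (m p11 a259) (j (m p13 a244) (j (m p15 a260) (j
      (m p17 a261) (j (m p19 a247) (j (m p23 a262) (j (m p25 a263) (j (m p27 a264) (j (m p29 a265)
      (m p31 a266))))))))))))))), (j (m p0 a267) (j (m p2 a268) (j (m p4 a269) (j (m p6 a270) (j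
      (m p8 a271) (j (m p12 a272) (j (m p14 a273) (j (m p16 a274) (j (m p18 a275) (j (m p20 a276)
      (j (m p22 a277) (j (m p24 a278) (j (m p26 a279) (j (m p28 a280) (m p30 a281))))))))))))))),
      o, (j (m p0 a282) (j (m p2 a283) (j (m p4 a284) (j (m p6 a285) (j (m p8 a286) (j (m p12
      a287) (j (m p14 a288) (j (m p16 a289) (j (m p18 a290) (j (m p20 a291) (j (m p22 a292) (j (m
      p24 a293) (j (m p26 a294) (j (m p28 a295) (m p30 a296))))))))))))))), (j (m p1 a297) (j (m
      p3 a298) (j (m p5 a299) (j (m p7 a300) (j (m p9 a286) (j (m p11 a301) (j (m p13 a302) (j (m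
      p15 a303) (j (m p17 a304) (j (m p19 a305) (j (m p23 a292) (j (m p25 a306) (j (m p27 a307) (j
      (m p29 a308) (m p31 a309))))))))))))))), (j (m p0 a310) (j (m p2 a311) (j (m p4 a312) (j (m
      p6 a313) (j (m p8 a314) (j (m p12 a315) (j (m p14 a316) (j (m p16 a317) (j (m p18 a318) (j
      (m p20 a319) (j (m p22 a320) (j (m p24 a321) (j (m p26 a322) (j (m p28 a323) (m p30
      a324))))))))))))))), (j (m p1 a325) (j (m p3 a326) (j (m p5 a327) (j (m p7 a313) (j (m p9
      a328) (j (m p11 a329) (j (m p13 a330) (j (m p15 a331) (j (m p17 a332) (j (m p19 a333) (j (m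
      p23 a334) (j (m p25 a321) (j (m p27 a335) (j (m p29 a336) (m p31 a337))))))))))))))), (j (m
      p0 a338) (j (m p2 a339) (j (m p4 a340) (j (m p6 a341) (j (m p8 a342) (j (m p12 a343) (j (m
      p14 a344) (j (m p16 a345) (j (m p18 a346) (j (m p20 a347) (j (m p22 a348) (j (m p24 a349) (j
      (m p26 a350) (j (m p28 a351) (m p30 a352))))))))))))))), (j (m p1 a353) (j (m p3 a354) (j (m
      p5 a340) (j (m p7 a355) (j (m p9 a356) (j (m p11 a357) (j (m p13 a358) (j (m p15 a359) (j (m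
      p17 a360) (j (m p19 a361) (j (m p23 a362) (j (m p25 a363) (j (m p27 a350) (j (m p29 a364) (m
      p31 a365))))))))))))))), (j (m p0 a366) (j (m p2 a367) (j (m p4 a368) (j (m p6 a369) (j (m
      p8 a370) (j (m p12 a371) (j (m p14 a372) (j (m p16 a373) (j (m p18 a374) (j (m p20 a375) (j
      (m p22 a376) (j (m p24 a377) (j (m p26 a378) (j (m p28 a379) (m p30 a380))))))))))))))), (j
      (m p1 a381) (j (m p3 a367) (j (m p5 a382) (j (m p7 a383) (j (m p9 a384) (j (m p11 a385) (j
      (m p13 a386) (j (m p15 a387) (j (m p17 a388) (j (m p19 a389) (j (m p23 a390) (j (m p25 a391)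
      (j (m p27 a392) (j (m p29 a379) (m p31 a393))))))))))))))), (j (m p0 a394) (j (m p2 a395) (j
      (m p4 a396) (j (m p6 a397) (j (m p8 a398) (j (m p12 a399) (j (m p14 a400) (j (m p16 a401) (j
      (m p18 a402) (j (m p20 a403) (j (m p22 a404) (j (m p24 a405) (j (m p26 a406) (j (m p28 a407)
      (m p30 a408))))))))))))))), (j (m p1 a394) (j (m p3 a409) (j (m p5 a410) (j (m p7 a411) (j
      (m p9 a412) (j (m p11 a413) (j (m p13 a414) (j (m p15 a415) (j (m p17 a416) (j (m p19 a417)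
      (j (m p23 a418) (j (m p25 a419) (j (m p27 a420) (j (m p29 a421) (m p31 a408)))))))))))))))])
      (j (m q0 b0) (j (m q4 b1) (j (m q8 b2) (j (m q12 b3) (j (m q16 b4) (j (m q20 b5) (j (m q24
      b6) (m q28 b7)))))))) (m q2 b0) (j (m q4 b8) (j (m q12 b9) (j (m q20 b10) (m q28 b11)))) (j
      (m q2 b12) (m q6 b8)) (j (m q8 b13) (j (m q12 b14) (j (m q24 b15) (m q28 b16)))) (j (m q12
      b17) (m q28 b18)) (j (m q2 b19) (j (m q6 b20) (m q14 b17))) (j (m q16 b21) (j (m q20 b22) (j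
      (m q24 b23) (m q28 b24)))) (j (m q2 b25) (m q18 b21)) (j (m q20 b26) (m q28 b27)) (j (m q2
      b28) (j (m q6 b29) (j (m q18 b30) (m q22 b26)))) (j (m q24 b31) (m q28 b32)) (j (m q2 b33)
      (j (m q18 b34) (m q26 b31))) (m q28 b35) (j (m q2 b36) (j (m q6 b37) (j (m q14 b38) (j (m
      q18 b39) (j (m q22 b40) (j (m q26 b41) (m q30 b35))))))) (m q30 b7) (j (m q0 b42) (j (m q8
      b43) (j (m q16 b44) (m q24 b45)))) (j (m q26 b45) (m q30 b46)) (j (m q0 b47) (j (m q4 b48)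
      (j (m q16 b49) (m q20 b50)))) (j (m q22 b50) (m q30 b51)) (j (m q0 b52) (m q16 b53)) (j (m
      q18 b53) (j (m q22 b54) (j (m q26 b55) (m q30 b56)))) (j (m q0 b57) (j (m q4 b58) (j (m q8
      b59) (m q12 b60)))) (j (m q14 b60) (m q30 b61)) (j (m q14 b62) (j (m q26 b63) (m q30 b64)))
      (j (m q0 b65) (m q4 b66)) (j (m q6 b66) (j (m q14 b67) (j (m q22 b68) (m q30 b69)))) (m q0
      b36) (m q29 b7) (j (m q3 b0) (j (m q7 b70) (j (m q11 b71) (j (m q15 b72) (j (m q19 b73) (j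
      (m q23 b74) (j (m q27 b75) (m q31 b7)))))))) (j (m q25 b76) (m q29 b11)) (j (m q3 b12) (j (m
      q11 b77) (j (m q19 b78) (m q27 b76)))) (m q29 b16) (j (m q17 b79) (j (m q25 b80) (m q29
      b18))) (j (m q3 b19) (m q19 b79)) (j (m q13 b81) (m q29 b24)) (j (m q3 b25) (j (m q7 b82) (j
      (m q11 b83) (m q15 b81)))) (j (m q9 b84) (j (m q13 b85) (j (m q25 b86) (m q29 b27)))) (j (m
      q3 b28) (m q11 b84)) (j (m q5 b87) (j (m q13 b88) (m q29 b32))) (j (m q3 b33) (m q7 b87)) (j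
      (m q1 b36) (j (m q5 b89) (j (m q9 b90) (j (m q13 b91) (j (m q17 b92) (j (m q25 b93) (m q29
      b35))))))) (m q3 b36) (m q1 b0) (j (m q1 b42) (m q5 b94)) (j (m q7 b94) (j (m q15 b95) (j (m
      q23 b96) (m q31 b46)))) (j (m q1 b47) (m q9 b97)) (j (m q11 b97) (j (m q15 b98) (j (m q27
      b99) (m q31 b51)))) (j (m q1 b52) (j (m q5 b100) (j (m q9 b101) (m q13 b102)))) (j (m q15
      b102) (m q31 b56)) (j (m q1 b57) (m q17 b103)) (j (m q19 b103) (j (m q23 b104) (j (m q27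
      b105) (m q31 b61)))) (j (m q23 b106) (m q31 b64)) (j (m q1 b65) (j (m q9 b107) (j (m q17
      b108) (m q25 b109)))) (j (m q27 b109) (m q31 b69)) (m q31 b35) (j (m q0 b110) (j (m q8 b111)
      (j (m q16 b112) (m q24 b113)))) (j (m q2 b110) (m q6 b114)) (j (m q0 b115) (j (m q4 b116) (j
      (m q8 b117) (j (m q12 b118) (j (m q16 b119) (j (m q20 b120) (j (m q24 b121) (m q28
      b122)))))))) (m q6 b116) (j (m q8 b123) (m q24 b124)) (j (m q8 b125) (j (m q12 b126) (j (m
      q24 b127) (m q28 b128)))) (j (m q6 b129) (m q14 b126)) (j (m q16 b130) (m q24 b131)) (j (m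
      q2 b132) (j (m q6 b133) (j (m q18 b130) (m q22 b134)))) (j (m q16 b135) (j (m q20 b136) (j
      (m q24 b137) (m q28 b138)))) (j (m q6 b139) (m q22 b136)) (m q24 b140) (j (m q2 b141) (j (m
      q6 b142) (j (m q14 b143) (j (m q18 b144) (j (m q22 b145) (j (m q26 b140) (m q30 b146)))))))
      (j (m q24 b147) (m q28 b148)) (j (m q6 b149) (j (m q14 b150) (j (m q22 b151) (m q30 b148))))
      (j (m q4 b152) (j (m q12 b153) (j (m q20 b154) (m q28 b155)))) (j (m q26 b156) (m q30 b155))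
      (m q26 b121) (j (m q4 b157) (m q20 b158)) (j (m q18 b159) (j (m q22 b158) (j (m q26 b160) (m
      q30 b161)))) (j (m q0 b162) (j (m q4 b163) (j (m q16 b164) (m q20 b165)))) (j (m q18 b164)
      (m q26 b166)) (j (m q4 b167) (m q12 b168)) (j (m q14 b168) (j (m q26 b169) (m q30 b170))) (m
      q26 b171) (m q4 b142) (j (m q0 b172) (m q4 b173)) (j (m q2 b172) (j (m q18 b174) (m q26
      b175))) (j (m q25 b113) (m q29 b176)) (j (m q7 b114) (j (m q15 b177) (j (m q23 b178) (m q31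
      b176)))) (m q25 b121) (j (m q3 b179) (j (m q7 b116) (j (m q11 b180) (j (m q15 b181) (j (m
      q19 b182) (j (m q23 b183) (j (m q27 b121) (m q31 b184)))))))) (j (m q17 b185) (j (m q25
      b124) (m q29 b186))) (j (m q17 b187) (m q25 b127)) (j (m q3 b188) (j (m q7 b129) (j (m q19
      b187) (m q23 b189)))) (j (m q9 b190) (j (m q13 b191) (j (m q25 b131) (m q29 b192)))) (j (m
      q7 b133) (m q15 b191)) (j (m q9 b193) (m q25 b137)) (j (m q3 b194) (j (m q7 b139) (j (m q11
      b193) (m q15 b195)))) (j (m q1 b196) (j (m q5 b142) (j (m q9 b197) (j (m q13 b198) (j (m q17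
      b199) (j (m q25 b140) (m q29 b200))))))) (m q7 b142) (j (m q1 b201) (j (m q9 b202) (j (m q17
      b203) (m q25 b147)))) (j (m q3 b201) (m q7 b149)) (j (m q1 b204) (m q5 b152)) (j (m q3 b204)
      (j (m q11 b205) (j (m q19 b206) (m q27 b156)))) (m q5 b116) (j (m q1 b207) (j (m q5 b157) (j
      (m q9 b208) (m q13 b209)))) (j (m q11 b208) (m q27 b160)) (j (m q5 b163) (m q13 b210)) (j (m
      q11 b211) (j (m q15 b210) (j (m q27 b166) (m q31 b212)))) (j (m q1 b213) (j (m q5 b167) (m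
      q17 b214))) (j (m q19 b214) (m q27 b169)) (j (m q19 b215) (j (m q23 b216) (j (m q27 b171) (m
      q31 b217)))) (m q27 b140) (j (m q5 b173) (j (m q13 b218) (m q29 b219))) (j (m q27 b175) (m
      q31 b219)) (j (m q0 b220) (j (m q4 b221) (j (m q16 b222) (m q20 b223)))) (m q2 b220) (j (m
      q4 b224) (m q20 b225)) (j (m q2 b226) (j (m q6 b224) (m q14 b227))) (j (m q0 b228) (j (m q4
      b229) (j (m q8 b230) (j (m q12 b231) (j (m q16 b232) (j (m q20 b233) (j (m q24 b234) (m q28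
      b235)))))))) (j (m q4 b236) (j (m q12 b237) (j (m q20 b238) (m q28 b239)))) (m q14 b237) (j
      (m q16 b240) (m q20 b241)) (j (m q2 b242) (j (m q18 b240) (m q26 b243))) (m q20 b244) (j (m
      q2 b245) (j (m q6 b246) (j (m q14 b247) (j (m q18 b248) (j (m q22 b244) (j (m q26 b249) (m
      q30 b250))))))) (j (m q16 b251) (j (m q20 b252) (j (m q24 b253) (m q28 b254)))) (m q26 b253)
      (j (m q20 b255) (m q28 b256)) (j (m q14 b257) (j (m q26 b258) (m q30 b256))) (j (m q8 b259)
      (j (m q12 b260) (j (m q24 b261) (m q28 b262)))) (j (m q22 b263) (m q30 b262)) (j (m q8 b264)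
      (m q24 b265)) (j (m q18 b266) (j (m q22 b267) (j (m q26 b265) (m q30 b268)))) (m q22 b233)
      (j (m q0 b269) (j (m q8 b270) (j (m q16 b271) (m q24 b272)))) (j (m q18 b271) (m q22 b273))
      (j (m q8 b274) (m q12 b275)) (j (m q6 b276) (j (m q14 b275) (j (m q22 b277) (m q30 b278))))
      (j (m q0 b279) (j (m q4 b280) (j (m q8 b281) (m q12 b282)))) (j (m q6 b280) (m q22 b283)) (j
      (m q0 b284) (m q8 b285)) (j (m q2 b284) (j (m q6 b286) (j (m q18 b287) (m q22 b288)))) (j (m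
      q1 b289) (m q9 b259)) (j (m q3 b289) (j (m q7 b290) (j (m q19 b291) (m q23 b263)))) (j (m q1
      b292) (j (m q5 b293) (j (m q9 b264) (m q13 b294)))) (j (m q7 b293) (m q23 b267)) (m q9 b230)
      (j (m q3 b295) (j (m q7 b296) (j (m q11 b230) (j (m q15 b297) (j (m q19 b298) (j (m q23
      b233) (j (m q27 b299) (m q31 b300)))))))) (j (m q9 b270) (m q13 b301)) (j (m q7 b302) (j (m
      q15 b301) (j (m q23 b273) (m q31 b303)))) (j (m q1 b304) (j (m q9 b274) (j (m q17 b305) (m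
      q25 b306)))) (j (m q19 b305) (m q23 b277)) (m q23 b244) (j (m q9 b281) (m q25 b307)) (j (m
      q19 b308) (j (m q23 b283) (j (m q27 b307) (m q31 b309)))) (j (m q9 b285) (j (m q13 b310) (j
      (m q25 b311) (m q29 b312)))) (j (m q23 b288) (m q31 b312)) (j (m q0 b313) (m q16 b314)) (j
      (m q2 b313) (j (m q6 b315) (m q14 b316))) (j (m q0 b317) (j (m q4 b318) (j (m q16 b319) (m
      q20 b320)))) (j (m q6 b318) (m q14 b321)) (j (m q0 b322) (j (m q8 b323) (j (m q16 b324) (m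
      q24 b325)))) (j (m q0 b326) (j (m q4 b327) (j (m q8 b328) (j (m q12 b329) (j (m q16 b330) (j
      (m q20 b331) (j (m q24 b332) (m q28 b333)))))))) (m q14 b329) (m q16 b334) (j (m q2 b335) (j
      (m q6 b336) (j (m q14 b337) (j (m q18 b334) (j (m q22 b338) (j (m q26 b339) (m q30
      b340))))))) (j (m q16 b341) (m q20 b342)) (j (m q6 b343) (j (m q14 b344) (j (m q22 b342) (m
      q30 b345)))) (j (m q16 b346) (m q24 b347)) (j (m q14 b348) (j (m q26 b347) (m q30 b349))) (j
      (m q16 b350) (j (m q20 b351) (j (m q24 b352) (m q28 b353)))) (j (m q14 b354) (m q30 b353))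
      (j (m q12 b355) (m q28 b356)) (j (m q18 b357) (j (m q22 b358) (j (m q26 b359) (m q30
      b356)))) (j (m q8 b360) (j (m q12 b361) (j (m q24 b362) (m q28 b363)))) (j (m q18 b364) (m
      q26 b362)) (j (m q4 b365) (j (m q12 b366) (j (m q20 b367) (m q28 b368)))) (j (m q18 b369) (m
      q22 b367)) (m q18 b330) (m q12 b337) (j (m q2 b370) (j (m q18 b371) (m q26 b372))) (j (m q4
      b373) (m q12 b374)) (j (m q2 b375) (j (m q6 b373) (j (m q18 b376) (m q22 b377)))) (j (m q0
      b378) (j (m q4 b379) (j (m q8 b380) (m q12 b381)))) (j (m q2 b378) (m q18 b382)) (j (m q17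
      b314) (j (m q25 b383) (m q29 b384))) (j (m q15 b316) (m q31 b384)) (j (m q17 b319) (m q25
      b385)) (j (m q11 b386) (j (m q15 b321) (j (m q27 b385) (m q31 b387)))) (m q17 b324) (m q17
      b330) (j (m q3 b388) (j (m q7 b389) (j (m q11 b390) (j (m q15 b329) (j (m q19 b330) (j (m
      q23 b391) (j (m q27 b392) (m q31 b393)))))))) (j (m q1 b394) (j (m q5 b395) (j (m q9 b396)
      (j (m q13 b337) (j (m q17 b334) (j (m q25 b397) (m q29 b398))))))) (m q15 b337) (j (m q1
      b399) (j (m q9 b400) (j (m q17 b341) (m q25 b401)))) (j (m q11 b400) (m q15 b344)) (j (m q1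
      b402) (j (m q5 b403) (m q17 b346))) (j (m q7 b403) (m q15 b348)) (j (m q1 b404) (m q17
      b350)) (j (m q3 b404) (j (m q7 b405) (j (m q11 b406) (m q15 b354)))) (j (m q1 b407) (j (m q5
      b408) (j (m q9 b409) (m q13 b355)))) (j (m q3 b407) (m q19 b357)) (j (m q5 b410) (m q13
      b361)) (j (m q3 b411) (j (m q7 b410) (j (m q19 b364) (m q23 b412)))) (j (m q9 b413) (m q13
      b366)) (j (m q3 b414) (j (m q11 b413) (j (m q19 b369) (m q27 b415)))) (m q13 b329) (m q19
      b334) (j (m q19 b371) (m q23 b416)) (j (m q9 b417) (j (m q13 b374) (j (m q25 b418) (m q29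
      b419)))) (j (m q19 b376) (m q27 b418)) (j (m q13 b381) (m q29 b420)) (j (m q19 b382) (j (m
      q23 b421) (j (m q27 b422) (m q31 b420)))) (j (m q0 b423) (j (m q4 b424) (j (m q8 b425) (m
      q12 b426)))) (j (m q2 b423) (m q18 b427)) (j (m q4 b428) (m q12 b429)) (j (m q2 b430) (j (m
      q6 b428) (j (m q18 b431) (m q22 b432)))) (j (m q8 b433) (m q12 b434)) (m q12 b435) (j (m q2
      b436) (j (m q6 b437) (j (m q14 b435) (j (m q18 b438) (j (m q22 b439) (j (m q26 b440) (m q30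
      b441))))))) (j (m q0 b442) (j (m q4 b443) (j (m q8 b444) (j (m q12 b445) (j (m q16 b446) (j
      (m q20 b447) (j (m q24 b448) (m q28 b449)))))))) (m q18 b446) (j (m q4 b450) (j (m q12 b451)
      (j (m q20 b452) (m q28 b453)))) (j (m q18 b454) (m q22 b452)) (j (m q8 b455) (j (m q12 b456)
      (j (m q24 b457) (m q28 b458)))) (j (m q18 b459) (m q26 b457)) (j (m q12 b460) (m q28 b461))
      (j (m q18 b462) (j (m q22 b463) (j (m q26 b464) (m q30 b461)))) (j (m q16 b465) (j (m q20
      b466) (j (m q24 b467) (m q28 b468)))) (j (m q14 b469) (m q30 b468)) (j (m q16 b470) (m q24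
      b471)) (j (m q14 b472) (j (m q26 b471) (m q30 b473))) (j (m q16 b474) (m q20 b475)) (j (m q6
      b476) (j (m q14 b477) (j (m q22 b475) (m q30 b478)))) (m q16 b438) (m q14 b445) (m q14 b479)
      (j (m q0 b480) (j (m q4 b481) (j (m q16 b482) (m q20 b483)))) (j (m q6 b481) (m q14 b484))
      (j (m q0 b485) (m q16 b486)) (j (m q2 b485) (j (m q6 b487) (m q14 b488))) (j (m q13 b426) (m
      q29 b489)) (j (m q19 b427) (j (m q23 b490) (j (m q27 b491) (m q31 b489)))) (j (m q9 b492) (j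
      (m q13 b429) (j (m q25 b493) (m q29 b494)))) (j (m q19 b431) (m q27 b493)) (j (m q5 b495) (j
      (m q13 b434) (m q29 b496))) (j (m q1 b497) (j (m q5 b498) (j (m q9 b499) (j (m q13 b435) (j
      (m q17 b438) (j (m q25 b500) (m q29 b501))))))) (m q19 b438) (m q13 b445) (j (m q3 b502) (j
      (m q7 b503) (j (m q11 b504) (j (m q15 b445) (j (m q19 b446) (j (m q23 b505) (j (m q27 b506)
      (m q31 b507)))))))) (j (m q9 b508) (m q13 b451)) (j (m q3 b509) (j (m q11 b508) (j (m q19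
      b454) (m q27 b510)))) (j (m q5 b511) (m q13 b456)) (j (m q3 b512) (j (m q7 b511) (j (m q19
      b459) (m q23 b513)))) (j (m q1 b514) (j (m q5 b515) (j (m q9 b516) (m q13 b460)))) (j (m q3
      b514) (m q19 b462)) (j (m q1 b517) (m q17 b465)) (j (m q3 b517) (j (m q7 b518) (j (m q11
      b519) (m q15 b469)))) (j (m q1 b520) (j (m q5 b521) (m q17 b470))) (j (m q7 b521) (m q15
      b472)) (j (m q1 b522) (j (m q9 b523) (j (m q17 b474) (m q25 b524)))) (j (m q11 b523) (m q15
      b477)) (m q15 b435) (m q17 b446) (j (m q7 b525) (j (m q15 b479) (j (m q23 b526) (m q31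
      b527)))) (j (m q17 b482) (m q25 b528)) (j (m q11 b529) (j (m q15 b484) (j (m q27 b528) (m
      q31 b530)))) (j (m q17 b486) (j (m q25 b531) (m q29 b532))) (j (m q15 b488) (m q31 b532)) (j
      (m q0 b533) (m q8 b534)) (j (m q2 b533) (j (m q6 b535) (j (m q18 b536) (m q22 b537)))) (j (m
      q0 b538) (j (m q4 b539) (j (m q8 b540) (m q12 b541)))) (j (m q6 b539) (m q22 b542)) (m q8
      b543) (j (m q8 b544) (m q12 b545)) (j (m q6 b546) (j (m q14 b545) (j (m q22 b547) (m q30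
      b548)))) (j (m q0 b549) (j (m q8 b550) (j (m q16 b551) (m q24 b552)))) (j (m q18 b551) (m
      q22 b553)) (j (m q0 b554) (j (m q4 b555) (j (m q8 b556) (j (m q12 b557) (j (m q16 b558) (j
      (m q20 b559) (j (m q24 b560) (m q28 b561)))))))) (m q22 b559) (j (m q8 b562) (m q24 b563))
      (j (m q18 b564) (j (m q22 b565) (j (m q26 b563) (m q30 b566)))) (j (m q8 b567) (j (m q12
      b568) (j (m q24 b569) (m q28 b570)))) (j (m q22 b571) (m q30 b570)) (j (m q9 b534) (j (m q13
      b572) (j (m q25 b573) (m q29 b574)))) (j (m q23 b537) (m q31 b574)) (j (m q9 b540) (m q25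
      b575)) (j (m q19 b576) (j (m q23 b542) (j (m q27 b575) (m q31 b577)))) (j (m q1 b578) (j (m
      q5 b579) (j (m q9 b543) (j (m q13 b580) (j (m q17 b581) (j (m q25 b582) (m q29 b583)))))))
      (j (m q1 b584) (j (m q9 b544) (j (m q17 b585) (m q25 b586)))) (j (m q19 b585) (m q23 b547))
      (j (m q9 b550) (m q13 b587)) (j (m q7 b588) (j (m q15 b587) (j (m q23 b553) (m q31 b589))))
      (m q9 b556) (j (m q3 b590) (j (m q7 b591) (j (m q11 b556) (j (m q15 b592) (j (m q19 b593) (j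
      (m q23 b559) (j (m q27 b594) (m q31 b595)))))))) (j (m q1 b596) (j (m q5 b597) (j (m q9
      b562) (m q13 b598)))) (j (m q7 b597) (m q23 b565)) (j (m q1 b599) (m q9 b567)) (j (m q3
      b599) (j (m q7 b600) (j (m q19 b601) (m q23 b571)))) (j (m q1 b602) (j (m q5 b603) (m q17
      b604))) (j (m q3 b602) (m q11 b605)) (m q5 b606) (j (m q3 b607) (j (m q7 b606) (j (m q11
      b608) (m q15 b609)))) (m q11 b543) (j (m q5 b610) (j (m q13 b611) (m q29 b612))) (j (m q11
      b613) (m q15 b611)) (m q17 b614) (j (m q3 b615) (j (m q11 b616) (j (m q19 b614) (m q27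
      b617)))) (j (m q17 b618) (j (m q25 b619) (m q29 b620))) (j (m q11 b621) (m q27 b619)) (m q29
      b622) (j (m q11 b623) (j (m q15 b624) (j (m q27 b625) (m q31 b622)))) (j (m q0 b626) (m q4
      b627)) (j (m q2 b626) (j (m q18 b628) (m q26 b629))) (m q4 b630) (j (m q2 b631) (j (m q6
      b630) (j (m q14 b632) (j (m q18 b633) (j (m q22 b634) (j (m q26 b635) (m q30 b636))))))) (j
      (m q0 b637) (j (m q4 b638) (j (m q8 b639) (m q12 b640)))) (j (m q4 b641) (m q12 b642)) (j (m
      q14 b642) (j (m q26 b643) (m q30 b644))) (j (m q0 b645) (j (m q4 b646) (j (m q16 b647) (m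
      q20 b648)))) (j (m q18 b647) (m q26 b649)) (j (m q4 b650) (m q20 b651)) (j (m q18 b652) (j
      (m q22 b651) (j (m q26 b653) (m q30 b654)))) (j (m q0 b655) (j (m q4 b656) (j (m q8 b657) (j
      (m q12 b658) (j (m q16 b659) (j (m q20 b660) (j (m q24 b661) (m q28 b662)))))))) (m q26
      b661) (j (m q4 b663) (j (m q12 b664) (j (m q20 b665) (m q28 b666)))) (j (m q26 b667) (m q30
      b666)) (j (m q24 b668) (m q28 b669)) (j (m q6 b670) (j (m q14 b671) (j (m q22 b672) (m q30
      b669)))) (m q24 b635) (j (m q16 b673) (j (m q20 b674) (j (m q24 b675) (m q28 b676)))) (j (m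
      q6 b677) (m q22 b674)) (j (m q16 b678) (m q24 b679)) (j (m q2 b680) (j (m q6 b681) (j (m q18
      b678) (m q22 b682)))) (j (m q8 b683) (j (m q12 b684) (j (m q24 b685) (m q28 b686)))) (j (m
      q6 b687) (m q14 b684)) (j (m q2 b688) (j (m q6 b689) (m q14 b690))) (m q6 b656) (j (m q0
      b691) (j (m q8 b692) (j (m q16 b693) (m q24 b694)))) (j (m q2 b691) (m q6 b695)) (j (m q5
      b627) (j (m q13 b696) (m q29 b697))) (j (m q27 b629) (m q31 b697)) (j (m q1 b698) (j (m q5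
      b630) (j (m q9 b699) (j (m q13 b700) (j (m q17 b701) (j (m q25 b635) (m q29 b702))))))) (m
      q27 b635) (m q5 b638) (j (m q1 b703) (j (m q5 b641) (m q17 b704))) (j (m q19 b704) (m q27
      b643)) (j (m q5 b646) (m q13 b705)) (j (m q11 b706) (j (m q15 b705) (j (m q27 b649) (m q31
      b707)))) (j (m q1 b708) (j (m q5 b650) (j (m q9 b709) (m q13 b710)))) (j (m q11 b709) (m q27
      b653)) (m q5 b656) (j (m q3 b711) (j (m q7 b656) (j (m q11 b712) (j (m q15 b713) (j (m q19
      b714) (j (m q23 b715) (j (m q27 b661) (m q31 b716)))))))) (j (m q1 b717) (m q5 b663)) (j (m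
      q3 b717) (j (m q11 b718) (j (m q19 b719) (m q27 b667)))) (j (m q1 b720) (j (m q9 b721) (j (m
      q17 b722) (m q25 b668)))) (j (m q3 b720) (m q7 b670)) (m q7 b630) (j (m q9 b723) (m q25
      b675)) (j (m q3 b724) (j (m q7 b677) (j (m q11 b723) (m q15 b725)))) (j (m q9 b726) (j (m
      q13 b727) (j (m q25 b679) (m q29 b728)))) (j (m q7 b681) (m q15 b727)) (j (m q17 b729) (m
      q25 b685)) (j (m q3 b730) (j (m q7 b687) (j (m q19 b729) (m q23 b731)))) (j (m q7 b689) (m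
      q23 b732)) (m q25 b661) (j (m q25 b694) (m q29 b733)) (j (m q7 b695) (j (m q15 b734) (j (m
      q23 b735) (m q31 b733)))) (m q0 b736) (j (m q2 b736) (j (m q6 b737) (j (m q14 b738) (j (m
      q18 b739) (j (m q22 b740) (j (m q26 b741) (m q30 b742))))))) (j (m q0 b743) (m q4 b744)) (j
      (m q6 b744) (j (m q14 b745) (j (m q22 b746) (m q30 b747)))) (j (m q0 b748) (m q8 b749)) (j
      (m q0 b750) (j (m q4 b751) (j (m q8 b752) (m q12 b753)))) (j (m q14 b753) (m q30 b754)) (j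
      (m q0 b755) (m q16 b756)) (j (m q18 b756) (j (m q22 b757) (j (m q26 b758) (m q30 b759)))) (j
      (m q0 b760) (j (m q4 b761) (j (m q16 b762) (m q20 b763)))) (j (m q22 b763) (m q30 b764)) (j
      (m q0 b765) (j (m q8 b766) (j (m q16 b767) (m q24 b768)))) (j (m q26 b768) (m q30 b769)) (j
      (m q0 b770) (j (m q4 b771) (j (m q8 b772) (j (m q12 b773) (j (m q16 b774) (j (m q20 b775) (j
      (m q24 b776) (m q28 b777)))))))) (m q30 b777) (m q28 b742) (j (m q24 b778) (m q28 b779)) (j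
      (m q2 b780) (j (m q18 b781) (m q26 b778))) (j (m q20 b782) (m q28 b783)) (j (m q2 b784) (j
      (m q6 b785) (j (m q18 b786) (m q22 b782)))) (j (m q16 b787) (j (m q20 b788) (j (m q24 b789)
      (m q28 b790)))) (j (m q2 b791) (m q18 b787)) (j (m q12 b792) (m q28 b793)) (j (m q2 b794) (j
      (m q6 b795) (m q14 b792))) (m q2 b796) (j (m q4 b797) (j (m q12 b798) (j (m q20 b799) (m q28
      b800)))) (j (m q2 b801) (m q6 b797)) (m q2 b770) (j (m q1 b736) (j (m q5 b802) (j (m q9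
      b803) (j (m q13 b804) (j (m q17 b805) (j (m q25 b806) (m q29 b742))))))) (m q31 b742) (j (m
      q1 b743) (j (m q9 b807) (j (m q17 b808) (m q25 b809)))) (j (m q27 b809) (m q31 b747)) (j (m
      q1 b748) (j (m q5 b810) (m q17 b811))) (j (m q1 b750) (m q17 b812)) (j (m q19 b812) (j (m
      q23 b813) (j (m q27 b814) (m q31 b754)))) (j (m q1 b755) (j (m q5 b815) (j (m q9 b816) (m
      q13 b817)))) (j (m q15 b817) (m q31 b759)) (j (m q1 b760) (m q9 b818)) (j (m q11 b818) (j (m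
      q15 b819) (j (m q27 b820) (m q31 b764)))) (j (m q1 b765) (m q5 b821)) (j (m q7 b821) (j (m
      q15 b822) (j (m q23 b823) (m q31 b769)))) (m q1 b770) (j (m q3 b770) (j (m q7 b824) (j (m
      q11 b825) (j (m q15 b826) (j (m q19 b827) (j (m q23 b828) (j (m q27 b829) (m q31
      b777)))))))) (m q3 b736) (j (m q5 b830) (j (m q13 b831) (m q29 b779))) (j (m q3 b780) (m q7
      b830)) (j (m q9 b832) (j (m q13 b833) (j (m q25 b834) (m q29 b783)))) (j (m q3 b784) (m q11
      b832)) (j (m q13 b835) (m q29 b790)) (j (m q3 b791) (j (m q7 b836) (j (m q11 b837) (m q15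
      b835)))) (j (m q17 b838) (j (m q25 b839) (m q29 b793))) (j (m q3 b794) (m q19 b838)) (j (m
      q3 b796) (j (m q7 b840) (j (m q19 b841) (m q23 b842)))) (j (m q25 b843) (m q29 b800)) (j (m
      q3 b801) (j (m q11 b844) (j (m q19 b845) (m q27 b843)))) (m q29 b777))
      (j (m r0 c0) (j (m r8 c1) (j (m r16 c2) (m r24 c3)))) (m r4 c0) (j (m r8 c4) (m r24 c5)) (j
      (m r4 c6) (m r12 c4)) (j (m r16 c7) (m r24 c8)) (j (m r4 c9) (m r20 c7)) (m r24 c10) (j (m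
      r4 c11) (j (m r12 c12) (j (m r20 c13) (m r28 c10)))) (m r6 c0) (m r6 c6) (m r6 c9) (m r6
      c11) (m r2 c0) (j (m r8 c14) (m r24 c15)) (m r12 c14) (m r24 c16) (j (m r12 c17) (m r28
      c16)) (j (m r6 c18) (m r14 c14)) (j (m r6 c19) (m r14 c17)) (m r2 c20) (m r6 c20) (j (m r16
      c21) (m r24 c22)) (m r20 c21) (m r24 c23) (j (m r20 c24) (m r28 c23)) (j (m r16 c25) (m r24
      c26)) (j (m r6 c27) (m r22 c21)) (j (m r6 c28) (m r22 c24)) (j (m r2 c29) (m r18 c25)) (m r6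
      c29) (m r18 c21) (m r24 c30) (m r28 c30) (m r24 c31) (m r24 c32) (j (m r6 c33) (j (m r14
      c34) (j (m r22 c35) (m r30 c30)))) (j (m r2 c36) (j (m r18 c37) (m r26 c31))) (m r6 c36) (j
      (m r6 c38) (m r14 c39)) (j (m r18 c40) (m r26 c32)) (j (m r6 c41) (m r22 c40)) (m r26 c30)
      (m r26 c3) (m r26 c5) (m r26 c8) (m r26 c10) (m r30 c10) (j (m r0 c42) (m r16 c43)) (m r4
      c42) (m r16 c44) (j (m r4 c45) (m r20 c44)) (j (m r4 c46) (m r20 c47)) (j (m r18 c43) (m r26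
      c48)) (j (m r18 c44) (m r26 c49)) (m r22 c44) (m r26 c50) (j (m r22 c47) (m r30 c50)) (j (m
      r0 c51) (m r8 c52)) (m r4 c51) (m r8 c53) (j (m r4 c54) (m r12 c53)) (j (m r4 c55) (m r12
      c56)) (m r14 c53) (m r26 c57) (j (m r14 c56) (m r30 c57)) (m r0 c36) (m r4 c36) (m r4 c38)
      (m r4 c41) (m r4 c33) (m r28 c3) (j (m r0 c58) (m r16 c59)) (j (m r20 c59) (m r28 c60)) (j
      (m r0 c61) (m r8 c62)) (j (m r12 c62) (m r28 c63)) (m r0 c11) (m r2 c11) (m r2 c58) (m r2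
      c61) (m r2 c64) (m r2 c19) (j (m r20 c65) (m r28 c66)) (m r28 c26) (m r16 c65) (j (m r2 c67)
      (m r18 c65)) (m r22 c65) (m r2 c28) (m r28 c31) (m r28 c68) (m r30 c31) (j (m r2 c69) (m r18
      c70)) (j (m r22 c70) (m r30 c68)) (m r2 c71) (m r2 c33) (m r30 c3) (m r30 c60) (m r30 c63)
      (j (m r0 c72) (m r16 c73)) (m r20 c73) (m r0 c46) (m r30 c48) (m r18 c73) (j (m r22 c73) (m
      r30 c74)) (j (m r0 c75) (m r8 c76)) (m r12 c76) (m r0 c55) (j (m r14 c76) (m r30 c77)) (m r0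
      c69) (m r0 c71) (m r0 c33) (m r25 c3) (m r25 c5) (m r25 c8) (m r25 c10) (m r29 c3) (m r27
      c3) (j (m r7 c0) (j (m r15 c78) (j (m r23 c79) (m r31 c3)))) (j (m r19 c80) (m r27 c5)) (j
      (m r7 c6) (m r23 c80)) (j (m r11 c81) (m r27 c8)) (j (m r7 c9) (m r15 c81)) (j (m r3 c11) (j
      (m r11 c82) (j (m r19 c83) (m r27 c10)))) (m r7 c11) (j (m r17 c84) (m r25 c15)) (j (m r17
      c85) (m r25 c16)) (m r19 c84) (j (m r7 c18) (m r23 c84)) (j (m r3 c19) (m r19 c85)) (m r7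
      c19) (j (m r7 c20) (m r23 c86)) (j (m r9 c87) (m r25 c22)) (j (m r9 c88) (m r25 c23)) (m r25
      c26) (j (m r13 c89) (m r29 c26)) (m r13 c87) (m r11 c87) (j (m r7 c27) (m r15 c87)) (j (m r3
      c28) (m r11 c88)) (m r7 c28) (j (m r7 c29) (m r15 c89)) (j (m r1 c33) (j (m r9 c90) (j (m
      r17 c91) (m r25 c30)))) (m r25 c31) (j (m r5 c36) (j (m r13 c92) (m r29 c31))) (m r5 c38) (j
      (m r9 c93) (m r25 c32)) (j (m r5 c41) (m r13 c93)) (m r5 c33) (m r3 c33) (m r7 c33) (m r7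
      c36) (m r7 c38) (m r7 c41) (m r5 c0) (m r5 c6) (m r5 c9) (m r5 c11) (m r1 c11) (j (m r5 c42)
      (m r13 c94)) (j (m r5 c45) (m r13 c95)) (m r9 c95) (j (m r1 c46) (m r9 c96)) (m r5 c46) (m
      r27 c48) (j (m r15 c94) (m r31 c48)) (j (m r11 c95) (m r27 c49)) (m r15 c95) (j (m r11 c96)
      (m r27 c50)) (m r5 c51) (m r5 c54) (j (m r1 c55) (m r17 c97)) (m r5 c55) (j (m r19 c97) (m
      r27 c57)) (m r27 c31) (m r31 c31) (m r27 c32) (m r27 c30) (m r29 c10) (m r29 c60) (m r29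
      c63) (m r3 c0) (j (m r3 c58) (m r11 c98)) (j (m r15 c98) (m r31 c60)) (j (m r3 c61) (m r19
      c99)) (j (m r23 c99) (m r31 c63)) (m r31 c10) (m r17 c100) (m r29 c16) (j (m r3 c64) (m r19
      c100)) (m r3 c20) (m r23 c100) (m r9 c101) (j (m r13 c101) (m r29 c66)) (m r29 c23) (j (m r3
      c67) (m r11 c101)) (m r3 c29) (m r15 c101) (m r1 c36) (j (m r1 c69) (m r9 c102)) (j (m r13
      c102) (m r29 c68)) (j (m r1 c71) (m r17 c103)) (m r29 c30) (m r3 c36) (m r3 c69) (m r3 c71)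
      (m r1 c0) (m r1 c58) (m r1 c61) (m r1 c42) (j (m r1 c72) (m r9 c104)) (m r13 c104) (j (m r15
      c104) (m r31 c74)) (m r11 c104) (m r31 c50) (m r1 c51) (j (m r1 c75) (m r17 c105)) (m r19
      c105) (j (m r23 c105) (m r31 c77)) (m r31 c57) (m r31 c68) (m r31 c30) (j (m r0 c106) (m r16
      c107)) (m r4 c106) (m r16 c108) (j (m r4 c109) (m r20 c108)) (j (m r6 c106) (m r14 c110)) (j
      (m r6 c109) (m r14 c111)) (m r2 c106) (m r14 c112) (j (m r0 c113) (m r16 c114)) (j (m r4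
      c113) (m r12 c115)) (j (m r0 c116) (j (m r8 c117) (j (m r16 c118) (m r24 c119)))) (m r12
      c117) (m r16 c120) (j (m r4 c121) (j (m r12 c122) (j (m r20 c120) (m r28 c123)))) (j (m r16
      c124) (m r24 c125)) (j (m r12 c126) (m r28 c125)) (m r14 c115) (m r14 c117) (m r14 c122) (m
      r14 c126) (m r16 c127) (m r20 c127) (m r16 c128) (m r16 c129) (j (m r6 c130) (j (m r14 c131)
      (j (m r22 c127) (m r30 c132)))) (j (m r2 c133) (m r18 c128)) (j (m r6 c133) (m r14 c134)) (m
      r14 c135) (m r18 c127) (j (m r18 c129) (m r26 c136)) (j (m r14 c137) (m r30 c136)) (m r16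
      c138) (j (m r20 c138) (m r28 c139)) (j (m r16 c140) (m r24 c141)) (m r28 c141) (j (m r14
      c142) (m r30 c139)) (j (m r14 c143) (m r30 c141)) (m r14 c144) (m r26 c141) (j (m r8 c145)
      (m r24 c146)) (m r12 c145) (m r24 c147) (j (m r12 c148) (m r28 c147)) (j (m r12 c149) (m r28
      c150)) (j (m r18 c151) (m r26 c146)) (j (m r18 c152) (m r26 c147)) (m r18 c153) (j (m r22
      c153) (m r30 c150)) (m r30 c147) (m r18 c114) (m r18 c118) (m r18 c120) (m r18 c124) (m r22
      c120) (m r8 c135) (m r12 c135) (m r12 c134) (m r12 c131) (m r12 c137) (m r0 c154) (j (m r4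
      c154) (m r12 c155)) (j (m r0 c156) (m r8 c157)) (m r12 c157) (j (m r4 c158) (m r12 c159)) (j
      (m r2 c154) (m r18 c160)) (j (m r2 c156) (m r18 c161)) (m r6 c154) (m r18 c162) (j (m r6
      c158) (m r22 c162)) (j (m r8 c163) (m r24 c164)) (m r28 c164) (m r8 c149) (m r26 c164) (j (m
      r22 c165) (m r30 c164)) (m r22 c151) (j (m r8 c166) (m r24 c167)) (j (m r20 c168) (m r28
      c167)) (m r20 c118) (m r8 c122) (j (m r0 c169) (m r8 c170)) (j (m r4 c169) (m r20 c171)) (m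
      r22 c118) (m r22 c168) (m r22 c171) (m r8 c172) (m r8 c131) (m r8 c173) (j (m r0 c174) (m r8
      c175)) (m r8 c159) (m r4 c174) (m r22 c161) (m r2 c174) (j (m r6 c174) (m r22 c176)) (j (m
      r17 c107) (m r25 c177)) (j (m r17 c108) (m r25 c178)) (m r29 c177) (m r29 c179) (m r27 c177)
      (j (m r15 c110) (m r31 c177)) (j (m r11 c111) (m r27 c178)) (m r15 c111) (j (m r15 c112) (m
      r31 c179)) (m r17 c114) (m r17 c118) (m r17 c120) (m r17 c124) (j (m r19 c114) (m r27 c180))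
      (j (m r15 c115) (m r31 c180)) (m r19 c118) (j (m r7 c181) (j (m r15 c117) (j (m r23 c118) (m
      r31 c182)))) (j (m r3 c183) (j (m r11 c122) (j (m r19 c120) (m r27 c184)))) (m r15 c122) (j
      (m r3 c185) (m r19 c124)) (j (m r7 c185) (m r15 c126)) (j (m r1 c186) (j (m r9 c131) (j (m
      r17 c127) (m r25 c187)))) (j (m r17 c128) (m r25 c188)) (j (m r13 c134) (m r29 c188)) (j (m
      r5 c189) (j (m r13 c135) (m r29 c190))) (m r13 c131) (j (m r1 c191) (m r17 c129)) (j (m r5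
      c191) (m r13 c137)) (m r11 c131) (m r15 c131) (m r15 c134) (m r15 c135) (m r15 c137) (j (m
      r1 c192) (m r17 c138)) (j (m r1 c193) (m r17 c140)) (m r5 c194) (m r5 c193) (j (m r3 c192)
      (m r11 c142)) (m r15 c142) (m r3 c193) (j (m r7 c193) (m r15 c143)) (j (m r7 c194) (m r15
      c144)) (j (m r5 c195) (m r13 c145)) (j (m r5 c196) (m r13 c148)) (j (m r1 c197) (m r9 c149))
      (m r13 c149) (m r1 c196) (m r19 c151) (j (m r7 c195) (m r23 c151)) (j (m r3 c196) (m r19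
      c152)) (m r7 c196) (j (m r3 c197) (m r19 c153)) (m r13 c115) (m r13 c117) (m r13 c122) (m
      r13 c126) (m r9 c122) (m r19 c128) (m r19 c127) (m r19 c129) (j (m r13 c155) (m r29 c198))
      (j (m r13 c157) (m r29 c199)) (m r25 c198) (j (m r9 c159) (m r25 c200)) (m r13 c159) (j (m
      r19 c160) (m r27 c198)) (m r31 c198) (m r19 c161) (j (m r23 c161) (m r31 c199)) (j (m r19
      c162) (m r27 c200)) (m r25 c201) (m r29 c201) (j (m r11 c202) (m r27 c201)) (m r11 c112) (m
      r31 c201) (j (m r3 c203) (m r11 c166)) (j (m r7 c203) (m r23 c168)) (m r11 c117) (m r23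
      c120) (j (m r11 c170) (m r27 c204)) (j (m r23 c171) (m r31 c204)) (j (m r1 c205) (m r9
      c172)) (m r5 c205) (m r9 c135) (j (m r9 c173) (m r25 c206)) (m r29 c206) (m r11 c172) (m r11
      c135) (m r11 c173) (m r1 c207) (m r5 c207) (j (m r3 c207) (m r11 c208)) (m r7 c207) (m r11
      c144) (j (m r1 c209) (m r9 c163)) (m r5 c209) (m r9 c145) (j (m r7 c209) (m r23 c165)) (m r3
      c209) (m r23 c153) (m r9 c117) (m r9 c166) (m r9 c170) (m r23 c127) (m r9 c157) (j (m r9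
      c175) (m r25 c210)) (m r29 c210) (j (m r23 c176) (m r31 c210)) (m r23 c162) (m r27 c210) (j
      (m r0 c211) (m r8 c212)) (m r4 c211) (m r8 c213) (j (m r4 c214) (m r12 c213)) (j (m r0 c215)
      (m r8 c216)) (j (m r6 c211) (m r22 c217)) (j (m r6 c214) (m r22 c218)) (m r2 c211) (j (m r2
      c215) (m r18 c219)) (m r22 c219) (m r8 c220) (m r12 c220) (j (m r6 c221) (j (m r14 c220) (j
      (m r22 c222) (m r30 c223)))) (m r2 c224) (j (m r6 c224) (m r22 c225)) (j (m r2 c226) (j (m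
      r18 c227) (m r26 c228))) (m r22 c227) (m r26 c229) (j (m r22 c230) (m r30 c229)) (j (m r0
      c231) (m r8 c232)) (j (m r4 c231) (m r20 c233)) (m r8 c234) (j (m r4 c235) (j (m r12 c234)
      (j (m r20 c236) (m r28 c237)))) (j (m r0 c238) (j (m r8 c239) (j (m r16 c240) (m r24
      c241)))) (m r20 c240) (j (m r8 c242) (m r24 c243)) (j (m r20 c244) (m r28 c243)) (m r22
      c233) (m r22 c236) (m r22 c240) (m r22 c244) (m r18 c240) (m r8 c245) (j (m r12 c245) (m r28
      c246)) (j (m r8 c247) (m r24 c248)) (m r28 c248) (j (m r8 c249) (m r24 c250)) (j (m r22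
      c251) (m r30 c246)) (j (m r22 c252) (m r30 c248)) (j (m r18 c253) (m r26 c250)) (m r22 c253)
      (m r26 c248) (j (m r16 c254) (m r24 c255)) (m r20 c254) (m r24 c256) (j (m r20 c257) (m r28
      c256)) (j (m r20 c258) (m r28 c259)) (m r26 c255) (m r26 c256) (j (m r14 c260) (m r30 c259))
      (m r30 c256) (m r16 c227) (m r20 c227) (m r20 c225) (m r20 c222) (m r20 c230) (m r14 c234)
      (m r0 c261) (j (m r4 c261) (m r20 c262)) (j (m r0 c263) (m r16 c264)) (m r20 c264) (j (m r4
      c265) (m r20 c266)) (m r2 c261) (m r2 c263) (m r6 c261) (j (m r6 c265) (m r14 c267)) (j (m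
      r4 c268) (m r12 c269)) (m r12 c216) (m r0 c268) (m r18 c218) (j (m r2 c268) (m r18 c270)) (m
      r6 c268) (m r12 c271) (m r12 c272) (j (m r18 c273) (m r26 c274)) (j (m r14 c271) (m r30
      c274)) (m r18 c222) (j (m r2 c275) (m r18 c276)) (j (m r6 c275) (m r14 c272)) (j (m r16
      c277) (m r24 c278)) (j (m r12 c279) (m r28 c278)) (m r16 c236) (m r12 c239) (j (m r0 c280)
      (m r16 c281)) (j (m r4 c280) (m r12 c282)) (m r18 c236) (m r18 c277) (m r18 c281) (j (m r12
      c283) (m r28 c284)) (m r24 c284) (m r12 c249) (j (m r18 c285) (m r26 c284)) (m r30 c284) (m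
      r18 c251) (j (m r16 c286) (m r24 c287)) (m r28 c287) (m r16 c258) (m r26 c287) (j (m r14
      c288) (m r30 c287)) (m r16 c273) (m r16 c222) (m r16 c276) (m r14 c279) (m r14 c239) (m r14
      c282) (j (m r0 c289) (m r16 c290)) (m r16 c266) (m r4 c289) (m r2 c289) (j (m r6 c289) (m
      r14 c291)) (j (m r9 c212) (m r25 c292)) (j (m r9 c213) (m r25 c293)) (m r29 c292) (m r9
      c216) (j (m r13 c216) (m r29 c294)) (m r27 c292) (j (m r23 c217) (m r31 c292)) (j (m r19
      c218) (m r27 c293)) (m r23 c218) (j (m r23 c219) (m r31 c294)) (j (m r1 c295) (j (m r9 c220)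
      (j (m r17 c222) (m r25 c296)))) (m r19 c222) (m r23 c222) (m r23 c225) (m r23 c227) (m r23
      c230) (m r9 c232) (m r9 c234) (m r9 c239) (m r9 c242) (m r13 c239) (j (m r11 c232) (m r27
      c297)) (j (m r23 c233) (m r31 c297)) (j (m r3 c298) (j (m r11 c234) (j (m r19 c236) (m r27
      c299)))) (m r23 c236) (m r11 c239) (j (m r7 c300) (j (m r15 c239) (j (m r23 c240) (m r31
      c301)))) (j (m r3 c302) (m r11 c242)) (j (m r7 c302) (m r23 c244)) (j (m r1 c303) (m r9
      c245)) (j (m r1 c304) (m r9 c247)) (m r9 c249) (j (m r5 c305) (m r13 c249)) (m r5 c304) (j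
      (m r3 c303) (m r19 c251)) (m r23 c251) (m r3 c304) (j (m r7 c304) (m r23 c252)) (j (m r7
      c305) (m r23 c253)) (m r13 c213) (m r25 c306) (j (m r13 c269) (m r29 c306)) (j (m r19 c270)
      (m r27 c306)) (m r19 c219) (m r31 c306) (j (m r1 c307) (m r17 c273)) (j (m r5 c307) (m r13
      c271)) (m r13 c220) (m r17 c227) (j (m r17 c276) (m r25 c308)) (j (m r13 c272) (m r29 c308))
      (m r19 c273) (m r19 c227) (m r19 c276) (m r13 c234) (m r13 c279) (m r13 c282) (j (m r3 c309)
      (m r19 c277)) (j (m r7 c309) (m r15 c279)) (m r15 c234) (m r19 c240) (j (m r19 c281) (m r27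
      c310)) (j (m r15 c282) (m r31 c310)) (m r1 c311) (j (m r5 c311) (m r13 c283)) (m r13 c245)
      (j (m r3 c311) (m r19 c285)) (m r7 c311) (m r19 c253) (j (m r1 c312) (m r17 c286)) (m r5
      c312) (m r17 c254) (j (m r1 c313) (m r17 c258)) (j (m r7 c312) (m r15 c288)) (m r3 c312) (j
      (m r3 c313) (m r11 c260)) (m r15 c260) (m r15 c271) (m r15 c220) (m r15 c272) (m r11 c220)
      (m r17 c240) (m r17 c277) (m r17 c236) (m r17 c281) (m r17 c264) (j (m r17 c290) (m r25
      c314)) (m r29 c314) (j (m r17 c266) (m r25 c315)) (j (m r15 c291) (m r31 c314)) (j (m r11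
      c267) (m r27 c315)) (m r15 c267) (m r27 c314) (m r0 c316) (m r4 c316) (m r0 c317) (m r0
      c318) (j (m r6 c316) (j (m r14 c319) (j (m r22 c320) (m r30 c321)))) (m r2 c316) (j (m r14
      c322) (m r30 c323)) (j (m r2 c317) (m r18 c324)) (j (m r22 c324) (m r30 c325)) (j (m r2
      c318) (j (m r18 c326) (m r26 c327))) (m r30 c327) (m r0 c328) (j (m r4 c328) (m r12 c329))
      (j (m r0 c330) (m r8 c331)) (m r12 c331) (j (m r14 c329) (m r30 c332)) (j (m r14 c331) (m
      r30 c333)) (m r26 c334) (m r30 c334) (m r0 c335) (j (m r4 c335) (m r20 c336)) (j (m r0 c337)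
      (m r16 c338)) (m r20 c338) (j (m r0 c339) (m r16 c340)) (j (m r22 c336) (m r30 c341)) (j (m
      r22 c338) (m r30 c342)) (m r18 c338) (j (m r18 c340) (m r26 c343)) (m r30 c343) (m r0 c344)
      (j (m r4 c344) (j (m r12 c345) (j (m r20 c346) (m r28 c347)))) (j (m r0 c348) (m r8 c349))
      (j (m r12 c349) (m r28 c350)) (j (m r0 c351) (m r16 c352)) (j (m r20 c352) (m r28 c353)) (j
      (m r0 c354) (j (m r8 c355) (j (m r16 c356) (m r24 c357)))) (m r28 c357) (m r30 c347) (m r30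
      c350) (m r30 c353) (m r30 c357) (m r26 c357) (m r24 c327) (m r28 c327) (m r28 c321) (m r28
      c323) (m r28 c325) (m r16 c358) (j (m r20 c358) (m r28 c359)) (j (m r16 c360) (m r24 c361))
      (m r28 c361) (j (m r20 c362) (m r28 c363)) (j (m r2 c364) (m r18 c358)) (j (m r2 c365) (m
      r18 c360)) (m r2 c366) (j (m r6 c366) (m r22 c362)) (m r22 c358) (m r8 c367) (j (m r12 c367)
      (m r28 c368)) (j (m r8 c369) (m r24 c370)) (m r28 c370) (j (m r12 c371) (m r28 c372)) (m r2
      c373) (j (m r6 c373) (m r14 c371)) (m r14 c367) (m r2 c344) (m r2 c348) (m r2 c351) (m r2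
      c354) (m r6 c344) (m r4 c374) (m r4 c318) (m r26 c321) (j (m r18 c375) (m r26 c376)) (j (m
      r6 c374) (m r22 c375)) (m r26 c377) (m r6 c318) (m r26 c332) (m r26 c378) (j (m r4 c379) (m
      r20 c380)) (m r16 c380) (m r4 c339) (m r26 c341) (j (m r18 c380) (m r26 c381)) (m r22 c380)
      (m r24 c347) (j (m r16 c382) (m r24 c383)) (j (m r4 c384) (m r20 c382)) (j (m r8 c385) (m
      r24 c386)) (j (m r4 c387) (m r12 c385)) (m r4 c354) (m r26 c347) (m r26 c383) (m r26 c386)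
      (m r24 c321) (m r24 c376) (m r24 c377) (j (m r16 c388) (m r24 c389)) (m r24 c363) (m r20
      c388) (m r18 c388) (j (m r6 c390) (m r22 c388)) (m r6 c365) (j (m r8 c391) (m r24 c392)) (m
      r24 c372) (m r12 c391) (j (m r6 c393) (m r14 c391)) (m r6 c354) (m r6 c384) (m r6 c387) (j
      (m r1 c316) (j (m r9 c394) (j (m r17 c395) (m r25 c321)))) (m r29 c321) (m r29 c323) (j (m
      r1 c317) (m r9 c396)) (j (m r13 c396) (m r29 c325)) (m r1 c318) (j (m r5 c318) (j (m r13
      c397) (m r29 c327))) (m r27 c321) (m r31 c321) (m r31 c323) (m r31 c325) (m r31 c327) (j (m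
      r1 c328) (m r17 c398)) (j (m r1 c330) (m r17 c399)) (j (m r19 c398) (m r27 c332)) (m r31
      c332) (m r19 c399) (j (m r23 c399) (m r31 c333)) (j (m r23 c400) (m r31 c334)) (j (m r1
      c335) (m r9 c401)) (j (m r1 c337) (m r9 c402)) (m r13 c402) (m r1 c339) (j (m r5 c339) (m
      r13 c403)) (j (m r11 c401) (m r27 c341)) (m r31 c341) (m r11 c402) (j (m r15 c402) (m r31
      c342)) (j (m r15 c403) (m r31 c343)) (m r1 c344) (m r1 c348) (m r1 c351) (m r1 c354) (m r5
      c354) (j (m r3 c344) (j (m r11 c404) (j (m r19 c405) (m r27 c347)))) (m r31 c347) (j (m r3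
      c348) (m r19 c406)) (j (m r23 c406) (m r31 c350)) (j (m r3 c351) (m r11 c407)) (j (m r15
      c407) (m r31 c353)) (m r3 c354) (j (m r7 c354) (j (m r15 c408) (j (m r23 c409) (m r31
      c357)))) (m r3 c318) (m r7 c318) (m r3 c316) (m r3 c317) (j (m r13 c410) (m r29 c359)) (j (m
      r13 c411) (m r29 c361)) (j (m r9 c412) (m r25 c363)) (m r29 c363) (m r9 c410) (j (m r3 c364)
      (m r11 c410)) (m r15 c410) (m r3 c365) (j (m r7 c365) (m r15 c411)) (j (m r3 c366) (m r11
      c412)) (m r29 c368) (m r29 c370) (j (m r17 c413) (m r25 c372)) (m r29 c372) (j (m r3 c373)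
      (m r19 c413)) (m r29 c347) (m r29 c350) (m r29 c353) (m r29 c357) (m r25 c347) (m r5 c316)
      (j (m r9 c414) (m r25 c376)) (j (m r5 c374) (m r13 c414)) (j (m r17 c415) (m r25 c377)) (m
      r25 c327) (m r27 c376) (m r27 c377) (m r27 c327) (m r5 c328) (m r17 c416) (j (m r19 c416) (m
      r27 c378)) (m r23 c416) (m r27 c334) (m r5 c335) (m r9 c417) (j (m r5 c379) (m r13 c417)) (j
      (m r11 c417) (m r27 c381)) (m r15 c417) (m r27 c343) (m r5 c344) (m r5 c384) (m r5 c387) (m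
      r7 c344) (j (m r11 c418) (m r27 c383)) (j (m r7 c384) (m r15 c418)) (j (m r19 c419) (m r27
      c386)) (j (m r7 c387) (m r23 c419)) (m r27 c357) (m r7 c316) (m r7 c374) (j (m r9 c420) (m
      r25 c389)) (m r13 c420) (m r25 c361) (j (m r7 c390) (m r15 c420)) (m r7 c366) (m r11 c420)
      (j (m r17 c421) (m r25 c392)) (m r25 c370) (m r7 c373) (m r19 c421) (j (m r7 c393) (m r23
      c421)) (m r25 c357) (m r25 c383) (m r25 c386))
      (j (m s0 t0) (m s16 t16)) (m s8 t0) (m s16 t24) (j (m s8 t8) (m s24 t24)) (m s12 t0) (m s12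
      t8) (m s4 t0) (m s16 t28) (m s24 t28) (m s16 t20) (j (m s12 t12) (m s28 t28)) (j (m s4 t4)
      (m s20 t20)) (m s12 t4) (m s20 t28) (m s14 t0) (m s14 t8) (m s14 t12) (m s14 t4) (m s6 t0)
      (m s6 t4) (m s2 t0) (m s16 t30) (m s24 t30) (m s28 t30) (m s20 t30) (m s16 t26) (m s24 t26)
      (m s16 t22) (m s20 t22) (m s16 t18) (j (m s14 t14) (m s30 t30)) (m s26 t26) (m s26 t30) (j
      (m s6 t6) (m s22 t22)) (m s14 t6) (m s22 t30) (j (m s2 t2) (m s18 t18)) (m s18 t26) (m s6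
      t2) (m s14 t2) (m s18 t30) (m s18 t22) (m s18 t16) (m s18 t24) (m s18 t28) (m s18 t20) (m
      s22 t20) (m s22 t28) (m s26 t24) (m s26 t28) (m s30 t28) (m s0 t2) (m s8 t2) (m s12 t2) (m
      s4 t2) (m s4 t6) (m s12 t6) (m s12 t14) (m s20 t16) (m s20 t24) (m s28 t24) (m s0 t4) (m s8
      t4) (m s8 t12) (m s2 t4) (m s20 t26) (m s28 t26) (m s20 t18) (m s30 t26) (m s22 t18) (m s22
      t26) (m s2 t6) (m s22 t16) (m s22 t24) (m s30 t24) (m s0 t6) (m s8 t6) (m s8 t14) (m s24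
      t16) (m s0 t8) (m s4 t8) (m s24 t20) (m s28 t20) (m s4 t12) (m s6 t8) (m s6 t12) (m s2 t8)
      (m s24 t22) (m s28 t22) (m s24 t18) (m s30 t22) (m s6 t14) (m s26 t18) (m s26 t22) (m s26
      t16) (m s26 t20) (m s30 t20) (m s4 t14) (m s28 t16) (m s0 t12) (m s2 t12) (m s28 t18) (m s30
      t18) (m s2 t14) (m s30 t16) (m s0 t14) (m s17 t16) (m s17 t24) (m s17 t28) (m s17 t20) (m
      s25 t16) (m s25 t20) (m s29 t16) (m s19 t16) (m s19 t24) (m s27 t16) (m s23 t16) (j (m s15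
      t0) (m s31 t16)) (j (m s7 t8) (m s23 t24)) (m s15 t8) (j (m s3 t12) (m s19 t28)) (m s19 t20)
      (j (m s11 t4) (m s27 t20)) (m s11 t12) (m s7 t12) (m s15 t12) (m s15 t4) (j (m s1 t14) (m
      s17 t30)) (m s17 t26) (m s5 t14) (m s17 t22) (j (m s9 t6) (m s25 t22)) (m s9 t14) (m s17
      t18) (m s25 t18) (j (m s13 t2) (m s29 t18)) (m s13 t14) (m s13 t6) (m s3 t14) (m s11 t14) (m
      s7 t14) (m s15 t14) (m s11 t6) (m s15 t6) (m s15 t2) (m s13 t0) (m s13 t8) (m s13 t12) (m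
      s13 t4) (m s9 t4) (m s9 t12) (m s5 t8) (m s5 t12) (m s1 t12) (m s19 t18) (m s27 t18) (m s23
      t18) (m s31 t18) (m s19 t22) (m s27 t22) (m s19 t26) (m s23 t26) (m s19 t30) (m s9 t0) (m s9
      t8) (m s1 t8) (m s11 t0) (m s11 t8) (m s3 t8) (m s23 t20) (m s31 t20) (m s23 t28) (m s9 t2)
      (m s29 t22) (m s23 t22) (m s31 t22) (m s23 t30) (m s25 t24) (m s25 t28) (m s29 t24) (m s27
      t24) (m s7 t0) (m s31 t24) (m s3 t4) (m s27 t28) (m s7 t4) (m s1 t6) (m s25 t30) (m s25 t26)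
      (m s5 t2) (m s29 t26) (m s5 t6) (m s3 t6) (m s7 t6) (m s7 t2) (m s5 t0) (m s5 t4) (m s1 t4)
      (m s27 t26) (m s31 t26) (m s27 t30) (m s29 t28) (m s29 t20) (m s3 t0) (m s31 t28) (m s1 t2)
      (m s29 t30) (m s3 t2) (m s11 t2) (m s1 t0) (m s31 t30) (m s0 t1) (m s8 t1) (m s12 t1) (m s4
      t1) (m s0 t5) (m s8 t5) (m s0 t9) (m s4 t9) (m s0 t13) (j (m s14 t1) (m s30 t17)) (m s6 t1)
      (j (m s6 t9) (m s22 t25)) (m s30 t25) (m s2 t1) (m s2 t9) (m s2 t5) (j (m s2 t13) (m s18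
      t29)) (m s26 t29) (m s30 t29) (m s22 t29) (m s0 t3) (m s8 t3) (m s0 t11) (j (m s12 t3) (m
      s28 t19)) (m s4 t3) (j (m s4 t11) (m s20 t27)) (m s28 t27) (m s0 t7) (j (m s8 t7) (m s24
      t23)) (j (m s0 t15) (m s16 t31)) (m s24 t31) (m s28 t23) (m s28 t31) (m s20 t31) (m s30 t19)
      (m s30 t27) (m s30 t23) (m s30 t31) (m s26 t23) (m s26 t31) (m s22 t27) (m s22 t31) (m s18
      t31) (m s16 t29) (m s24 t29) (m s28 t29) (m s20 t29) (m s20 t25) (m s28 t25) (m s28 t17) (m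
      s2 t3) (m s2 t11) (m s2 t7) (m s2 t15) (m s6 t3) (m s6 t11) (m s14 t3) (m s4 t5) (m s12 t5)
      (m s4 t13) (m s26 t17) (m s14 t5) (m s18 t25) (m s26 t25) (m s6 t5) (m s6 t13) (m s16 t27)
      (m s24 t27) (m s24 t19) (m s4 t7) (m s4 t15) (m s12 t7) (m s26 t19) (m s26 t27) (m s18 t27)
      (m s16 t25) (m s24 t25) (m s24 t17) (m s6 t7) (m s6 t15) (m s14 t7) (m s8 t9) (m s12 t9) (m
      s8 t13) (m s22 t17) (m s14 t9) (m s8 t11) (m s20 t19) (m s12 t11) (m s16 t23) (m s8 t15) (m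
      s20 t23) (m s22 t19) (m s22 t23) (m s18 t23) (m s12 t13) (m s18 t17) (m s14 t13) (m s16 t19)
      (m s12 t15) (m s18 t19) (m s16 t17) (m s20 t17) (m s14 t15) (m s14 t11) (j (m s1 t1) (m s17
      t17)) (m s1 t5) (m s5 t5) (m s25 t17) (m s1 t9) (j (m s9 t9) (m s25 t25)) (m s29 t17) (m s29
      t25) (m s1 t13) (m s9 t13) (m s5 t13) (j (m s13 t13) (m s29 t29)) (m s19 t17) (m s27 t17) (m
      s23 t17) (m s31 t17) (m s27 t25) (m s31 t25) (m s31 t29) (m s1 t3) (m s1 t11) (m s1 t7) (m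
      s1 t15) (m s5 t7) (m s5 t15) (m s9 t11) (m s9 t15) (m s13 t15) (j (m s3 t3) (m s19 t19)) (m
      s27 t19) (m s3 t11) (j (m s11 t11) (m s27 t27)) (m s23 t19) (m s31 t19) (m s31 t27) (m s3
      t7) (m s3 t15) (m s11 t15) (j (m s7 t7) (m s23 t23)) (m s31 t23) (m s7 t15) (j (m s15 t15)
      (m s31 t31)) (m s3 t13) (m s11 t13) (m s7 t13) (m s15 t13) (m s3 t9) (m s11 t9) (m s3 t5) (m
      s7 t5) (m s3 t1) (m s29 t19) (m s29 t27) (m s29 t23) (m s29 t31) (m s25 t19) (m s25 t27) (m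
      s17 t19) (m s5 t1) (m s5 t9) (m s13 t9) (m s25 t29) (m s27 t29) (m s5 t3) (m s5 t11) (m s13
      t11) (m s7 t11) (m s15 t11) (m s7 t3) (m s27 t23) (m s27 t31) (m s19 t23) (m s7 t9) (m s15
      t9) (m s7 t1) (m s25 t23) (m s25 t31) (m s17 t23) (m s9 t1) (m s17 t25) (m s9 t5) (m s13 t5)
      (m s19 t25) (m s23 t25) (m s23 t29) (m s9 t3) (m s9 t7) (m s13 t7) (m s11 t3) (m s19 t27) (m
      s23 t27) (m s11 t7) (m s15 t7) (m s23 t31) (m s11 t5) (m s15 t5) (m s11 t1) (m s17 t27) (m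
      s13 t1) (m s17 t29) (m s19 t29) (m s13 t3) (m s15 t3) (m s19 t31) (m s15 t1) (m s17 t31)

/-- Split off the head of a list, with default value `o`. -/
def fetch {α β : Type} (o : α) (l : List α) (k : α → List α → β) : β :=
  List.casesOn l (k o []) k

theorem fetch_eq {α β : Type} (o : α) (l : List α) (k : α → List α → β) :
    fetch o l k = k (l.getD 0 o) l.tail := by
  cases l <;> rfl

/-- Pass the thirty entries of a list that belong to acyclic patterns to a function. -/
def spread {α β : Type} (o : α) (l : List α)
    (k : α → α → α → α → α → α → α → α → α → α → α → α → α → α → α → 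
      α → α → α → α → α → α → α → α → α → α → α → α → α → α → α → β) : β :=
  fetch o l fun x0 l => fetch o l fun x1 l => fetch o l fun x2 l => fetch o l fun x3 l =>
  fetch o l fun x4 l => fetch o l fun x5 l => fetch o l fun x6 l => fetch o l fun x7 l =>
  fetch o l fun x8 l => fetch o l fun x9 l => fetch o l fun _ l => fetch o l fun x11 l =>
  fetch o l fun x12 l => fetch o l fun x13 l => fetch o l fun x14 l => fetch o l fun x15 l =>
  fetch o l fun x16 l => fetch o l fun x17 l => fetch o l fun x18 l => fetch o l fun x19 l =>
  fetch o l fun x20 l => fetch o l fun _ l => fetch o l fun x22 l => fetch o l fun x23 l =>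
  fetch o l fun x24 l => fetch o l fun x25 l => fetch o l fun x26 l => fetch o l fun x27 l =>
  fetch o l fun x28 l => fetch o l fun x29 l => fetch o l fun x30 l => fetch o l fun x31 _ =>
  k x0 x1 x2 x3 x4 x5 x6 x7 x8 x9 x11 x12 x13 x14 x15 x16 x17 x18 x19 x20 x22 x23 x24 x25 x26 x27
  x28 x29 x30 x31

theorem List.getD_tail_eq {α : Type} (o : α) (l : List α) (n : ℕ) :
    l.tail.getD n o = l.getD (n + 1) o := by
  cases l <;> simp

theorem spread_eq {α β : Type} (o : α) (l : List α)
    (k : α → α → α → α → α → α → α → α → α → α → α → α → α → α → α → 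
      α → α → α → α → α → α → α → α → α → α → α → α → α → α → α → β) :
    spread o l k =
      k (l.getD 0 o) (l.getD 1 o) (l.getD 2 o) (l.getD 3 o) (l.getD 4 o) (l.getD 5 o) (l.getD 6 o)
      (l.getD 7 o) (l.getD 8 o) (l.getD 9 o) (l.getD 11 o) (l.getD 12 o) (l.getD 13 o) (l.getD 14
      o) (l.getD 15 o) (l.getD 16 o) (l.getD 17 o) (l.getD 18 o) (l.getD 19 o) (l.getD 20 o)
      (l.getD 22 o) (l.getD 23 o) (l.getD 24 o) (l.getD 25 o) (l.getD 26 o) (l.getD 27 o) (l.getD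
      28 o) (l.getD 29 o) (l.getD 30 o) (l.getD 31 o) := by
  simp only [spread, fetch_eq, List.getD_tail_eq]

/-- Reindex pattern lanes for moving the entry `1` of a row to the front. -/
def front1 (l : List ℕ) : List ℕ :=
  fetch 0 l fun x0 l => fetch 0 l fun x1 l => fetch 0 l fun x2 l => fetch 0 l fun x3 l =>
  fetch 0 l fun x4 l => fetch 0 l fun x5 l => fetch 0 l fun x6 l => fetch 0 l fun x7 l =>
  fetch 0 l fun x8 l => fetch 0 l fun x9 l => fetch 0 l fun x10 l => fetch 0 l fun x11 l =>
  fetch 0 l fun x12 l => fetch 0 l fun x13 l => fetch 0 l fun x14 l => fetch 0 l fun x15 l =>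
  fetch 0 l fun x16 l => fetch 0 l fun x17 l => fetch 0 l fun x18 l => fetch 0 l fun x19 l =>
  fetch 0 l fun x20 l => fetch 0 l fun x21 l => fetch 0 l fun x22 l => fetch 0 l fun x23 l =>
  fetch 0 l fun x24 l => fetch 0 l fun x25 l => fetch 0 l fun x26 l => fetch 0 l fun x27 l =>
  fetch 0 l fun x28 l => fetch 0 l fun x29 l => fetch 0 l fun x30 l => fetch 0 l fun x31 _ =>
  [x28, x30, x29, x31, x24, x26, x25, x27, x20, x22, x21, x23, x16, x18, x17, x19, x12, x14, x13,
  x15, x8, x10, x9, x11, x4, x6, x5, x7, x0, x2, x1, x3]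

/-- Reindex pattern lanes for moving the entry `2` of a row to the front. -/
def front2 (l : List ℕ) : List ℕ :=
  fetch 0 l fun x0 l => fetch 0 l fun x1 l => fetch 0 l fun x2 l => fetch 0 l fun x3 l =>
  fetch 0 l fun x4 l => fetch 0 l fun x5 l => fetch 0 l fun x6 l => fetch 0 l fun x7 l =>
  fetch 0 l fun x8 l => fetch 0 l fun x9 l => fetch 0 l fun x10 l => fetch 0 l fun x11 l =>
  fetch 0 l fun x12 l => fetch 0 l fun x13 l => fetch 0 l fun x14 l => fetch 0 l fun x15 l =>
  fetch 0 l fun x16 l => fetch 0 l fun x17 l => fetch 0 l fun x18 l => fetch 0 l fun x19 l =>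
  fetch 0 l fun x20 l => fetch 0 l fun x21 l => fetch 0 l fun x22 l => fetch 0 l fun x23 l =>
  fetch 0 l fun x24 l => fetch 0 l fun x25 l => fetch 0 l fun x26 l => fetch 0 l fun x27 l =>
  fetch 0 l fun x28 l => fetch 0 l fun x29 l => fetch 0 l fun x30 l => fetch 0 l fun x31 _ =>
  [x3, x7, x2, x6, x1, x5, x0, x4, x11, x15, x10, x14, x9, x13, x8, x12, x19, x23, x18, x22, x17,
  x21, x16, x20, x27, x31, x26, x30, x25, x29, x24, x28]

/-- Reindex pattern lanes for moving the entry `3` of a row to the front. -/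
def front3 (l : List ℕ) : List ℕ :=
  fetch 0 l fun x0 l => fetch 0 l fun x1 l => fetch 0 l fun x2 l => fetch 0 l fun x3 l =>
  fetch 0 l fun x4 l => fetch 0 l fun x5 l => fetch 0 l fun x6 l => fetch 0 l fun x7 l =>
  fetch 0 l fun x8 l => fetch 0 l fun x9 l => fetch 0 l fun x10 l => fetch 0 l fun x11 l =>
  fetch 0 l fun x12 l => fetch 0 l fun x13 l => fetch 0 l fun x14 l => fetch 0 l fun x15 l =>
  fetch 0 l fun x16 l => fetch 0 l fun x17 l => fetch 0 l fun x18 l => fetch 0 l fun x19 l =>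
  fetch 0 l fun x20 l => fetch 0 l fun x21 l => fetch 0 l fun x22 l => fetch 0 l fun x23 l =>
  fetch 0 l fun x24 l => fetch 0 l fun x25 l => fetch 0 l fun x26 l => fetch 0 l fun x27 l =>
  fetch 0 l fun x28 l => fetch 0 l fun x29 l => fetch 0 l fun x30 l => fetch 0 l fun x31 _ =>
  [x16, x24, x17, x25, x18, x26, x19, x27, x20, x28, x21, x29, x22, x30, x23, x31, x0, x8, x1, x9,
  x2, x10, x3, x11, x4, x12, x5, x13, x6, x14, x7, x15]

/-- Reindex pattern lanes for moving the entry `4` of a row to the front. -/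
def front4 (l : List ℕ) : List ℕ :=
  fetch 0 l fun x0 l => fetch 0 l fun x1 l => fetch 0 l fun x2 l => fetch 0 l fun x3 l =>
  fetch 0 l fun x4 l => fetch 0 l fun x5 l => fetch 0 l fun x6 l => fetch 0 l fun x7 l =>
  fetch 0 l fun x8 l => fetch 0 l fun x9 l => fetch 0 l fun x10 l => fetch 0 l fun x11 l =>
  fetch 0 l fun x12 l => fetch 0 l fun x13 l => fetch 0 l fun x14 l => fetch 0 l fun x15 l =>
  fetch 0 l fun x16 l => fetch 0 l fun x17 l => fetch 0 l fun x18 l => fetch 0 l fun x19 l =>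
  fetch 0 l fun x20 l => fetch 0 l fun x21 l => fetch 0 l fun x22 l => fetch 0 l fun x23 l =>
  fetch 0 l fun x24 l => fetch 0 l fun x25 l => fetch 0 l fun x26 l => fetch 0 l fun x27 l =>
  fetch 0 l fun x28 l => fetch 0 l fun x29 l => fetch 0 l fun x30 l => fetch 0 l fun x31 _ =>
  [x15, x31, x14, x30, x13, x29, x12, x28, x11, x27, x10, x26, x9, x25, x8, x24, x7, x23, x6, x22,
  x5, x21, x4, x20, x3, x19, x2, x18, x1, x17, x0, x16]

/-- The decision diagram applied to lists of lanes. -/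
def rows {α : Type} (m j : α → α → α) (o : α) (p q r s t : List α) : List α :=
  spread o t <| spread o s <| spread o r <| spread o q <| spread o p <| omRow m j o

/-- Lattice expressions in the pattern values of five rows. -/
inductive LatExpr
  | zero
  | var (k z : ℕ)
  | meet (x y : LatExpr)
  | join (x y : LatExpr)

/-- Evaluation of a lattice expression. -/
def LatExpr.eval {α : Type} (m j : α → α → α) (o : α) (ρ : ℕ → ℕ → α) : LatExpr → α
  | .zero => o
  | .var k z => ρ k z
  | .meet x y => m (x.eval m j o ρ) (y.eval m j o ρ)
  | .join x y => j (x.eval m j o ρ) (y.eval m j o ρ)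

theorem LatExpr.eval_testBit (ρ : ℕ → ℕ → ℕ) (b : ℕ) (e : LatExpr) :
    (e.eval Nat.land Nat.lor 0 ρ).testBit b =
      e.eval and or false fun k z => (ρ k z).testBit b := by
  induction e with
  | zero => simp [eval]
  | var k z => rfl
  | meet x y hx hy => simp [eval, hx, hy]
  | join x y hx hy => simp [eval, hx, hy]

theorem LatExpr.eval_mono {ρ ρ' : ℕ → ℕ → Bool} (h : ∀ k z, ρ k z = true → ρ' k z = true)
    (e : LatExpr) (he : e.eval and or false ρ = true) : e.eval and or false ρ' = true := by
  induction e with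
  | zero => simp [eval] at he
  | var k z => exact h k z he
  | meet x y hx hy =>
    simp only [eval, Bool.and_eq_true] at he ⊢
    exact ⟨hx he.1, hy he.2⟩
  | join x y hx hy =>
    simp only [eval, Bool.or_eq_true] at he ⊢
    exact he.imp hx hy

/-- The value attached to pattern `z` of row `k`. -/
def rowVal {α : Type} (o : α) (p q r s t : List α) : ℕ → ℕ → α
  | 0, z => p.getD z o
  | 1, z => q.getD z o
  | 2, z => r.getD z o
  | 3, z => s.getD z o
  | _, z => t.getD z o

/-- The decision diagram as a list of lattice expressions. -/
def rowExprs : List LatExpr :=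
  rows .meet .join .zero ((List.range 32).map (.var 0)) ((List.range 32).map (.var 1))
    ((List.range 32).map (.var 2)) ((List.range 32).map (.var 3)) ((List.range 32).map (.var 4))

set_option maxRecDepth 100000 in
set_option maxHeartbeats 0 in
theorem rows_eq_map {α : Type} (m j : α → α → α) (o : α) (p q r s t : List α) :
    rows m j o p q r s t = rowExprs.map (LatExpr.eval m j o (rowVal o p q r s t)) := by
  unfold rows
  simp only [spread_eq]
  rfl

theorem rows_getD {α : Type} (m j : α → α → α) (o : α) (p q r s t : List α) (z : ℕ) :
    (rows m j o p q r s t).getD z o =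
      (rowExprs.getD z .zero).eval m j o (rowVal o p q r s t) := by
  rw [rows_eq_map]
  exact List.getD_map rowExprs .zero (LatExpr.eval m j o (rowVal o p q r s t))

/-- The index of the quadruple of `0, …, 5` that omits `k` and then the `j`-th remaining point,
in lexicographic order of the quadruples. -/
def quadIdx (k j : ℕ) : ℕ :=
  (([[14, 13, 12, 11, 10],
    [14, 9, 8, 7, 6],
    [13, 9, 5, 4, 3],
    [12, 8, 5, 2, 1],
    [11, 7, 4, 2, 0],
    [10, 6, 3, 1, 0]] : List (List ℕ)).getD k []).getD j 0

/-- The three-term Grassmann-Plücker relations on six points: indices of the quadruples in the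
three products, the first and the last product adding up to the middle one. -/
def gpIdx : List (ℕ × ℕ × ℕ × ℕ × ℕ × ℕ) :=
  [(0, 5, 1, 4, 2, 3),
   (0, 8, 1, 7, 2, 6),
   (0, 9, 3, 7, 4, 6),
   (1, 9, 3, 8, 5, 6),
   (2, 9, 4, 8, 5, 7),
   (0, 12, 1, 11, 2, 10),
   (0, 13, 3, 11, 4, 10),
   (1, 13, 3, 12, 5, 10),
   (2, 13, 4, 12, 5, 11),
   (0, 14, 6, 11, 7, 10),
   (1, 14, 6, 12, 8, 10),
   (2, 14, 7, 12, 8, 11),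
   (3, 14, 6, 13, 9, 10),
   (4, 14, 7, 13, 9, 11),
   (5, 14, 8, 13, 9, 12)]

/-- The truth table of the variable `i` among `n` variables, as a number of `2 ^ n` bits. -/
def truth (n i : ℕ) : ℕ :=
  match n with
  | 0 => 0
  | n + 1 =>
    if i = n then (2 ^ 2 ^ n - 1) <<< 2 ^ n else truth n i ||| truth n i <<< 2 ^ n

theorem truth_lt (n i : ℕ) : truth n i < 2 ^ 2 ^ n := by
  induction n with
  | zero => simp [truth]
  | succ n ih =>
    have hp : 2 ^ (n + 1) = 2 ^ n + 2 ^ n := by ring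
    have h2 : 2 ^ 2 ^ n ≤ 2 ^ 2 ^ (n + 1) :=
      Nat.pow_le_pow_right (by omega) (Nat.pow_le_pow_right (by omega) (Nat.le_succ n))
    have shift (x : ℕ) (hx : x < 2 ^ 2 ^ n) : x <<< 2 ^ n < 2 ^ 2 ^ (n + 1) := by
      rw [Nat.shiftLeft_eq, hp, pow_add]
      exact Nat.mul_lt_mul_of_pos_right hx (by positivity)
    rw [truth]
    split_ifs
    · exact shift _ (Nat.sub_lt (by positivity) one_pos)
    · exact Nat.or_lt_two_pow (ih.trans_le h2) (shift _ ih)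

theorem truth_testBit (n i b : ℕ) (hi : i < n) (hb : b < 2 ^ n) :
    (truth n i).testBit b = b.testBit i := by
  induction n generalizing b with
  | zero => omega
  | succ n ih =>
    rw [truth]
    have hp : 2 ^ (n + 1) = 2 ^ n + 2 ^ n := by ring
    split_ifs with h
    · subst h
      rw [Nat.testBit_shiftLeft, Nat.testBit_two_pow_sub_one]
      by_cases hlt : 2 ^ i ≤ b
      · have : b = 2 ^ i + (b - 2 ^ i) := by omega
        rw [this, Nat.testBit_two_pow_add_eq, Nat.testBit_lt_two_pow (by omega)]
        simp
        omega
      · rw [Nat.testBit_lt_two_pow (by omega : b < 2 ^ i)]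
        simp [hlt]
    · have hi' : i < n := by omega
      rw [Nat.testBit_or, Nat.testBit_shiftLeft]
      by_cases hlt : 2 ^ n ≤ b
      · have hb' : b - 2 ^ n < 2 ^ n := by omega
        rw [ih _ hi' hb', Nat.testBit_lt_two_pow
          ((truth_lt n i).trans_le (Nat.pow_le_pow_right (by omega) hlt))]
        have : b = 2 ^ n + (b - 2 ^ n) := by omega
        conv_rhs => rw [this, Nat.testBit_two_pow_add_gt hi']
        simp [hlt]
      · rw [ih _ hi' (by omega)]
        simp [hlt]

/-- The truth table of a literal in fifteen variables. -/
def litTable (i : ℕ) (b : Bool) : ℕ :=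
  if b then truth 15 i else (2 ^ 2 ^ 15 - 1) ^^^ truth 15 i

/-- The truth table of the statement that row `k` has pattern `z`. -/
def rowTable (k z : ℕ) : ℕ :=
  litTable (quadIdx k 0) (z.testBit 0) &&& (litTable (quadIdx k 1) (z.testBit 1) &&&
    (litTable (quadIdx k 2) (z.testBit 2) &&& (litTable (quadIdx k 3) (z.testBit 3) &&&
      litTable (quadIdx k 4) (z.testBit 4))))

/-- The pattern of row `k` for the sign vector `v`. -/
def rowPat (v : ℕ → Bool) (k : ℕ) : ℕ :=
  (v (quadIdx k 0)).toNat + 2 * (v (quadIdx k 1)).toNat + 4 * (v (quadIdx k 2)).toNat +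
    8 * (v (quadIdx k 3)).toNat + 16 * (v (quadIdx k 4)).toNat

/-- The truth table of one Grassmann-Plücker relation. -/
def gpTable : ℕ × ℕ × ℕ × ℕ × ℕ × ℕ → ℕ
  | (a, b, c, d, e, f) =>
    (truth 15 a ^^^ truth 15 b ^^^ (truth 15 e ^^^ truth 15 f)) |||
      ((2 ^ 2 ^ 15 - 1) ^^^ (truth 15 a ^^^ truth 15 b ^^^ (truth 15 c ^^^ truth 15 d)))

/-- The sign vector `v` of six points satisfies the Grassmann-Plücker relation `t`. -/
def GPSign (v : ℕ → Bool) (t : ℕ × ℕ × ℕ × ℕ × ℕ × ℕ) : Prop :=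
  match t with
  | (a, b, c, d, e, f) => (v a ^^ v b) ≠ (v e ^^ v f) ∨ (v a ^^ v b) = (v c ^^ v d)

/-- The truth table of the chirotope axioms. -/
def validTable : ℕ :=
  List.foldr (fun t x => gpTable t &&& x)
    (List.foldr (fun k x => ((2 ^ 2 ^ 15 - 1) ^^^ rowTable k 10) &&&
      (((2 ^ 2 ^ 15 - 1) ^^^ rowTable k 21) &&& x)) (2 ^ 2 ^ 15 - 1) (List.range 6)) gpIdx

/-- The truth tables of the patterns of row `k`. -/
def rowTables (k : ℕ) : List ℕ := (List.range 32).map (rowTable k)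

theorem validTable_rows :
    ((List.range 32).all fun z =>
      Nat.beq (Nat.land (Nat.land validTable (rowTable 0 z))
          ((rows Nat.land Nat.lor 0 (rowTables 1) (rowTables 2) (rowTables 3) (rowTables 4)
            (rowTables 5)).getD z 0))
        (Nat.land validTable (rowTable 0 z))) = true := by
  decide +kernel

theorem exists_index (v : ℕ → Bool) :
    ∃ b < 2 ^ 15, ∀ i < 15, (truth 15 i).testBit b = v i := by
  refine ⟨Nat.ofBits fun i : Fin 15 => v i, Nat.ofBits_lt_two_pow _, fun i hi => ?_⟩
  rw [truth_testBit _ _ _ hi (Nat.ofBits_lt_two_pow _), Nat.testBit_ofBits_lt _ _ hi]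

theorem quadIdx_lt : ∀ k < 6, ∀ j < 5, quadIdx k j < 15 := by decide

theorem gpIdx_lt : ∀ t ∈ gpIdx, t.1 < 15 ∧ t.2.1 < 15 ∧ t.2.2.1 < 15 ∧ t.2.2.2.1 < 15 ∧
    t.2.2.2.2.1 < 15 ∧ t.2.2.2.2.2 < 15 := by decide

theorem testBit_full {b : ℕ} (hb : b < 2 ^ 15) : (2 ^ 2 ^ 15 - 1).testBit b = true := by
  rw [Nat.testBit_two_pow_sub_one]
  exact decide_eq_true hb

theorem litTable_testBit {v : ℕ → Bool} {b : ℕ} (hb : b < 2 ^ 15)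
    (hv : ∀ i < 15, (truth 15 i).testBit b = v i)
    {i : ℕ} (hi : i < 15) (c : Bool) :
    (litTable i c).testBit b = (v i == c) := by
  cases c
  · rw [litTable, if_neg (by simp), Nat.testBit_xor, testBit_full hb, hv i hi]
    cases v i <;> rfl
  · simp [litTable, hv i hi]

theorem pattern_bits : ∀ z < 32, ∀ a b c d e : Bool,
    (a == z.testBit 0 && (b == z.testBit 1 && (c == z.testBit 2 && (d == z.testBit 3 &&
      e == z.testBit 4)))) =
    decide (z = a.toNat + 2 * b.toNat + 4 * c.toNat + 8 * d.toNat + 16 * e.toNat) := by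
  decide +kernel

theorem rowTable_testBit {v : ℕ → Bool} {b : ℕ} (hb : b < 2 ^ 15)
    (hv : ∀ i < 15, (truth 15 i).testBit b = v i)
    {k z : ℕ} (hk : k < 6) (hz : z < 32) :
    (rowTable k z).testBit b = decide (z = rowPat v k) := by
  have q := quadIdx_lt k hk
  simp only [rowTable, Nat.testBit_and, litTable_testBit hb hv (q 0 (by omega)),
    litTable_testBit hb hv (q 1 (by omega)), litTable_testBit hb hv (q 2 (by omega)),
    litTable_testBit hb hv (q 3 (by omega)), litTable_testBit hb hv (q 4 (by omega)), rowPat]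
  exact pattern_bits z hz _ _ _ _ _

theorem validTable_testBit {v : ℕ → Bool} {b : ℕ} (hb : b < 2 ^ 15)
    (hv : ∀ i < 15, (truth 15 i).testBit b = v i)
    (hg : ∀ t ∈ gpIdx, GPSign v t)
    (ha : ∀ k < 6, rowPat v k ≠ 10 ∧ rowPat v k ≠ 21) : validTable.testBit b = true := by
  have aux (l : List ℕ) (hl : ∀ k ∈ l, k < 6) :
      (List.foldr (fun k x => ((2 ^ 2 ^ 15 - 1) ^^^ rowTable k 10) &&&
        (((2 ^ 2 ^ 15 - 1) ^^^ rowTable k 21) &&& x)) (2 ^ 2 ^ 15 - 1) l).testBit b = true := by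
    induction l with
    | nil => exact testBit_full hb
    | cons k l ih =>
      have hk := hl k (by simp)
      rw [List.foldr_cons, Nat.testBit_and, Nat.testBit_and, Nat.testBit_xor, Nat.testBit_xor,
        testBit_full hb, rowTable_testBit hb hv hk (by omega), rowTable_testBit hb hv hk (by omega),
        ih fun k h => hl k (by simp [h])]
      simp [(ha k hk).1.symm, (ha k hk).2.symm]
  have aux' (l : List (ℕ × ℕ × ℕ × ℕ × ℕ × ℕ)) (hl : ∀ t ∈ l, t ∈ gpIdx) (x : ℕ)
      (hx : x.testBit b = true) :
      (List.foldr (fun t x => gpTable t &&& x) x l).testBit b = true := by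
    induction l with
    | nil => exact hx
    | cons t l ih =>
      have ht := hg t (hl t (by simp))
      obtain ⟨h1, h2, h3, h4, h5, h6⟩ := gpIdx_lt t (hl t (by simp))
      rw [List.foldr_cons, Nat.testBit_and, ih fun t h => hl t (by simp [h])]
      simp only [GPSign] at ht
      simp only [gpTable, Nat.testBit_or, Nat.testBit_xor, testBit_full hb, hv _ h1, hv _ h2,
        hv _ h3, hv _ h4, hv _ h5, hv _ h6]
      revert ht
      generalize v t.1 = a, v t.2.1 = c, v t.2.2.1 = d, v t.2.2.2.1 = e, v t.2.2.2.2.1 = f,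
        v t.2.2.2.2.2 = g
      revert a c d e f g
      decide
  exact aux' gpIdx (fun _ h => h) _ (aux _ fun k hk => List.mem_range.mp hk)

theorem rowPat_lt (v : ℕ → Bool) (k : ℕ) : rowPat v k < 32 := by
  have h (c : Bool) : c.toNat ≤ 1 := Bool.toNat_le c
  have := h (v (quadIdx k 0))
  have := h (v (quadIdx k 1))
  have := h (v (quadIdx k 2))
  have := h (v (quadIdx k 3))
  have := h (v (quadIdx k 4))
  unfold rowPat
  omega

/-- The decision diagram computes a consequence of the chirotope axioms on six points. -/
theorem rows_sound (v : ℕ → Bool) (hg : ∀ t ∈ gpIdx, GPSign v t)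
    (ha : ∀ k < 6, rowPat v k ≠ 10 ∧ rowPat v k ≠ 21) (p q r s t : List ℕ) (c : ℕ)
    (hp : (p.getD (rowPat v 1) 0).testBit c = true) (hq : (q.getD (rowPat v 2) 0).testBit c = true)
    (hr : (r.getD (rowPat v 3) 0).testBit c = true) (hs : (s.getD (rowPat v 4) 0).testBit c = true)
    (ht : (t.getD (rowPat v 5) 0).testBit c = true) :
    ((rows Nat.land Nat.lor 0 p q r s t).getD (rowPat v 0) 0).testBit c = true := by
  obtain ⟨b, hb, hv⟩ := exists_index v
  have key := Nat.eq_of_beq_eq_true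
    (List.all_eq_true.mp validTable_rows _ (List.mem_range.mpr (rowPat_lt v 0)))
  have h0 : (Nat.land validTable (rowTable 0 (rowPat v 0))).testBit b = true := by
    refine (Nat.testBit_and _ _ _).trans ?_
    rw [validTable_testBit hb hv hg ha, rowTable_testBit hb hv (by omega) (rowPat_lt v 0)]
    simp
  rw [← key] at h0
  replace h0 := ((Nat.testBit_and _ _ _).symm.trans h0)
  rw [Bool.and_eq_true, rows_getD, LatExpr.eval_testBit] at h0
  rw [rows_getD, LatExpr.eval_testBit]
  have tab (k z : ℕ) (hk : k < 6) (h : ((rowTables k).getD z 0).testBit b = true) :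
      z = rowPat v k := by
    by_cases hz : z < 32
    · rw [rowTables, List.getD_eq_getElem _ _ (by simpa using hz)] at h
      simpa [rowTable_testBit hb hv hk hz] using h
    · rw [rowTables, List.getD_eq_default _ _ (by simpa using hz)] at h
      simp at h
  refine LatExpr.eval_mono (fun k z h => ?_) _ h0.2
  match k with
  | 0 => rwa [rowVal, tab 1 z (by omega) h]
  | 1 => rwa [rowVal, tab 2 z (by omega) h]
  | 2 => rwa [rowVal, tab 3 z (by omega) h]
  | 3 => rwa [rowVal, tab 4 z (by omega) h]
  | k + 4 => rwa [rowVal, tab 5 z (by omega) h] <;> simp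

/-- Weights whose sums over five-element and over six-element sets are pairwise distinct. -/
def wt (i : ℕ) : ℕ :=
  ([0, 1, 2, 4, 7, 13, 24, 44, 84, 161, 309] : List ℕ).getD i 0

/-- The triangles on `0, …, 10`, as a set of numbers `a + 11 * b + 121 * c` with `a < b < c`. -/
def faceBits : ℕ :=
3576149238422871986174719317069357239904809654827342130851784263612925408172834345130377891682709412141399950259011722159047655224269292047275329023819009742224016222520863609712998042234971296795959097450460502124358261796593084346327058174457639179259420290456806161223614925710480779118298498897194477990459737032957418334199904643367878089890105420702611005892791369208677021254033007137783808

/-- For each pattern, the set of addresses of the five-element sets on which it is allowed. -/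
def rootLanes : List ℕ :=
  [1062804109754140444077896862622910882580748360040357630474545473326755389788905844075552378562461070634494882241088278648733308057554066183209033616267440410153471245911039353751091712,
   528124120726953923505089677153852432899142796854199208386718035665401588547263914794266723761217832725249212812505247229744266041789998966369739795146468173551040948930102879599104,
   1062804236387426825138525518075765044423560816397471514409521960213239029296408750858751038394614287293398737405893018142199280563732120647697677654556186494748136856609413276286073344,
   1062804236387426825131327255994819778383521458080719687686367110627767860590551857893455941667022814216069950048322013691986296224590224413475242180167855473135704296138544258254649856,
   1062804236387426825138067334020730740227509897271679182208127313500105498146062005337150918322930720105061203508167313050126356646890848756914398575132678138453848122160606905942161920,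
   1062804236387426825138525518075765044423560816397471514409521960213239029296408750858751038394614287293398737405893018142199280563732120647697677654556186494748136856609413276286073344,
   1062795878590770640158620387607689256212809866540523032610746043566514754200581013261752531223622809886462062415221250331494743309754422195432352500372710167511281145238971838569132032,
   1062804236387426825138525408184402326993218241012543157230721669931142571147190770878051537720140835060546855633797267695897650408241830301694399795311791004425406603845969193986963968,
   1062804236387426825138525518075765044423560816397471514409521960213239029296408750858751038394614287293398737405893018142199280563732120647697677654556186494748136856609413276286073344,
   458188114235061428404852991041396616598404379170684161502488545178515145966175192234192616931725402738500722902902783091830568070696190325758044756485313379958784,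
   0,
   1062804236387426825138525518075765044423560816397471514409521960213239029296408750858751038394614287293398737405893018142199280563732120647697677654556186494748136856609413276286073344,
   528250753892627759349104970827789764374580942680467972473983387255601831494820334819734056379649836957052877773985670760567341157217384232128421102328781655490298425776009198451200,
   1062284533381271072530738433525917549261842830013887267366467790623925705708792314465326246086269013749132359221650525998661194316072592209065966809935574803122718176531951466279082496,
   1062804236387426825138525518075765044423560816397471514409521960213239029296408750858751038394614287293398737405893018142199280563732120647697677654556186494748136856609413276286073344,
   1062804235883648128973489421992716649101782026699819645986355723813309105046200184221280922302150824485086329679519041796641889821268061424825675263657355918682798115458802804121930240,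
   1062804235883648128973489421992716649101782026699819645986355723813309105046200184221280922310298968390424274024592824550279402465473935022325383349497275813033049941431523777065257537,
   1062804236387426825138525518075765044423560816397471514409521960213239029296408750858751038402762431198736681750966800895836793207937994245197385740396106389098388682582134249229531713,
   1062284533381271072530738433525917549261842830013887267366467790623925705708792314465326246094417157654470303566724308752298706960278465806565674895775494697472970002504672439222540865,
   528250753892627759349104970827789764374580942680467972473983387255601831494820334819734056379649836957052877773985670760567341157217384232128421102328781655641414153227975284374081,
   1062804236387426825138525518075765044423560816397471514409521960213239029296408750858751038402762431198736681750966800895836793207937994245197385740396106389098388682582134249229531713,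
   0,
   458188114235061428404852991041396616598404379170684161502488545178515154114319097572136962005508156376013367108776357755575570615257987743434359537284104199471169,
   1062804236387426825138525518075765044423560816397471514409521960213239029296408750858751038402762431198736681750966800895836793207937994245197385740396106389098388682582134249229531713,
   1062804236387426825138525408184402326993218241012543157230721669931142571147190770878051537728288978965884799978871050449535163052447703899194107881151710898775658429818690166930422337,
   1062795878590770640158620387607689256212809866540523032610746043566514754200581013261752531231770953791800006760295033085132255953960295792932060586212630061861532971211692811512459265,
   1062804236387426825138525518075765044423560816397471514409521960213239029296408750858751038402762431198736681750966800895836793207937994245197385740396106389098388682582134249229531713,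
   1062804236387426825138067334020730740227509897271679182208127313500105498146062005337150918322930720105061203508167313050126356646890848756914398575132678138453848122160606905942161920,
   1062804236387426825131327255994819778383521458080719687686367110627767860590551857893455941675170958121407894393395796445623808868796098010974950266007775367485956122111265093759154753,
   1062804236387426825138525518075765044423560816397471514409521960213239029296408750858751038402762431198736681750966800895836793207937994245197385740396106389098388682582134249229531713,
   528124120726953923505089677153852432899142796854199208386718035665401588547263914794266731909361738063193557886288000867256910247663596466077825635066362523802866921651075823057473,
   1062804109754140444077896862622910882580748360040357630474545473326755389788905844075552378562461070634494882241088278648733308057554066206044996699562798507086046757102961673314122305]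

/-- Entry `6 * k + i` is the set of addresses of the six-element sets whose element of rank `k`
is `k + i`. -/
def baseMasks : List ℕ :=
  [1062804173070783634601016499716320486658371641118062442517862855970065767626207375914220829666649234823797037715857620178548229350505591949840988120957582265212013296559481060459552768,
   2125608092874994507080789974279965386255823599743166285648059563811252473603083985461031057943470014170537481972638276926320935471857923987879386068278112125729904938960784174545371136,
   4251215172683697965906952234230049576266664570877817043740323506816700291062806166816562591494351281458915523533059871845286154130316174849917877112159200351239383062060506545739792384,
   17004844481674135106295806229614652893063474518697152741895524449350594266764785412969421695926976170097309286665588512301153535089300422754150218875581325393006783228296753737971531776,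
   136037718473511055929043126219309825469521693200800878350656538470016649252032281277371508189341573657679557498313882931760521017580672932877925914360659167274662530960945726136078303232,
   8702164874309912144930213176155645990168053640839691029699692760275411924760203145038438437113516616399082774302662672635438355868101955410485575332111767174247731541367082500615833649152,
   126633286381060621512576337793530459841246479299693833074064439530824665383183705300694914227738528296729538481715387761614576629955901295086818526202347060827079088973186867200,
   759799718286190970785747410897183736971456386645666846715604353492107521353079124643294441560161619580309162511505516787610049754844380671268297767925165320111895796352513212416,
   7091464037331332751184446176117751392897106175501966274190338340517650317173754862543147062668135529353266659801597496098126484371032415564188211770755228452696226056694682091520,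
   186404197551353050284712538829269724065373608249237841219639610362595999828489115850810122714227900586611603507647132189586344342190082588626896967211132781327358631648333257506816,
   78322181056409987037424582996534280039250894256145373058005489825890836529454512172125383014643402289275481445715464426572677956082514202753193509830731107291410700701909153572978688,
   8862568548140575808734468814534491515621590762393254670505924890011933799838180522345665512797615860671087351807509115942073022828073072996787250365699276554534768585159371252763415543808,
   28793048285102643999837012670414858749358621463713948806745157670517860145840634378258366678011396464468297012901670815171183208768898214819507475096456247767998464,
   806205351982874031995435687894179148865536894412786509419151931872954265950132320004948341202357121556749239945914167606058837622820924568289316876850171991096819712,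
   58046785342766930303670985406977246555212060612707091748424548943562332724465899987822486176955548675051715757172394402482661067120359889992726286712878095136819511296,
   90516130032911479889368611060840924402446773963962430836581987723893390592511294399452217762405580267103405584704560843189639749616402088594444012231796917154296627200000,
   74879158279252905595222001582106634696143731427728615725894002582871042618020930352802705055550976073226684172898597621458125869953551344139719581158494420006659051237016600576,
   8862647064628847563218876145063060006049435714726318132126821533304468755439783096712453853763230659307338459767220831379073070119574429156408097668155644673279240393985504823361300070400,
   23817051317718446589520400144898918302960769493504764480092367354492212927837441538443404736257811939007953865194523460443780378676657397760,
   5525555905710679608768732833616549046286898522251138077968513630970882346606266861436532276460461038532743035542504364598871125840455576584192,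
   24937405411703922317091439767714963419932044019497709413789169139257961550815986080020657637554274385692944693191616414093960782000428745773547520,
   78561299667542197296503519440600720766225179078681579306829914688070748666702371858906877679114470830590432596088990823092007929301121316463887096217600,
   68102280105628433347766609990699229763125400378949998343538800044155063614076596313103506188274054293005415672410274174726252347685724845835260016466077217386921984,
   8862647064703726812073072765032691096985147291263955449880153356322256521862901795141468930130304240472505864635378191367095177576968132121193423958866712720690835575619216563288137531392,
   1042962419883256876169444192465601618458351820479962634987509746476832233724508284536762671104,
   15552655605299126537438751798047051334450942346997202812933745339462522269299867539012204829343744,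
   143165539268479952942085220306259542509844363488724504888118384357806115901848546793442701993640854552576,
   472823773556506361957003862621400749964653663242233294007039007115946642987057382022374654705136028302706292220231680,
   450663086192772657328622354270043347941611320628978532513213436215365154011886904228472382652373956604252117084819588934092811066497224933376,
   8862647064703726812073140867312796803979819667920265020371378411792754359717475404665832349022869962182254475640654518853907974914119906152087186128476297991335639759698042689098736467968,
   8192,
   250198622208,
   2414847388140523386568704,
   8769004245337804872333397856527403508584939520000,
   1263026981219629992492764410768995897920660305810527396132330752759405644621500720495092897415168,
   8862647064703726812073140867312796803979819668370928106564151069121377186811292309256971180214862655537682898638099289079454287819064302637608889338980844929918537263978393607819206066176]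

/-- A case distinction on the patterns of five-element sets. The label of a leaf is the number of
the batch in which it is refuted. -/
inductive CaseTree
  | leaf (b : ℕ)
  | node (a m : ℕ) (l r : CaseTree)

/-- The case distinction used for the fixed set of triangles. -/
def caseTree : CaseTree :=
  .node 302 4042322160 (.node 302 4278255360 (.node 302 1073741826 (.node 37 1073741826 (.node 344
  3435973836 (.node 345 134217744 (.node 57 3435973836 (.leaf 0) (.leaf 1)) (.node 48 2863311530
  (.node 48 2147483649 (.leaf 5) (.leaf 3)) (.leaf 1))) (.node 6 3435973836 (.node 342 2863311530
  (.node 346 134217744 (.leaf 1) (.node 342 4042322160 (.leaf 2) (.leaf 1))) (.node 342 4042322160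
  (.node 344 2863311530 (.leaf 1) (.leaf 1)) (.leaf 0))) (.node 345 16777344 (.node 342 16777344
  (.leaf 0) (.leaf 2)) (.leaf 0)))) (.node 0 4042322160 (.node 347 33554496 (.node 350 134217744
  (.node 345 2863311530 (.leaf 0) (.leaf 3)) (.node 350 67108896 (.node 308 2863311530 (.leaf 1)
  (.leaf 3)) (.node 307 2863311530 (.leaf 1) (.leaf 1)))) (.node 342 3435973836 (.node 307
  2863311530 (.leaf 1) (.leaf 3)) (.node 347 2863311530 (.leaf 0) (.leaf 0)))) (.node 324
  2863311530 (.node 305 3435973836 (.node 325 2863311530 (.leaf 1) (.leaf 0)) (.node 461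
  2863311530 (.node 461 3435973836 (.leaf 0) (.leaf 3)) (.leaf 1))) (.node 324 268435464 (.leaf 0)
  (.node 305 3435973836 (.leaf 2) (.leaf 2)))))) (.node 154 270336 (.node 77 4042322160 (.node 382
  3435973836 (.node 302 2863311530 (.node 384 33554496 (.node 37 2863311530 (.node 424 2863311530
  (.leaf 0) (.leaf 0)) (.node 344 2863311530 (.leaf 1) (.leaf 0))) (.node 234 2863311530 (.leaf 0)
  (.leaf 2))) (.node 37 4042322160 (.node 462 4194816 (.leaf 4) (.node 344 3435973836 (.leaf 0)
  (.leaf 3))) (.node 342 3435973836 (.leaf 3) (.node 37 528384 (.node 194 3435973836 (.leaf 0)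
  (.leaf 0)) (.leaf 0))))) (.node 77 3435973836 (.node 77 2863311530 (.leaf 3) (.leaf 2)) (.leaf
  0))) (.node 77 270336 (.node 237 2863311530 (.node 160 2863311530 (.leaf 1) (.leaf 0)) (.node
  382 2863311530 (.leaf 2) (.leaf 1))) (.node 234 2863311530 (.leaf 2) (.leaf 3)))) (.node 77
  3435973836 (.node 459 268435464 (.node 305 4042322160 (.node 305 268435464 (.node 307 3435973836
  (.node 37 2863311530 (.leaf 2) (.leaf 2)) (.node 348 2863311530 (.leaf 0) (.leaf 3))) (.node 464
  268435464 (.node 465 4194816 (.leaf 0) (.leaf 1)) (.node 461 3435973836 (.leaf 1) (.leaf 1))))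
  (.node 234 4042322160 (.node 502 2863311530 (.leaf 2) (.leaf 2)) (.node 461 268435464 (.node 302
  2863311530 (.leaf 0) (.leaf 3)) (.node 501 3435973836 (.leaf 0) (.leaf 1))))) (.node 154
  2863311530 (.node 463 2147483649 (.node 154 3435973836 (.leaf 2) (.leaf 0)) (.node 470
  2863311530 (.node 163 4042322160 (.leaf 1) (.leaf 4)) (.node 234 2863311530 (.leaf 0) (.leaf
  1)))) (.node 462 98304 (.node 166 2863311530 (.node 154 4042322160 (.leaf 3) (.leaf 1)) (.node
  459 4042322160 (.node 311 4042322160 (.node 234 4042322160 (.leaf 0) (.node 481 2863311530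
  (.leaf 0) (.leaf 2))) (.node 302 2863311530 (.leaf 1) (.leaf 4))) (.node 311 2863311530 (.node
  159 2863311530 (.leaf 2) (.leaf 3)) (.node 163 2863311530 (.leaf 0) (.leaf 0))))) (.node 462
  2863311530 (.node 237 16777344 (.leaf 2) (.node 154 4042322160 (.leaf 0) (.leaf 0))) (.leaf
  0))))) (.node 385 16777344 (.node 77 4042322160 (.node 390 2863311530 (.node 345 2863311530
  (.leaf 2) (.leaf 0)) (.node 350 2863311530 (.leaf 2) (.leaf 1))) (.node 384 2863311530 (.node 77
  2863311530 (.leaf 1) (.leaf 2)) (.node 461 3435973836 (.leaf 1) (.leaf 1)))) (.node 384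
  3435973836 (.node 302 2863311530 (.node 154 4042322160 (.node 77 4042322160 (.leaf 3) (.leaf 0))
  (.leaf 3)) (.node 311 4042322160 (.leaf 3) (.leaf 1))) (.node 384 2863311530 (.node 37
  2863311530 (.leaf 3) (.node 344 3435973836 (.leaf 0) (.leaf 1))) (.node 37 3435973836 (.node 385
  2863311530 (.node 100 2863311530 (.leaf 2) (.node 302 2863311530 (.leaf 0) (.leaf 4))) (.node
  345 2863311530 (.leaf 0) (.leaf 3))) (.node 37 2863311530 (.node 385 2863311530 (.leaf 3) (.leaf
  2)) (.node 385 2863311530 (.leaf 5) (.leaf 4)))))))))) (.node 302 1050624 (.node 385 2863311530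
  (.node 385 268435464 (.node 77 4278255360 (.node 234 2863311530 (.node 322 4042322160 (.leaf 2)
  (.leaf 2)) (.leaf 3)) (.node 404 2863311530 (.leaf 4) (.leaf 4))) (.node 385 67108896 (.node 342
  3435973836 (.leaf 1) (.leaf 0)) (.node 393 3435973836 (.leaf 4) (.leaf 1)))) (.node 344
  3435973836 (.node 342 2863311530 (.node 345 268435464 (.leaf 0) (.node 154 4042322160 (.node 501
  2863311530 (.leaf 0) (.node 154 2863311530 (.leaf 0) (.leaf 2))) (.node 345 4194816 (.node 37
  2863311530 (.leaf 0) (.leaf 0)) (.leaf 2)))) (.node 342 3435973836 (.node 117 3435973836 (.leaf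
  1) (.leaf 3)) (.node 342 4042322160 (.leaf 1) (.leaf 2)))) (.node 154 4042322160 (.node 382
  4042322160 (.node 311 2863311530 (.leaf 1) (.node 311 3435973836 (.leaf 1) (.leaf 4))) (.node 77
  4042322160 (.leaf 2) (.node 37 2863311530 (.leaf 0) (.leaf 0)))) (.node 461 3435973836 (.node 37
  2863311530 (.leaf 4) (.node 37 4042322160 (.leaf 4) (.leaf 0))) (.node 37 2863311530 (.node 154
  4278255360 (.leaf 1) (.leaf 2)) (.node 6 4278255360 (.leaf 2) (.leaf 3))))))) (.node 313 270336
  (.node 393 3435973836 (.node 324 2863311530 (.leaf 2) (.leaf 1)) (.node 88 2863311530 (.node 324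
  2863311530 (.leaf 2) (.leaf 3)) (.node 77 2863311530 (.node 26 2863311530 (.leaf 1) (.leaf 1))
  (.node 77 4278255360 (.node 11 2863311530 (.node 6 3435973836 (.leaf 4) (.leaf 3)) (.leaf 0))
  (.node 86 3435973836 (.leaf 1) (.leaf 0)))))) (.node 17 4278255360 (.node 17 16777344 (.node 302
  2863311530 (.node 314 2863311530 (.node 154 16777344 (.leaf 0) (.node 154 4278255360 (.leaf 0)
  (.leaf 1))) (.node 154 16777344 (.leaf 0) (.node 154 4278255360 (.leaf 3) (.leaf 2)))) (.node
  322 3435973836 (.node 322 4042322160 (.leaf 2) (.leaf 2)) (.node 26 2863311530 (.node 322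
  4042322160 (.leaf 0) (.leaf 4)) (.node 344 2863311530 (.leaf 0) (.leaf 0))))) (.node 17
  2147483649 (.node 302 2863311530 (.node 174 4042322160 (.node 324 2863311530 (.leaf 1) (.leaf
  2)) (.leaf 4)) (.node 333 2863311530 (.leaf 2) (.leaf 4))) (.node 322 270336 (.node 325
  2863311530 (.node 154 2863311530 (.leaf 1) (.leaf 3)) (.node 311 2863311530 (.leaf 0) (.leaf
  5))) (.leaf 3)))) (.node 325 2863311530 (.node 17 2863311530 (.node 37 4278255360 (.node 322
  4042322160 (.leaf 0) (.leaf 1)) (.node 37 4042322160 (.leaf 3) (.leaf 1))) (.node 60 2863311530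
  (.node 23 2863311530 (.leaf 1) (.node 17 4042322160 (.leaf 0) (.leaf 2))) (.node 17 4042322160
  (.leaf 0) (.node 324 2863311530 (.leaf 3) (.leaf 0))))) (.node 77 4278255360 (.node 97 270336
  (.node 382 4042322160 (.leaf 4) (.leaf 0)) (.node 382 4042322160 (.leaf 0) (.leaf 0))) (.node
  322 4042322160 (.leaf 4) (.node 324 2863311530 (.node 37 4278255360 (.leaf 4) (.node 77
  4042322160 (.leaf 0) (.leaf 2))) (.node 384 2863311530 (.leaf 0) (.leaf 2)))))))))) (.node 154
  4042322160 (.node 154 3435973836 (.node 154 1073741826 (.node 6 1073741826 (.node 313 270336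
  (.leaf 1) (.node 17 4278255360 (.node 459 3435973836 (.node 26 2863311530 (.leaf 4) (.leaf 2))
  (.node 26 2863311530 (.leaf 3) (.leaf 2))) (.leaf 3))) (.node 167 16777344 (.node 313 2863311530
  (.node 311 4042322160 (.node 159 2863311530 (.node 475 33554496 (.leaf 2) (.leaf 4)) (.node 470
  3435973836 (.leaf 3) (.leaf 2))) (.node 461 3435973836 (.node 470 3435973836 (.leaf 0) (.leaf
  0)) (.leaf 2))) (.node 313 536870916 (.node 470 2863311530 (.leaf 0) (.leaf 0)) (.leaf 2)))
  (.node 176 2863311530 (.node 28 2863311530 (.leaf 3) (.node 197 2863311530 (.leaf 1) (.leaf 2)))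
  (.node 163 270336 (.leaf 4) (.node 0 4042322160 (.leaf 2) (.leaf 5)))))) (.node 17 4042322160
  (.node 176 2863311530 (.node 17 2863311530 (.node 17 4278255360 (.leaf 3) (.leaf 5)) (.node 17
  4278255360 (.node 154 4278255360 (.leaf 3) (.leaf 0)) (.leaf 1))) (.node 174 4042322160 (.leaf
  2) (.node 17 4278255360 (.leaf 3) (.leaf 3)))) (.node 17 16777344 (.node 154 4278255360 (.node
  325 2863311530 (.node 302 4278255360 (.leaf 1) (.leaf 2)) (.node 176 2863311530 (.leaf 2) (.leaf
  2))) (.node 459 3435973836 (.node 461 3435973836 (.leaf 0) (.leaf 1)) (.node 385 270336 (.leaf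
  0) (.leaf 4)))) (.node 174 4042322160 (.node 176 2863311530 (.leaf 0) (.node 459 2863311530
  (.node 17 2863311530 (.leaf 0) (.leaf 1)) (.leaf 5))) (.node 59 3435973836 (.node 216 3435973836
  (.node 119 3435973836 (.leaf 3) (.leaf 5)) (.node 60 2863311530 (.leaf 3) (.leaf 5))) (.node 194
  4042322160 (.leaf 1) (.leaf 1))))))) (.node 154 536870916 (.node 166 2863311530 (.node 6 270336
  (.node 11 2863311530 (.leaf 2) (.leaf 3)) (.node 302 270336 (.node 17 4042322160 (.node 28
  3435973836 (.leaf 1) (.leaf 1)) (.leaf 0)) (.node 302 3435973836 (.leaf 3) (.leaf 0)))) (.node 0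
  3435973836 (.node 37 2863311530 (.node 194 4042322160 (.leaf 3) (.leaf 2)) (.node 0 4042322160
  (.node 0 4278255360 (.leaf 3) (.leaf 0)) (.node 37 4042322160 (.leaf 1) (.node 177 2863311530
  (.node 194 2863311530 (.leaf 2) (.leaf 1)) (.node 22 2863311530 (.leaf 0) (.leaf 3)))))) (.node
  160 33554496 (.node 0 4042322160 (.leaf 0) (.leaf 1)) (.leaf 0)))) (.node 302 3435973836 (.node
  166 2863311530 (.node 333 3435973836 (.node 459 4042322160 (.leaf 2) (.leaf 2)) (.node 459
  2863311530 (.leaf 3) (.leaf 4))) (.node 459 2863311530 (.node 163 2863311530 (.node 167 33554496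
  (.leaf 2) (.leaf 1)) (.node 163 3435973836 (.node 6 4042322160 (.leaf 0) (.leaf 1)) (.leaf 3)))
  (.node 163 3435973836 (.node 459 3435973836 (.leaf 3) (.leaf 0)) (.node 311 4042322160 (.leaf 1)
  (.leaf 1))))) (.node 302 4278255360 (.leaf 1) (.node 77 3435973836 (.leaf 0) (.leaf 1))))))
  (.node 461 3435973836 (.node 461 268435464 (.node 459 3435973836 (.node 462 1073741826 (.node
  157 4042322160 (.leaf 1) (.leaf 0)) (.node 176 2863311530 (.node 37 2863311530 (.node 154
  4278255360 (.leaf 0) (.leaf 3)) (.node 154 4278255360 (.leaf 1) (.leaf 2))) (.node 463 33554496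
  (.node 77 3435973836 (.leaf 2) (.leaf 0)) (.node 481 2863311530 (.leaf 1) (.leaf 0))))) (.node
  462 268435464 (.node 154 16777344 (.node 302 4278255360 (.leaf 2) (.leaf 2)) (.node 37
  3435973836 (.leaf 0) (.leaf 2))) (.node 459 16777344 (.node 159 3435973836 (.leaf 0) (.leaf 1))
  (.leaf 0)))) (.node 302 33554496 (.node 313 3435973836 (.node 154 270336 (.node 462 2863311530
  (.node 313 528384 (.node 6 2863311530 (.leaf 4) (.node 6 4278255360 (.leaf 0) (.leaf 3))) (.node
  6 4042322160 (.leaf 1) (.leaf 1))) (.node 544 2863311530 (.leaf 4) (.node 248 2863311530 (.node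
  6 2863311530 (.leaf 0) (.leaf 1)) (.node 459 2863311530 (.leaf 1) (.leaf 1))))) (.node 154
  33554496 (.leaf 0) (.leaf 1))) (.node 324 3435973836 (.node 311 3435973836 (.leaf 1) (.node 311
  33554496 (.node 154 3435973836 (.leaf 3) (.leaf 2)) (.leaf 0))) (.node 311 2863311530 (.node 28
  16777344 (.leaf 1) (.node 28 2863311530 (.leaf 0) (.leaf 1))) (.leaf 3)))) (.node 302 147456
  (.node 459 3435973836 (.node 17 2863311530 (.node 196 3435973836 (.node 37 4278255360 (.leaf 0)
  (.leaf 2)) (.node 154 4278255360 (.leaf 2) (.leaf 3))) (.node 0 2863311530 (.node 462 2863311530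
  (.leaf 1) (.leaf 2)) (.node 471 2863311530 (.leaf 4) (.leaf 5)))) (.node 154 2863311530 (.leaf
  0) (.leaf 1))) (.node 302 98304 (.node 382 2863311530 (.node 234 3435973836 (.leaf 1) (.leaf 2))
  (.node 37 2863311530 (.leaf 3) (.node 314 2863311530 (.leaf 2) (.leaf 1)))) (.node 159
  3435973836 (.leaf 3) (.leaf 0)))))) (.node 461 1073741826 (.node 307 2863311530 (.node 459
  3435973836 (.node 154 33554496 (.node 0 3435973836 (.node 0 4042322160 (.leaf 0) (.leaf 0))
  (.leaf 5)) (.node 154 270336 (.node 459 2863311530 (.leaf 3) (.leaf 0)) (.node 459 270336 (.leaf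
  3) (.leaf 1)))) (.node 462 1073741826 (.node 302 16777344 (.node 154 2863311530 (.leaf 0) (.leaf
  1)) (.leaf 2)) (.node 154 33554496 (.node 464 3435973836 (.leaf 2) (.leaf 2)) (.node 462
  2863311530 (.leaf 4) (.leaf 1))))) (.node 159 3435973836 (.node 0 4042322160 (.leaf 0) (.leaf
  1)) (.node 464 3435973836 (.leaf 3) (.node 316 2863311530 (.leaf 2) (.leaf 1))))) (.node 154
  98304 (.node 302 98304 (.node 311 3435973836 (.leaf 2) (.leaf 3)) (.node 462 4194816 (.node 463
  1073741826 (.node 166 4194816 (.leaf 0) (.node 163 4042322160 (.leaf 0) (.leaf 2))) (.node 174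
  2863311530 (.node 174 4042322160 (.leaf 1) (.leaf 2)) (.node 384 3435973836 (.node 481
  2863311530 (.leaf 1) (.leaf 4)) (.node 461 2863311530 (.leaf 4) (.leaf 2))))) (.leaf 0))) (.node
  154 147456 (.node 159 2863311530 (.node 0 4278255360 (.node 165 2863311530 (.leaf 0) (.leaf 2))
  (.leaf 2)) (.node 6 4042322160 (.node 470 2863311530 (.leaf 1) (.leaf 4)) (.node 37 4042322160
  (.leaf 3) (.node 163 3435973836 (.leaf 5) (.leaf 4))))) (.node 154 33554496 (.leaf 1) (.leaf
  1)))))))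

/-- Evaluate a number before passing it on. -/
def strict {α : Type} (n : ℕ) (k : ℕ → α) : α :=
  Nat.rec (k 0) (fun m _ => k (Nat.succ m)) n

theorem strict_eq {α : Type} (n : ℕ) (k : ℕ → α) : strict n k = k n := by
  cases n <;> rfl

/-- Evaluate a list of numbers before passing it on. The low bits of the entries are filled with
a running number, which keeps the entries apart. -/
def strictList {α : Type} (l : List ℕ) : ℕ → (List ℕ → ℕ → α) → α :=
  List.rec (fun c k => k [] c) (fun a _ ih c k => strict (Nat.lor a c) fun b =>
    strict (Nat.succ c) fun c => ih c fun t => k (b :: t)) l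

/-- `List.map` for evaluation in the kernel. -/
def mapN (f : ℕ → ℕ) (l : List ℕ) : List ℕ :=
  List.rec [] (fun a _ ih => f a :: ih) l

/-- `List.zipWith` for evaluation in the kernel. -/
def zipN (f : ℕ → ℕ → ℕ) (l : List ℕ) : List ℕ → List ℕ :=
  List.rec (fun _ => []) (fun a _ ih l' => List.casesOn l' [] fun b t => f a b :: ih t) l

/-- Shifts and masks that connect the five-element sets missing the element of rank `r` with the
six-element sets. -/
structure Mask where
  (u0 u1 u2 u3 u4 u5 m0 m1 m2 m3 m4 m5 n0 n1 n2 n3 n4 n5 : ℕ)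

/-- Move a lane from five-element sets to six-element sets. -/
def Mask.up (M : Mask) (d : ℕ) : ℕ :=
  Nat.lor (Nat.land (Nat.shiftLeft d M.u0) M.m0) (Nat.lor (Nat.land (Nat.shiftLeft d M.u1) M.m1)
  (Nat.lor (Nat.land (Nat.shiftLeft d M.u2) M.m2) (Nat.lor (Nat.land (Nat.shiftLeft d M.u3) M.m3)
  (Nat.lor (Nat.land (Nat.shiftLeft d M.u4) M.m4) (Nat.land (Nat.shiftLeft d M.u5) M.m5)))))

/-- Restrict the lane `d` of five-element sets by the lane `h` of six-element sets. -/
def Mask.down (M : Mask) (d h : ℕ) : ℕ :=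
  Nat.land (Nat.lor (Nat.shiftRight h M.u0) M.n0) (Nat.land (Nat.lor (Nat.shiftRight h M.u1) M.n1)
  (Nat.land (Nat.lor (Nat.shiftRight h M.u2) M.n2) (Nat.land (Nat.lor (Nat.shiftRight h M.u3) M.n3)
  (Nat.land (Nat.lor (Nat.shiftRight h M.u4) M.n4)
  (Nat.land (Nat.lor (Nat.shiftRight h M.u5) M.n5) d)))))

/-- Restrict the patterns of the row of mask `M` by those of the other five rows. -/
def stp (M a b c d e : Mask) (ta tb tc td te : List ℕ) (D : List ℕ) : List ℕ :=
  zipN M.down D (rows Nat.land Nat.lor 0 (mapN a.up ta) (mapN b.up tb) (mapN c.up tc)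
    (mapN d.up td) (mapN e.up te))

/-- Restrict the patterns of all six rows. -/
def sweep {α : Type} (a b c d e f : Mask) (D : List ℕ) (s : ℕ) (k : List ℕ → ℕ → α) : α :=
  strictList (stp a b c d e f D D D D D D) s fun D s => (fun E =>
  strictList (stp b a c d e f D E E E E D) s fun D s => (fun E F =>
  strictList (stp c a b d e f E E F F F D) s fun D s => (fun E F =>
  strictList (stp d a b c e f E E E F F D) s fun D s => (fun E F =>
  strictList (stp e a b c d f E E E E F D) s fun D s => (fun E =>
  strictList (stp f a b c d e E E E E E D) s k) (front4 D)) (front3 D) (front4 D))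
    (front2 D) (front3 D)) (front1 D) (front2 D)) (front1 D)

/-- Iterated sweeps. -/
def iter {α : Type} (n : ℕ) (a b c d e f : Mask) :
    List ℕ → ℕ → (List ℕ → ℕ → α) → α :=
  Nat.rec (fun D s k => k D s)
    (fun _ ih D s k => sweep a b c d e f D s fun D s => ih D s k) n

/-- No patterns are left. -/
def allZero (l : List ℕ) (_ : ℕ) : Bool :=
  List.rec true (fun a _ ih => Bool.rec false ih (Nat.beq (Nat.shiftRight a 32) 0)) l

/-- Concatenation of blocks of 622 bits. -/
def pack (l : List ℕ) : ℕ :=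
  List.rec 0 (fun x _ ih => Nat.lor (Nat.shiftLeft ih 622) x) l

/-- Blocks of 622 bits, shifted by 32. -/
def lanes (n x : ℕ) : ℕ :=
  Nat.shiftLeft (Nat.rec 0 (fun _ ih => Nat.lor (Nat.shiftLeft ih 622) x) n) 32

/-- The base mask for elements `k + i` of rank `k`. -/
def baseMask (k i : ℕ) : ℕ := baseMasks.getD (6 * k + i) 0

/-- The addresses of the five-element sets of which `k + i` is not the missing element
of rank `k`. -/
def baseHole (k i : ℕ) : ℕ :=
  Nat.xor (Nat.pred (Nat.pow 2 622)) (Nat.shiftRight (baseMask k i) (wt (k + i)))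

/-- The mask of rank `k` for `n` blocks. -/
def mkMask (n k : ℕ) : Mask :=
  ⟨wt k, wt (k + 1), wt (k + 2), wt (k + 3), wt (k + 4), wt (k + 5),
    lanes n (baseMask k 0), lanes n (baseMask k 1), lanes n (baseMask k 2),
    lanes n (baseMask k 3), lanes n (baseMask k 4), lanes n (baseMask k 5),
    lanes n (baseHole k 0), lanes n (baseHole k 1), lanes n (baseHole k 2),
    lanes n (baseHole k 3), lanes n (baseHole k 4), lanes n (baseHole k 5)⟩

/-- Evaluate the mask of rank `k` and pass it on. -/
def withMask {α : Type} (n k : ℕ) (f : Mask → α) : α :=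
  strict (wt k) fun u0 => strict (wt (k + 1)) fun u1 => strict (wt (k + 2)) fun u2 =>
  strict (wt (k + 3)) fun u3 => strict (wt (k + 4)) fun u4 => strict (wt (k + 5)) fun u5 =>
  strict (lanes n (baseMask k 0)) fun m0 => strict (lanes n (baseMask k 1)) fun m1 =>
  strict (lanes n (baseMask k 2)) fun m2 => strict (lanes n (baseMask k 3)) fun m3 =>
  strict (lanes n (baseMask k 4)) fun m4 => strict (lanes n (baseMask k 5)) fun m5 =>
  strict (lanes n (baseHole k 0)) fun n0 => strict (lanes n (baseHole k 1)) fun n1 =>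
  strict (lanes n (baseHole k 2)) fun n2 => strict (lanes n (baseHole k 3)) fun n3 =>
  strict (lanes n (baseHole k 4)) fun n4 => strict (lanes n (baseHole k 5)) fun n5 =>
  f ⟨u0, u1, u2, u3, u4, u5, m0, m1, m2, m3, m4, m5, n0, n1, n2, n3, n4, n5⟩

theorem withMask_eq {α : Type} (n k : ℕ) (f : Mask → α) : withMask n k f = f (mkMask n k) := by
  simp only [withMask, strict_eq, mkMask]

/-- The branches of a case tree that belong to batch `b`. A branch is a list of addresses with
sets of admissible patterns. -/
def CaseTree.branches (b : ℕ) : CaseTree → List (ℕ × ℕ) → List (List (ℕ × ℕ))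
  | .leaf c, p => bif Nat.beq c b then [p] else []
  | .node a m l r, p =>
    l.branches b ((a, m) :: p) ++ r.branches b ((a, Nat.xor m 4294967295) :: p)

/-- All labels of a case tree are smaller than `n`. -/
def CaseTree.labelsLT (n : ℕ) : CaseTree → Bool
  | .leaf c => Nat.blt c n
  | .node _ _ l r => l.labelsLT n && r.labelsLT n

/-- The addresses allowing pattern `z` in the branch `p`. -/
def branchLane (z x : ℕ) (p : List (ℕ × ℕ)) : ℕ :=
  List.rec x (fun q _ ih => bif Nat.testBit q.2 z then ih else
    Nat.land ih (Nat.xor (Nat.pred (Nat.pow 2 622)) (Nat.shiftLeft 1 q.1))) p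

/-- The initial lanes of the branches `P`. -/
def initLanes (P : List (List (ℕ × ℕ))) : List ℕ :=
  (List.range 32).map fun z =>
    Nat.shiftLeft (pack (P.map (branchLane z (rootLanes.getD z 0)))) 32

/-- Refute the branches `P` by `n` sweeps. -/
def refute (n : ℕ) (P : List (List (ℕ × ℕ))) : Bool :=
  strict P.length fun N =>
  withMask N 0 fun a => withMask N 1 fun b => withMask N 2 fun c => withMask N 3 fun d =>
  withMask N 4 fun e => withMask N 5 fun f =>
  strictList (initLanes P) 32 fun D s => iter n a b c d e f D s allZero

/-- The sign of an orientation. -/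
def chi (D : ℕ → ℕ → ℕ → ℕ → ℝ) (a b c d : ℕ) : Bool :=
  open Classical in decide (0 < D a b c d)

/-- The pattern of the signs of five points: the `j`-th bit belongs to the quadruple omitting the
`j`-th point. -/
def pat (D : ℕ → ℕ → ℕ → ℕ → ℝ) (a b c d e : ℕ) : ℕ :=
  (chi D b c d e).toNat + 2 * (chi D a c d e).toNat + 4 * (chi D a b d e).toNat +
    8 * (chi D a b c e).toNat + 16 * (chi D a b c d).toNat

/-- Orientations of eleven points in general position in three-space. -/
structure IsChirotope (D : ℕ → ℕ → ℕ → ℕ → ℝ) : Prop where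
  swap₁ : ∀ a b c d, D b a c d = -D a b c d
  swap₂ : ∀ a b c d, D a c b d = -D a b c d
  swap₃ : ∀ a b c d, D a b d c = -D a b c d
  gp : ∀ a b c d e f, D a b c d * D a b e f - D a b c e * D a b d f + D a b c f * D a b d e = 0
  ne_zero : ∀ a b c d, a < 11 → b < 11 → c < 11 → d < 11 → [a, b, c, d].Nodup → D a b c d ≠ 0
  acyc : ∀ a b c d e, a < 11 → b < 11 → c < 11 → d < 11 → e < 11 → [a, b, c, d, e].Nodup →
    pat D a b c d e ≠ 10 ∧ pat D a b c d e ≠ 21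

namespace IsChirotope

variable {D : ℕ → ℕ → ℕ → ℕ → ℝ}

theorem acbd (h : IsChirotope D) (a b c d : ℕ) : D a b c d = -D a c b d := by
  rw [h.swap₂ a b c d, neg_neg]

theorem acdb (h : IsChirotope D) (a b c d : ℕ) : D a b c d = D a c d b := by
  rw [h.acbd, h.swap₃ a c d b, neg_neg]

theorem cabd (h : IsChirotope D) (a b c d : ℕ) : D a b c d = D c a b d := by
  rw [h.acbd, h.swap₁ c a b d, neg_neg]

theorem cadb (h : IsChirotope D) (a b c d : ℕ) : D a b c d = -D c a d b := by
  rw [h.cabd, h.swap₃ c a d b]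

theorem cdab (h : IsChirotope D) (a b c d : ℕ) : D a b c d = D c d a b := by
  rw [h.cadb, h.swap₂ c d a b, neg_neg]

end IsChirotope

/-- The orientations of the quadruples of six points, in lexicographic order. -/
def quadVal (D : ℕ → ℕ → ℕ → ℕ → ℝ) (x p q r s t i : ℕ) : ℝ :=
  [D x p q r, D x p q s, D x p q t, D x p r s, D x p r t, D x p s t, D x q r s, D x q r t,
    D x q s t, D x r s t, D p q r s, D p q r t, D p q s t, D p r s t, D q r s t].getD i 0

theorem quadVal_gp {D : ℕ → ℕ → ℕ → ℕ → ℝ} (h : IsChirotope D) (x p q r s t : ℕ) :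
    ∀ u ∈ gpIdx, quadVal D x p q r s t u.1 * quadVal D x p q r s t u.2.1 -
      quadVal D x p q r s t u.2.2.1 * quadVal D x p q r s t u.2.2.2.1 +
      quadVal D x p q r s t u.2.2.2.2.1 * quadVal D x p q r s t u.2.2.2.2.2 = 0 := by
  simp only [gpIdx, List.forall_mem_cons, quadVal, List.getD_cons_zero, List.getD_cons_succ]
  refine ⟨?_, ?_, ?_, ?_, ?_, ?_, ?_, ?_, ?_, ?_, ?_, ?_, ?_, ?_, ?_, by simp⟩
  · exact h.gp x p q r s t
  · have g := h.gp x q p r s t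
    rw [h.acbd x q p r, h.acbd x q p s, h.acbd x q p t] at g
    linear_combination -g
  · have g := h.gp x r p q s t
    rw [h.acdb x r p q, h.acbd x r p s, h.acbd x r q t, h.acbd x r p t, h.acbd x r q s] at g
    linear_combination g
  · have g := h.gp x s p q r t
    rw [h.acdb x s p q, h.acbd x s r t, h.acdb x s p r, h.acbd x s q t, h.acbd x s p t,
      h.acdb x s q r] at g
    linear_combination -g
  · have g := h.gp x t p q r s
    rw [h.acdb x t p q, h.acdb x t r s, h.acdb x t p r, h.acdb x t q s, h.acdb x t p s,
      h.acdb x t q r] at g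
    linear_combination g
  · have g := h.gp p q x r s t
    rw [h.cabd p q x r, h.cabd p q x s, h.cabd p q x t] at g
    linear_combination g
  · have g := h.gp p r x q s t
    rw [h.cadb p r x q, h.cabd p r x s, h.acbd p r q t, h.cabd p r x t, h.acbd p r q s] at g
    linear_combination -g
  · have g := h.gp p s x q r t
    rw [h.cadb p s x q, h.acbd p s r t, h.cadb p s x r, h.acbd p s q t, h.cabd p s x t,
      h.acdb p s q r] at g
    linear_combination g
  · have g := h.gp p t x q r s
    rw [h.cadb p t x q, h.acdb p t r s, h.cadb p t x r, h.acdb p t q s, h.cadb p t x s,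
      h.acdb p t q r] at g
    linear_combination -g
  · have g := h.gp q r x p s t
    rw [h.cdab q r x p, h.cabd q r x s, h.cabd q r p t, h.cabd q r x t, h.cabd q r p s] at g
    linear_combination g
  · have g := h.gp q s x p r t
    rw [h.cdab q s x p, h.acbd q s r t, h.cadb q s x r, h.cabd q s p t, h.cabd q s x t,
      h.cadb q s p r] at g
    linear_combination -g
  · have g := h.gp q t x p r s
    rw [h.cdab q t x p, h.acdb q t r s, h.cadb q t x r, h.cadb q t p s, h.cadb q t x s,
      h.cadb q t p r] at g
    linear_combination g
  · have g := h.gp r s x p q t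
    rw [h.cdab r s x p, h.cabd r s q t, h.cdab r s x q, h.cabd r s p t, h.cabd r s x t,
      h.cdab r s p q] at g
    linear_combination g
  · have g := h.gp r t x p q s
    rw [h.cdab r t x p, h.cadb r t q s, h.cdab r t x q, h.cadb r t p s, h.cadb r t x s,
      h.cdab r t p q] at g
    linear_combination -g
  · have g := h.gp s t x p q r
    rw [h.cdab s t x p, h.cdab s t q r, h.cdab s t x q, h.cdab s t p r, h.cdab s t x r,
      h.cdab s t p q] at g
    linear_combination g

theorem gpSign_of_eq {w : ℕ → ℝ} (hw : ∀ i < 15, w i ≠ 0) {t : ℕ × ℕ × ℕ × ℕ × ℕ × ℕ}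
    (ht : t ∈ gpIdx)
    (h : w t.1 * w t.2.1 - w t.2.2.1 * w t.2.2.2.1 + w t.2.2.2.2.1 * w t.2.2.2.2.2 = 0) :
    GPSign (fun i => open Classical in decide (0 < w i)) t := by
  obtain ⟨h1, h2, h3, h4, h5, h6⟩ := gpIdx_lt t ht
  have sign (x y : ℝ) (hx : x ≠ 0) (hy : y ≠ 0) :
      x * y ≠ 0 ∧ (open Classical in (decide (0 < x) ^^ decide (0 < y)) = decide (x * y < 0)) := by
    rcases lt_or_gt_of_ne hx with hx' | hx' <;> rcases lt_or_gt_of_ne hy with hy' | hy'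
    · simp [hx, hy, hx'.not_gt, hy'.not_gt, (mul_pos_of_neg_of_neg hx' hy').le]
    · simp [hx, hy, hx'.not_gt, hy', mul_neg_of_neg_of_pos hx' hy']
    · simp [hx, hy, hx', hy'.not_gt, mul_neg_of_pos_of_neg hx' hy']
    · simp [hx, hy, hx', hy', (mul_pos hx' hy').le]
  obtain ⟨n1, e1⟩ := sign _ _ (hw _ h1) (hw _ h2)
  obtain ⟨n2, e2⟩ := sign _ _ (hw _ h3) (hw _ h4)
  obtain ⟨n3, e3⟩ := sign _ _ (hw _ h5) (hw _ h6)
  simp only [GPSign]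
  rw [e1, e2, e3]
  rcases lt_or_gt_of_ne n1 with g1 | g1 <;> rcases lt_or_gt_of_ne n3 with g3 | g3
  · right
    have : w t.2.2.1 * w t.2.2.2.1 < 0 := by linarith
    simp [g1, this]
  · left
    simp [g1, g3.le]
  · left
    simp [g1.le, g3]
  · right
    have : 0 < w t.2.2.1 * w t.2.2.2.1 := by linarith
    simp [g1.not_gt, this.not_gt]

/-- The restriction of a row by the other rows is sound. -/
theorem six_rows {D : ℕ → ℕ → ℕ → ℕ → ℝ} (h : IsChirotope D) {x p q r s t : ℕ}
    (hx : x < 11) (hp : p < 11) (hq : q < 11) (hr : r < 11) (hs : s < 11) (ht : t < 11)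
    (hd : [x, p, q, r, s, t].Nodup) (T₀ T₁ T₂ T₃ T₄ : List ℕ) (c : ℕ)
    (h₀ : (T₀.getD (pat D x q r s t) 0).testBit c = true)
    (h₁ : (T₁.getD (pat D x p r s t) 0).testBit c = true)
    (h₂ : (T₂.getD (pat D x p q s t) 0).testBit c = true)
    (h₃ : (T₃.getD (pat D x p q r t) 0).testBit c = true)
    (h₄ : (T₄.getD (pat D x p q r s) 0).testBit c = true) :
    ((rows Nat.land Nat.lor 0 T₀ T₁ T₂ T₃ T₄).getD (pat D p q r s t) 0).testBit c = true := by
  have hw : ∀ i < 15, quadVal D x p q r s t i ≠ 0 := by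
    intro i hi
    interval_cases i <;> refine h.ne_zero _ _ _ _ ‹_› ‹_› ‹_› ‹_› ?_ <;>
      simp only [List.nodup_cons, List.mem_cons, List.not_mem_nil, not_or] at hd ⊢ <;> tauto
  refine rows_sound (fun i => open Classical in decide (0 < quadVal D x p q r s t i))
    (fun u hu => gpSign_of_eq hw hu (quadVal_gp h x p q r s t u hu)) (fun k hk => ?_)
    T₀ T₁ T₂ T₃ T₄ c h₀ h₁ h₂ h₃ h₄
  interval_cases k <;> refine h.acyc _ _ _ _ _ ‹_› ‹_› ‹_› ‹_› ‹_› ?_ <;>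
      simp only [List.nodup_cons, List.mem_cons, List.not_mem_nil, not_or] at hd ⊢ <;> tauto

theorem chi_neg {D : ℕ → ℕ → ℕ → ℕ → ℝ} {a b c d p q r s : ℕ} (hn : D p q r s ≠ 0)
    (h : D a b c d = -D p q r s) : chi D a b c d = !chi D p q r s := by
  classical
  rcases lt_or_gt_of_ne hn with h' | h' <;> simp [chi, h, h', h'.le]

theorem chi_congr {D : ℕ → ℕ → ℕ → ℕ → ℝ} {a b c d p q r s : ℕ}
    (h : D a b c d = D p q r s) : chi D a b c d = chi D p q r s := by
  rw [chi, h, chi]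

namespace IsChirotope

variable {D : ℕ → ℕ → ℕ → ℕ → ℝ}

theorem chi_bacd (h : IsChirotope D) {a b c d : ℕ} (hn : D a b c d ≠ 0) :
    chi D b a c d = !chi D a b c d :=
  chi_neg hn (h.swap₁ a b c d)

theorem chi_cabd (h : IsChirotope D) (a b c d : ℕ) : chi D c a b d = chi D a b c d :=
  chi_congr (h.cabd a b c d).symm

theorem chi_dabc (h : IsChirotope D) {a b c d : ℕ} (hn : D a b c d ≠ 0) :
    chi D d a b c = !chi D a b c d :=
  chi_neg hn (by rw [h.swap₁ a d b c, h.acdb a d b c])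

theorem front1_pat (h : IsChirotope D) {a b c d e : ℕ} (ha : a < 11)
    (hb : b < 11) (hc : c < 11) (hd : d < 11) (he : e < 11) (hn : [a, b, c, d, e].Nodup)
    (l : List ℕ) : (front1 l).getD (pat D b a c d e) 0 = l.getD (pat D a b c d e) 0 := by
  have n (p q r s : ℕ) (hp : p < 11) (hq : q < 11) (hr : r < 11) (hs : s < 11)
    (hl : [p, q, r, s].Sublist [a, b, c, d, e]) := h.ne_zero p q r s hp hq hr hs (hn.sublist hl)
  unfold pat
  rw [h.chi_bacd (n a b d e ‹_› ‹_› ‹_› ‹_› (by simp)),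
    h.chi_bacd (n a b c e ‹_› ‹_› ‹_› ‹_› (by simp)),
    h.chi_bacd (n a b c d ‹_› ‹_› ‹_› ‹_› (by simp))]
  simp only [front1, fetch_eq, List.getD_tail_eq]
  generalize chi D b c d e = c0, chi D a c d e = c1, chi D a b d e = c2, chi D a b c e = c3,
    chi D a b c d = c4
  cases c0 <;> cases c1 <;> cases c2 <;> cases c3 <;> cases c4 <;> rfl

theorem front2_pat (h : IsChirotope D) {a b c d e : ℕ} (ha : a < 11)
    (hb : b < 11) (hc : c < 11) (hd : d < 11) (he : e < 11) (hn : [a, b, c, d, e].Nodup)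
    (l : List ℕ) : (front2 l).getD (pat D c a b d e) 0 = l.getD (pat D a b c d e) 0 := by
  have n (p q r s : ℕ) (hp : p < 11) (hq : q < 11) (hr : r < 11) (hs : s < 11)
    (hl : [p, q, r, s].Sublist [a, b, c, d, e]) := h.ne_zero p q r s hp hq hr hs (hn.sublist hl)
  unfold pat
  rw [h.chi_bacd (n b c d e ‹_› ‹_› ‹_› ‹_› (by simp)),
    h.chi_bacd (n a c d e ‹_› ‹_› ‹_› ‹_› (by simp)),
    h.chi_cabd a b c e,
    h.chi_cabd a b c d]
  simp only [front2, fetch_eq, List.getD_tail_eq]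
  generalize chi D b c d e = c0, chi D a c d e = c1, chi D a b d e = c2, chi D a b c e = c3,
    chi D a b c d = c4
  cases c0 <;> cases c1 <;> cases c2 <;> cases c3 <;> cases c4 <;> rfl

theorem front3_pat (h : IsChirotope D) {a b c d e : ℕ} (ha : a < 11)
    (hb : b < 11) (hc : c < 11) (hd : d < 11) (he : e < 11) (hn : [a, b, c, d, e].Nodup)
    (l : List ℕ) : (front3 l).getD (pat D d a b c e) 0 = l.getD (pat D a b c d e) 0 := by
  have n (p q r s : ℕ) (hp : p < 11) (hq : q < 11) (hr : r < 11) (hs : s < 11)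
    (hl : [p, q, r, s].Sublist [a, b, c, d, e]) := h.ne_zero p q r s hp hq hr hs (hn.sublist hl)
  unfold pat
  rw [h.chi_cabd b c d e,
    h.chi_cabd a c d e,
    h.chi_cabd a b d e,
    h.chi_dabc (n a b c d ‹_› ‹_› ‹_› ‹_› (by simp))]
  simp only [front3, fetch_eq, List.getD_tail_eq]
  generalize chi D b c d e = c0, chi D a c d e = c1, chi D a b d e = c2, chi D a b c e = c3,
    chi D a b c d = c4
  cases c0 <;> cases c1 <;> cases c2 <;> cases c3 <;> cases c4 <;> rfl

theorem front4_pat (h : IsChirotope D) {a b c d e : ℕ} (ha : a < 11)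
    (hb : b < 11) (hc : c < 11) (hd : d < 11) (he : e < 11) (hn : [a, b, c, d, e].Nodup)
    (l : List ℕ) : (front4 l).getD (pat D e a b c d) 0 = l.getD (pat D a b c d e) 0 := by
  have n (p q r s : ℕ) (hp : p < 11) (hq : q < 11) (hr : r < 11) (hs : s < 11)
    (hl : [p, q, r, s].Sublist [a, b, c, d, e]) := h.ne_zero p q r s hp hq hr hs (hn.sublist hl)
  unfold pat
  rw [h.chi_dabc (n b c d e ‹_› ‹_› ‹_› ‹_› (by simp)),
    h.chi_dabc (n a c d e ‹_› ‹_› ‹_› ‹_› (by simp)),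
    h.chi_dabc (n a b d e ‹_› ‹_› ‹_› ‹_› (by simp)),
    h.chi_dabc (n a b c e ‹_› ‹_› ‹_› ‹_› (by simp))]
  simp only [front4, fetch_eq, List.getD_tail_eq]
  generalize chi D b c d e = c0, chi D a c d e = c1, chi D a b d e = c2, chi D a b c e = c3,
    chi D a b c d = c4
  cases c0 <;> cases c1 <;> cases c2 <;> cases c3 <;> cases c4 <;> rfl

end IsChirotope

theorem testBit_land {x y i : ℕ} (hx : x.testBit i = true) (hy : y.testBit i = true) :
    (Nat.land x y).testBit i = true :=
  (Nat.testBit_and x y i).trans (by rw [hx, hy]; rfl)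

theorem testBit_lor {x y i : ℕ} (h : x.testBit i = true ∨ y.testBit i = true) :
    (Nat.lor x y).testBit i = true :=
  (Nat.testBit_or x y i).trans (by simpa using h)

theorem testBit_shiftLeft_add {x i j k : ℕ} (h : x.testBit i = true) (hj : j = i + k) :
    (Nat.shiftLeft x k).testBit j = true :=
  (Nat.testBit_shiftLeft x).trans (by simp [hj, h])

theorem testBit_shiftRight_of_add {x i k : ℕ} (h : x.testBit (i + k) = true) :
    (Nat.shiftRight x k).testBit i = true :=
  (Nat.testBit_shiftRight x).trans (by rwa [add_comm])

theorem lanes_testBit {n x l i : ℕ} (hl : l < n) (h : x.testBit i = true) :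
    (lanes n x).testBit (622 * l + 32 + i) = true := by
  refine testBit_shiftLeft_add (i := 622 * l + i) ?_ (by omega)
  induction n generalizing l with
  | zero => omega
  | succ n ih =>
    refine testBit_lor ?_
    rcases l with _ | l
    · exact Or.inr (by simpa using h)
    · exact Or.inl (testBit_shiftLeft_add (ih (l := l) (by omega)) (by ring))

theorem pack_testBit {L : List ℕ} {l i : ℕ} (h : (L.getD l 0).testBit i = true) :
    (pack L).testBit (622 * l + i) = true := by
  induction L generalizing l with
  | nil => simp at h
  | cons x L ih =>
    refine testBit_lor ?_
    rcases l with _ | l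
    · exact Or.inr (by simpa using h)
    · exact Or.inl (testBit_shiftLeft_add (ih (l := l) (by simpa using h)) (by ring))

/-- Five-element subsets of `0, …, 10`. -/
def fives : List (ℕ × ℕ × ℕ × ℕ × ℕ) :=
  (List.range 11).flatMap fun e => (List.range e).flatMap fun d => (List.range d).flatMap fun c =>
    (List.range c).flatMap fun b => (List.range b).map fun a => (a, b, c, d, e)

theorem mem_fives {a b c d e : ℕ} (hab : a < b) (hbc : b < c) (hcd : c < d) (hde : d < e)
    (he : e < 11) : (a, b, c, d, e) ∈ fives := by
  simp [fives, *]

/-- Six-element subsets of `0, …, 10`. -/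
def sixes : List (ℕ × ℕ × ℕ × ℕ × ℕ × ℕ) :=
  (List.range 11).flatMap fun f => (List.range f).flatMap fun e => (List.range e).flatMap fun d =>
    (List.range d).flatMap fun c => (List.range c).flatMap fun b =>
      (List.range b).map fun a => (a, b, c, d, e, f)

theorem mem_sixes {a b c d e f : ℕ} (hab : a < b) (hbc : b < c) (hcd : c < d) (hde : d < e)
    (hef : e < f) (hf : f < 11) : (a, b, c, d, e, f) ∈ sixes := by
  simp [sixes, *]

/-- The weight of a set. -/
def wt5 (a b c d e : ℕ) : ℕ := wt a + wt b + wt c + wt d + wt e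

theorem rank_check : (sixes.all fun (a, b, c, d, e, f) =>
    Nat.ble 14 (wt5 a b c d e + wt f) && (List.range 6).all fun m =>
      (fun s => Nat.ble m s && (Nat.blt (s - m) 6 &&
        Nat.testBit (baseMask m (s - m)) (wt5 a b c d e + wt f - 14)))
        ([a, b, c, d, e, f].getD m 0)) = true := by
  decide +kernel

theorem exists_baseMask {a b c d e f : ℕ} (hab : a < b) (hbc : b < c) (hcd : c < d) (hde : d < e)
    (hef : e < f) (hf : f < 11) : 14 ≤ wt5 a b c d e + wt f ∧ ∀ m < 6, ∃ i < 6,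
      m + i = [a, b, c, d, e, f].getD m 0 ∧
        (baseMask m i).testBit (wt5 a b c d e + wt f - 14) = true := by
  have := List.all_eq_true.mp rank_check _ (mem_sixes hab hbc hcd hde hef hf)
  simp only [Bool.and_eq_true, Nat.ble_eq, Nat.blt_eq, List.all_eq_true, List.mem_range] at this
  refine ⟨this.1, fun m hm => ?_⟩
  obtain ⟨h1, h2, h3⟩ := this.2 m hm
  exact ⟨_, h2, by omega, h3⟩

/-- Inserting `x` as the element of rank `r` gives a sorted list. -/
def fits (x a b c d e : ℕ) : ℕ → Bool
  | 0 => Nat.blt x a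
  | 1 => Nat.blt a x && Nat.blt x b
  | 2 => Nat.blt b x && Nat.blt x c
  | 3 => Nat.blt c x && Nat.blt x d
  | 4 => Nat.blt d x && Nat.blt x e
  | _ => Nat.blt e x

theorem hole_check : (fives.all fun (a, b, c, d, e) =>
    Nat.ble 14 (wt5 a b c d e) && (List.range 6).all fun r => (List.range 6).all fun i =>
      fits (r + i) a b c d e r || Nat.testBit (baseHole r i) (wt5 a b c d e - 14)) = true := by
  decide +kernel

theorem fits_or_hole {a b c d e : ℕ} (hab : a < b) (hbc : b < c) (hcd : c < d) (hde : d < e)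
    (he : e < 11) : 14 ≤ wt5 a b c d e ∧ ∀ r < 6, ∀ i < 6, fits (r + i) a b c d e r = true ∨
      (baseHole r i).testBit (wt5 a b c d e - 14) = true := by
  have := List.all_eq_true.mp hole_check _ (mem_fives hab hbc hcd hde he)
  simpa only [Bool.and_eq_true, Bool.or_eq_true, Nat.ble_eq, List.all_eq_true,
    List.mem_range] using this

theorem up_testBit {n m l i d w W : ℕ} (hl : l < n) (hi : i < 6)
    (hb : (baseMask m i).testBit (W - 14) = true) (hW : 14 ≤ W) (hw : W = w + wt (m + i))
    (hd : d.testBit (622 * l + 18 + w) = true) :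
    ((mkMask n m).up d).testBit (622 * l + 18 + W) = true := by
  have key : (Nat.land (Nat.shiftLeft d (wt (m + i))) (lanes n (baseMask m i))).testBit
      (622 * l + 18 + W) = true := by
    refine testBit_land (testBit_shiftLeft_add hd (by omega)) ?_
    have := lanes_testBit hl hb
    rwa [show 622 * l + 32 + (W - 14) = 622 * l + 18 + W by omega] at this
  unfold Mask.up
  interval_cases i
  · exact testBit_lor (.inl key)
  · exact testBit_lor (.inr (testBit_lor (.inl key)))
  · exact testBit_lor (.inr (testBit_lor (.inr (testBit_lor (.inl key)))))
  · exact testBit_lor (.inr (testBit_lor (.inr (testBit_lor (.inr (testBit_lor (.inl key)))))))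
  · exact testBit_lor (.inr (testBit_lor (.inr (testBit_lor (.inr (testBit_lor (.inr
      (testBit_lor (.inl key)))))))))
  · exact testBit_lor (.inr (testBit_lor (.inr (testBit_lor (.inr (testBit_lor (.inr
      (testBit_lor (.inr key)))))))))

theorem down_testBit {n r l d h W : ℕ} (hl : l < n) (hW : 14 ≤ W)
    (hd : d.testBit (622 * l + 18 + W) = true)
    (hh : ∀ i < 6, h.testBit (622 * l + 18 + W + wt (r + i)) = true ∨
      (baseHole r i).testBit (W - 14) = true) :
    ((mkMask n r).down d h).testBit (622 * l + 18 + W) = true := by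
  have key : ∀ i < 6, (Nat.lor (Nat.shiftRight h (wt (r + i))) (lanes n (baseHole r i))).testBit
      (622 * l + 18 + W) = true := by
    intro i hi
    refine testBit_lor ((hh i hi).imp testBit_shiftRight_of_add fun hb => ?_)
    have := lanes_testBit hl hb
    rwa [show 622 * l + 32 + (W - 14) = 622 * l + 18 + W by omega] at this
  unfold Mask.down
  exact testBit_land (key 0 (by omega)) (testBit_land (key 1 (by omega)) (testBit_land
    (key 2 (by omega)) (testBit_land (key 3 (by omega)) (testBit_land (key 4 (by omega))
    (testBit_land (key 5 (by omega)) hd)))))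

theorem mapN_getD (f : ℕ → ℕ) {l : List ℕ} {z : ℕ} (hz : z < l.length) :
    (mapN f l).getD z 0 = f (l.getD z 0) := by
  induction l generalizing z with
  | nil => simp at hz
  | cons x l ih =>
    rcases z with _ | z
    · rfl
    · exact ih (by simpa using hz)

theorem zipN_getD (f : ℕ → ℕ → ℕ) {l l' : List ℕ} {z : ℕ} (hz : z < l.length)
    (hz' : z < l'.length) : (zipN f l l').getD z 0 = f (l.getD z 0) (l'.getD z 0) := by
  induction l generalizing z l' with
  | nil => simp at hz
  | cons x l ih =>
    rcases l' with _ | ⟨y, l'⟩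
    · simp at hz'
    · rcases z with _ | z
      · rfl
      · exact ih (by simpa using hz) (by simpa using hz')

theorem lt_length_of_testBit {l : List ℕ} {z i : ℕ} (h : (l.getD z 0).testBit i = true) :
    z < l.length := by
  by_contra hz
  rw [List.getD_eq_default _ _ (by omega)] at h
  simp at h

set_option maxRecDepth 100000 in
theorem rows_length (p q r s t : List ℕ) :
    (rows Nat.land Nat.lor 0 p q r s t).length = 32 := by
  rw [rows_eq_map, List.length_map]
  decide +kernel

theorem pat_lt (D : ℕ → ℕ → ℕ → ℕ → ℝ) (a b c d e : ℕ) : pat D a b c d e < 32 := by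
  have h (c : Bool) : c.toNat ≤ 1 := Bool.toNat_le c
  have := h (chi D b c d e)
  have := h (chi D a c d e)
  have := h (chi D a b d e)
  have := h (chi D a b c e)
  have := h (chi D a b c d)
  unfold pat
  omega

theorem lift_testBit {n l m s w W z : ℕ} {t : List ℕ} (hl : l < n)
    (hs : ∃ i < 6, m + i = s ∧ (baseMask m i).testBit (W - 14) = true) (hW : 14 ≤ W)
    (hw : W = w + wt s) (ht : (t.getD z 0).testBit (622 * l + 18 + w) = true) :
    ((mapN (mkMask n m).up t).getD z 0).testBit (622 * l + 18 + W) = true := by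
  obtain ⟨i, hi, rfl, hb⟩ := hs
  rw [mapN_getD _ (lt_length_of_testBit ht)]
  exact up_testBit hl hi hb hW hw ht

/-- The patterns of `D` are among the patterns of block `l` of the lanes `L`. -/
def Admits (D : ℕ → ℕ → ℕ → ℕ → ℝ) (l : ℕ) (L : List ℕ) : Prop :=
  ∀ a b c d e, a < b → b < c → c < d → d < e → e < 11 →
    (L.getD (pat D a b c d e) 0).testBit (622 * l + 18 + wt5 a b c d e) = true

theorem stp_testBit {n r l z : ℕ} {m₀ m₁ m₂ m₃ m₄ : Mask} {t₀ t₁ t₂ t₃ t₄ L : List ℕ}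
    {a b c d e : ℕ} (hab : a < b) (hbc : b < c) (hcd : c < d) (hde : d < e) (he : e < 11)
    (hz : z < 32) (hl : l < n) (hr : r < 6)
    (hL : (L.getD z 0).testBit (622 * l + 18 + wt5 a b c d e) = true)
    (hx : ∀ x < 11, fits x a b c d e r = true →
      ((rows Nat.land Nat.lor 0 (mapN m₀.up t₀) (mapN m₁.up t₁) (mapN m₂.up t₂) (mapN m₃.up t₃)
        (mapN m₄.up t₄)).getD z 0).testBit (622 * l + 18 + (wt5 a b c d e + wt x)) = true) :
    ((stp (mkMask n r) m₀ m₁ m₂ m₃ m₄ t₀ t₁ t₂ t₃ t₄ L).getD z 0).testBit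
      (622 * l + 18 + wt5 a b c d e) = true := by
  obtain ⟨hW, hf⟩ := fits_or_hole hab hbc hcd hde he
  rw [stp, zipN_getD _ (lt_length_of_testBit hL) (by rwa [rows_length])]
  refine down_testBit hl hW hL fun i hi => (hf r hr i hi).imp_left fun hfit => ?_
  rw [add_assoc]
  exact hx _ (by omega) hfit

theorem stp_admits_zero {D : ℕ → ℕ → ℕ → ℕ → ℝ} (h : IsChirotope D) {n l : ℕ} (hl : l < n)
    {L : List ℕ} (hL : Admits D l L) : Admits D l
      (stp (mkMask n 0) (mkMask n 1) (mkMask n 2) (mkMask n 3) (mkMask n 4) (mkMask n 5)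
        L L L L L L) := by
  intro a b c d e hab hbc hcd hde he
  refine stp_testBit hab hbc hcd hde he (pat_lt ..) hl (by omega) (hL a b c d e ‹_› ‹_› ‹_› ‹_› ‹_›)
    fun x hx hf => ?_
  simp only [fits, Nat.blt_eq] at hf
  obtain ⟨hW, U⟩ := exists_baseMask (a := x) (b := a) (c := b) (d := c) (e := d) (f := e)
    (by omega) (by omega) (by omega) (by omega) (by omega) (by omega)
  rw [show wt5 x a b c d + wt e = wt5 a b c d e + wt x by unfold wt5; omega] at hW U
  refine six_rows h hx (by omega) (by omega) (by omega) (by omega) (by omega) (by simp; omega)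
    _ _ _ _ _ _ ?_ ?_ ?_ ?_ ?_
  · exact lift_testBit (s := a) (w := wt5 x b c d e) hl (U 1 (by omega)) hW (by unfold wt5; omega)
      (hL x b c d e (by omega) (by omega) (by omega) (by omega) (by omega))
  · exact lift_testBit (s := b) (w := wt5 x a c d e) hl (U 2 (by omega)) hW (by unfold wt5; omega)
      (hL x a c d e (by omega) (by omega) (by omega) (by omega) (by omega))
  · exact lift_testBit (s := c) (w := wt5 x a b d e) hl (U 3 (by omega)) hW (by unfold wt5; omega)
      (hL x a b d e (by omega) (by omega) (by omega) (by omega) (by omega))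
  · exact lift_testBit (s := d) (w := wt5 x a b c e) hl (U 4 (by omega)) hW (by unfold wt5; omega)
      (hL x a b c e (by omega) (by omega) (by omega) (by omega) (by omega))
  · exact lift_testBit (s := e) (w := wt5 x a b c d) hl (U 5 (by omega)) hW (by unfold wt5; omega)
      (hL x a b c d (by omega) (by omega) (by omega) (by omega) (by omega))

theorem stp_admits_one {D : ℕ → ℕ → ℕ → ℕ → ℝ} (h : IsChirotope D) {n l : ℕ} (hl : l < n)
    {L : List ℕ} (hL : Admits D l L) : Admits D l
      (stp (mkMask n 1) (mkMask n 0) (mkMask n 2) (mkMask n 3) (mkMask n 4) (mkMask n 5)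
        L (front1 L) (front1 L) (front1 L) (front1 L) L) := by
  intro a b c d e hab hbc hcd hde he
  refine stp_testBit hab hbc hcd hde he (pat_lt ..) hl (by omega) (hL a b c d e ‹_› ‹_› ‹_› ‹_› ‹_›)
    fun x hx hf => ?_
  simp only [fits, Bool.and_eq_true, Nat.blt_eq] at hf
  obtain ⟨hW, U⟩ := exists_baseMask (a := a) (b := x) (c := b) (d := c) (e := d) (f := e)
    (by omega) (by omega) (by omega) (by omega) (by omega) (by omega)
  rw [show wt5 a x b c d + wt e = wt5 a b c d e + wt x by unfold wt5; omega] at hW U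
  refine six_rows h hx (by omega) (by omega) (by omega) (by omega) (by omega) (by simp; omega)
    _ _ _ _ _ _ ?_ ?_ ?_ ?_ ?_
  · exact lift_testBit (s := a) (w := wt5 x b c d e) hl (U 0 (by omega)) hW (by unfold wt5; omega)
      (hL x b c d e (by omega) (by omega) (by omega) (by omega) (by omega))
  · refine lift_testBit (s := b) (w := wt5 a x c d e) hl (U 2 (by omega)) hW (by unfold wt5; omega) ?_
    rw [h.front1_pat (by omega) (by omega) (by omega) (by omega) (by omega) (by simp; omega)]
    exact hL a x c d e (by omega) (by omega) (by omega) (by omega) (by omega)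
  · refine lift_testBit (s := c) (w := wt5 a x b d e) hl (U 3 (by omega)) hW (by unfold wt5; omega) ?_
    rw [h.front1_pat (by omega) (by omega) (by omega) (by omega) (by omega) (by simp; omega)]
    exact hL a x b d e (by omega) (by omega) (by omega) (by omega) (by omega)
  · refine lift_testBit (s := d) (w := wt5 a x b c e) hl (U 4 (by omega)) hW (by unfold wt5; omega) ?_
    rw [h.front1_pat (by omega) (by omega) (by omega) (by omega) (by omega) (by simp; omega)]
    exact hL a x b c e (by omega) (by omega) (by omega) (by omega) (by omega)
  · refine lift_testBit (s := e) (w := wt5 a x b c d) hl (U 5 (by omega)) hW (by unfold wt5; omega) ?_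
    rw [h.front1_pat (by omega) (by omega) (by omega) (by omega) (by omega) (by simp; omega)]
    exact hL a x b c d (by omega) (by omega) (by omega) (by omega) (by omega)

theorem stp_admits_two {D : ℕ → ℕ → ℕ → ℕ → ℝ} (h : IsChirotope D) {n l : ℕ} (hl : l < n)
    {L : List ℕ} (hL : Admits D l L) : Admits D l
      (stp (mkMask n 2) (mkMask n 0) (mkMask n 1) (mkMask n 3) (mkMask n 4) (mkMask n 5)
        (front1 L) (front1 L) (front2 L) (front2 L) (front2 L) L) := by
  intro a b c d e hab hbc hcd hde he
  refine stp_testBit hab hbc hcd hde he (pat_lt ..) hl (by omega) (hL a b c d e ‹_› ‹_› ‹_› ‹_› ‹_›)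
    fun x hx hf => ?_
  simp only [fits, Bool.and_eq_true, Nat.blt_eq] at hf
  obtain ⟨hW, U⟩ := exists_baseMask (a := a) (b := b) (c := x) (d := c) (e := d) (f := e)
    (by omega) (by omega) (by omega) (by omega) (by omega) (by omega)
  rw [show wt5 a b x c d + wt e = wt5 a b c d e + wt x by unfold wt5; omega] at hW U
  refine six_rows h hx (by omega) (by omega) (by omega) (by omega) (by omega) (by simp; omega)
    _ _ _ _ _ _ ?_ ?_ ?_ ?_ ?_
  · refine lift_testBit (s := a) (w := wt5 b x c d e) hl (U 0 (by omega)) hW (by unfold wt5; omega) ?_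
    rw [h.front1_pat (by omega) (by omega) (by omega) (by omega) (by omega) (by simp; omega)]
    exact hL b x c d e (by omega) (by omega) (by omega) (by omega) (by omega)
  · refine lift_testBit (s := b) (w := wt5 a x c d e) hl (U 1 (by omega)) hW (by unfold wt5; omega) ?_
    rw [h.front1_pat (by omega) (by omega) (by omega) (by omega) (by omega) (by simp; omega)]
    exact hL a x c d e (by omega) (by omega) (by omega) (by omega) (by omega)
  · refine lift_testBit (s := c) (w := wt5 a b x d e) hl (U 3 (by omega)) hW (by unfold wt5; omega) ?_
    rw [h.front2_pat (by omega) (by omega) (by omega) (by omega) (by omega) (by simp; omega)]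
    exact hL a b x d e (by omega) (by omega) (by omega) (by omega) (by omega)
  · refine lift_testBit (s := d) (w := wt5 a b x c e) hl (U 4 (by omega)) hW (by unfold wt5; omega) ?_
    rw [h.front2_pat (by omega) (by omega) (by omega) (by omega) (by omega) (by simp; omega)]
    exact hL a b x c e (by omega) (by omega) (by omega) (by omega) (by omega)
  · refine lift_testBit (s := e) (w := wt5 a b x c d) hl (U 5 (by omega)) hW (by unfold wt5; omega) ?_
    rw [h.front2_pat (by omega) (by omega) (by omega) (by omega) (by omega) (by simp; omega)]
    exact hL a b x c d (by omega) (by omega) (by omega) (by omega) (by omega)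

theorem stp_admits_three {D : ℕ → ℕ → ℕ → ℕ → ℝ} (h : IsChirotope D) {n l : ℕ} (hl : l < n)
    {L : List ℕ} (hL : Admits D l L) : Admits D l
      (stp (mkMask n 3) (mkMask n 0) (mkMask n 1) (mkMask n 2) (mkMask n 4) (mkMask n 5)
        (front2 L) (front2 L) (front2 L) (front3 L) (front3 L) L) := by
  intro a b c d e hab hbc hcd hde he
  refine stp_testBit hab hbc hcd hde he (pat_lt ..) hl (by omega) (hL a b c d e ‹_› ‹_› ‹_› ‹_› ‹_›)
    fun x hx hf => ?_
  simp only [fits, Bool.and_eq_true, Nat.blt_eq] at hf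
  obtain ⟨hW, U⟩ := exists_baseMask (a := a) (b := b) (c := c) (d := x) (e := d) (f := e)
    (by omega) (by omega) (by omega) (by omega) (by omega) (by omega)
  rw [show wt5 a b c x d + wt e = wt5 a b c d e + wt x by unfold wt5; omega] at hW U
  refine six_rows h hx (by omega) (by omega) (by omega) (by omega) (by omega) (by simp; omega)
    _ _ _ _ _ _ ?_ ?_ ?_ ?_ ?_
  · refine lift_testBit (s := a) (w := wt5 b c x d e) hl (U 0 (by omega)) hW (by unfold wt5; omega) ?_
    rw [h.front2_pat (by omega) (by omega) (by omega) (by omega) (by omega) (by simp; omega)]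
    exact hL b c x d e (by omega) (by omega) (by omega) (by omega) (by omega)
  · refine lift_testBit (s := b) (w := wt5 a c x d e) hl (U 1 (by omega)) hW (by unfold wt5; omega) ?_
    rw [h.front2_pat (by omega) (by omega) (by omega) (by omega) (by omega) (by simp; omega)]
    exact hL a c x d e (by omega) (by omega) (by omega) (by omega) (by omega)
  · refine lift_testBit (s := c) (w := wt5 a b x d e) hl (U 2 (by omega)) hW (by unfold wt5; omega) ?_
    rw [h.front2_pat (by omega) (by omega) (by omega) (by omega) (by omega) (by simp; omega)]
    exact hL a b x d e (by omega) (by omega) (by omega) (by omega) (by omega)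
  · refine lift_testBit (s := d) (w := wt5 a b c x e) hl (U 4 (by omega)) hW (by unfold wt5; omega) ?_
    rw [h.front3_pat (by omega) (by omega) (by omega) (by omega) (by omega) (by simp; omega)]
    exact hL a b c x e (by omega) (by omega) (by omega) (by omega) (by omega)
  · refine lift_testBit (s := e) (w := wt5 a b c x d) hl (U 5 (by omega)) hW (by unfold wt5; omega) ?_
    rw [h.front3_pat (by omega) (by omega) (by omega) (by omega) (by omega) (by simp; omega)]
    exact hL a b c x d (by omega) (by omega) (by omega) (by omega) (by omega)

theorem stp_admits_four {D : ℕ → ℕ → ℕ → ℕ → ℝ} (h : IsChirotope D) {n l : ℕ} (hl : l < n)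
    {L : List ℕ} (hL : Admits D l L) : Admits D l
      (stp (mkMask n 4) (mkMask n 0) (mkMask n 1) (mkMask n 2) (mkMask n 3) (mkMask n 5)
        (front3 L) (front3 L) (front3 L) (front3 L) (front4 L) L) := by
  intro a b c d e hab hbc hcd hde he
  refine stp_testBit hab hbc hcd hde he (pat_lt ..) hl (by omega) (hL a b c d e ‹_› ‹_› ‹_› ‹_› ‹_›)
    fun x hx hf => ?_
  simp only [fits, Bool.and_eq_true, Nat.blt_eq] at hf
  obtain ⟨hW, U⟩ := exists_baseMask (a := a) (b := b) (c := c) (d := d) (e := x) (f := e)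
    (by omega) (by omega) (by omega) (by omega) (by omega) (by omega)
  rw [show wt5 a b c d x + wt e = wt5 a b c d e + wt x by unfold wt5; omega] at hW U
  refine six_rows h hx (by omega) (by omega) (by omega) (by omega) (by omega) (by simp; omega)
    _ _ _ _ _ _ ?_ ?_ ?_ ?_ ?_
  · refine lift_testBit (s := a) (w := wt5 b c d x e) hl (U 0 (by omega)) hW (by unfold wt5; omega) ?_
    rw [h.front3_pat (by omega) (by omega) (by omega) (by omega) (by omega) (by simp; omega)]
    exact hL b c d x e (by omega) (by omega) (by omega) (by omega) (by omega)
  · refine lift_testBit (s := b) (w := wt5 a c d x e) hl (U 1 (by omega)) hW (by unfold wt5; omega) ?_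
    rw [h.front3_pat (by omega) (by omega) (by omega) (by omega) (by omega) (by simp; omega)]
    exact hL a c d x e (by omega) (by omega) (by omega) (by omega) (by omega)
  · refine lift_testBit (s := c) (w := wt5 a b d x e) hl (U 2 (by omega)) hW (by unfold wt5; omega) ?_
    rw [h.front3_pat (by omega) (by omega) (by omega) (by omega) (by omega) (by simp; omega)]
    exact hL a b d x e (by omega) (by omega) (by omega) (by omega) (by omega)
  · refine lift_testBit (s := d) (w := wt5 a b c x e) hl (U 3 (by omega)) hW (by unfold wt5; omega) ?_
    rw [h.front3_pat (by omega) (by omega) (by omega) (by omega) (by omega) (by simp; omega)]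
    exact hL a b c x e (by omega) (by omega) (by omega) (by omega) (by omega)
  · refine lift_testBit (s := e) (w := wt5 a b c d x) hl (U 5 (by omega)) hW (by unfold wt5; omega) ?_
    rw [h.front4_pat (by omega) (by omega) (by omega) (by omega) (by omega) (by simp; omega)]
    exact hL a b c d x (by omega) (by omega) (by omega) (by omega) (by omega)

theorem stp_admits_five {D : ℕ → ℕ → ℕ → ℕ → ℝ} (h : IsChirotope D) {n l : ℕ} (hl : l < n)
    {L : List ℕ} (hL : Admits D l L) : Admits D l
      (stp (mkMask n 5) (mkMask n 0) (mkMask n 1) (mkMask n 2) (mkMask n 3) (mkMask n 4)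
        (front4 L) (front4 L) (front4 L) (front4 L) (front4 L) L) := by
  intro a b c d e hab hbc hcd hde he
  refine stp_testBit hab hbc hcd hde he (pat_lt ..) hl (by omega) (hL a b c d e ‹_› ‹_› ‹_› ‹_› ‹_›)
    fun x hx hf => ?_
  simp only [fits, Nat.blt_eq] at hf
  obtain ⟨hW, U⟩ := exists_baseMask (a := a) (b := b) (c := c) (d := d) (e := e) (f := x)
    (by omega) (by omega) (by omega) (by omega) (by omega) (by omega)
  rw [show wt5 a b c d e + wt x = wt5 a b c d e + wt x by unfold wt5; omega] at hW U
  refine six_rows h hx (by omega) (by omega) (by omega) (by omega) (by omega) (by simp; omega)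
    _ _ _ _ _ _ ?_ ?_ ?_ ?_ ?_
  · refine lift_testBit (s := a) (w := wt5 b c d e x) hl (U 0 (by omega)) hW (by unfold wt5; omega) ?_
    rw [h.front4_pat (by omega) (by omega) (by omega) (by omega) (by omega) (by simp; omega)]
    exact hL b c d e x (by omega) (by omega) (by omega) (by omega) (by omega)
  · refine lift_testBit (s := b) (w := wt5 a c d e x) hl (U 1 (by omega)) hW (by unfold wt5; omega) ?_
    rw [h.front4_pat (by omega) (by omega) (by omega) (by omega) (by omega) (by simp; omega)]
    exact hL a c d e x (by omega) (by omega) (by omega) (by omega) (by omega)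
  · refine lift_testBit (s := c) (w := wt5 a b d e x) hl (U 2 (by omega)) hW (by unfold wt5; omega) ?_
    rw [h.front4_pat (by omega) (by omega) (by omega) (by omega) (by omega) (by simp; omega)]
    exact hL a b d e x (by omega) (by omega) (by omega) (by omega) (by omega)
  · refine lift_testBit (s := d) (w := wt5 a b c e x) hl (U 3 (by omega)) hW (by unfold wt5; omega) ?_
    rw [h.front4_pat (by omega) (by omega) (by omega) (by omega) (by omega) (by simp; omega)]
    exact hL a b c e x (by omega) (by omega) (by omega) (by omega) (by omega)
  · refine lift_testBit (s := e) (w := wt5 a b c d x) hl (U 4 (by omega)) hW (by unfold wt5; omega) ?_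
    rw [h.front4_pat (by omega) (by omega) (by omega) (by omega) (by omega) (by simp; omega)]
    exact hL a b c d x (by omega) (by omega) (by omega) (by omega) (by omega)

theorem refute_batch_zero : refute 8 (caseTree.branches 0 []) = true := by decide +kernel

theorem refute_batch_one : refute 10 (caseTree.branches 1 []) = true := by decide +kernel

theorem refute_batch_two : refute 13 (caseTree.branches 2 []) = true := by decide +kernel

theorem refute_batch_three : refute 17 (caseTree.branches 3 []) = true := by decide +kernel

theorem refute_batch_four : refute 22 (caseTree.branches 4 []) = true := by decide +kernel

theorem refute_batch_five : refute 34 (caseTree.branches 5 []) = true := by decide +kernel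

theorem strictList_eq {α : Type} (L : List ℕ) (s : ℕ) (k : List ℕ → ℕ → α) :
    ∃ L' s', strictList L s k = k L' s' ∧
      ∀ z i, (L.getD z 0).testBit i = true → (L'.getD z 0).testBit i = true := by
  induction L generalizing s k with
  | nil => exact ⟨[], s, rfl, fun _ _ h => h⟩
  | cons x L ih =>
    obtain ⟨L', s', h, hL⟩ := ih (Nat.succ s) fun t => k (Nat.lor x s :: t)
    refine ⟨Nat.lor x s :: L', s', ?_, fun z i hz => ?_⟩
    · rw [← h]
      change strict (Nat.lor x s) (fun b => strict (Nat.succ s) fun c =>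
        strictList L c fun t => k (b :: t)) = _
      rw [strict_eq, strict_eq]
    · rcases z with _ | z
      · exact testBit_lor (.inl hz)
      · exact hL z i hz

theorem strictList_of_admits {D : ℕ → ℕ → ℕ → ℕ → ℝ} {l : ℕ} {L : List ℕ} (hL : Admits D l L)
    {s : ℕ} {k : List ℕ → ℕ → Bool} (hk : ∀ L s, Admits D l L → k L s = false) :
    strictList L s k = false := by
  obtain ⟨L', s', h, hb⟩ := strictList_eq L s k
  rw [h]
  exact hk L' s' fun a b c d e hab hbc hcd hde he => hb _ _ (hL a b c d e hab hbc hcd hde he)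

theorem sweep_of_admits {D : ℕ → ℕ → ℕ → ℕ → ℝ} (h : IsChirotope D) {n l : ℕ} (hl : l < n)
    {L : List ℕ} (hL : Admits D l L) {s : ℕ} {k : List ℕ → ℕ → Bool}
    (hk : ∀ L s, Admits D l L → k L s = false) :
    sweep (mkMask n 0) (mkMask n 1) (mkMask n 2) (mkMask n 3) (mkMask n 4) (mkMask n 5) L s k =
      false :=
  strictList_of_admits (stp_admits_zero h hl hL) fun _ _ hL =>
  strictList_of_admits (stp_admits_one h hl hL) fun _ _ hL =>
  strictList_of_admits (stp_admits_two h hl hL) fun _ _ hL =>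
  strictList_of_admits (stp_admits_three h hl hL) fun _ _ hL =>
  strictList_of_admits (stp_admits_four h hl hL) fun _ _ hL =>
  strictList_of_admits (stp_admits_five h hl hL) hk

theorem iter_of_admits {D : ℕ → ℕ → ℕ → ℕ → ℝ} (h : IsChirotope D) {n l : ℕ} (hl : l < n) (m : ℕ)
    {L : List ℕ} (hL : Admits D l L) {s : ℕ} {k : List ℕ → ℕ → Bool}
    (hk : ∀ L s, Admits D l L → k L s = false) :
    iter m (mkMask n 0) (mkMask n 1) (mkMask n 2) (mkMask n 3) (mkMask n 4) (mkMask n 5) L s k =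
      false := by
  induction m generalizing L s with
  | zero => exact hk L s hL
  | succ m ih => exact sweep_of_admits h hl hL fun L s hL => ih hL

theorem allZero_eq_false {L : List ℕ} {z i : ℕ} (h : (L.getD z 0).testBit (i + 32) = true)
    (s : ℕ) : allZero L s = false := by
  induction L generalizing z with
  | nil => simp at h
  | cons x L ih =>
    change Bool.rec false (allZero L s) (Nat.beq (Nat.shiftRight x 32) 0) = false
    rcases z with _ | z
    · have : Nat.beq (Nat.shiftRight x 32) 0 = false := by
        rw [← Bool.not_eq_true]
        intro h0
        have h1 : (Nat.shiftRight x 32).testBit i = true := testBit_shiftRight_of_add h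
        rw [Nat.eq_of_beq_eq_true h0] at h1
        simp at h1
      rw [this]
    · rw [ih h]
      cases Nat.beq (Nat.shiftRight x 32) 0 <;> rfl

theorem allZero_of_admits {D : ℕ → ℕ → ℕ → ℕ → ℝ} {l : ℕ} {L : List ℕ} (hL : Admits D l L)
    (s : ℕ) : allZero L s = false := by
  have := hL 0 1 2 3 4 (by omega) (by omega) (by omega) (by omega) (by omega)
  exact allZero_eq_false (i := 622 * l) this s

/-- A number that lists the five-element sets by weight. -/
def fiveTable : ℕ :=
  fives.foldr (fun (a, b, c, d, e) x => Nat.lor x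
    (Nat.shiftLeft (a + 11 * b + 121 * c + 1331 * d + 14641 * e) (18 * wt5 a b c d e))) 0

theorem fiveTable_check : (fives.all fun (a, b, c, d, e) =>
    Nat.blt (wt5 a b c d e - 14) 622 &&
    Nat.beq (Nat.mod (Nat.shiftRight fiveTable (18 * wt5 a b c d e)) (Nat.pow 2 18))
      (a + 11 * b + 121 * c + 1331 * d + 14641 * e)) = true := by
  decide +kernel

theorem wt5_injective {a b c d e a' b' c' d' e' : ℕ} (hab : a < b) (hbc : b < c) (hcd : c < d)
    (hde : d < e) (he : e < 11) (hab' : a' < b') (hbc' : b' < c') (hcd' : c' < d') (hde' : d' < e')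
    (he' : e' < 11) (h : wt5 a b c d e = wt5 a' b' c' d' e') :
    a = a' ∧ b = b' ∧ c = c' ∧ d = d' ∧ e = e' := by
  have h1 := List.all_eq_true.mp fiveTable_check _ (mem_fives hab hbc hcd hde he)
  have h2 := List.all_eq_true.mp fiveTable_check _ (mem_fives hab' hbc' hcd' hde' he')
  generalize fiveTable = t at h1 h2
  simp only [Bool.and_eq_true, h] at h1 h2
  have := (Nat.eq_of_beq_eq_true h1.2).symm.trans (Nat.eq_of_beq_eq_true h2.2)
  clear h h1 h2
  obtain rfl : e = e' := by omega
  obtain rfl : d = d' := by omega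
  obtain rfl : c = c' := by omega
  omega

theorem wt5_sub_lt {a b c d e : ℕ} (hab : a < b) (hbc : b < c) (hcd : c < d)
    (hde : d < e) (he : e < 11) : wt5 a b c d e - 14 < 622 := by
  have h1 := List.all_eq_true.mp fiveTable_check _ (mem_fives hab hbc hcd hde he)
  simp only [Bool.and_eq_true, Nat.blt_eq] at h1
  exact h1.1

/-- The patterns of `D` satisfy the conditions of the branch `p`. -/
def Follows (D : ℕ → ℕ → ℕ → ℕ → ℝ) (p : List (ℕ × ℕ)) : Prop :=
  ∀ q ∈ p, ∀ a b c d e, a < b → b < c → c < d → d < e → e < 11 → wt5 a b c d e - 14 = q.1 →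
    q.2.testBit (pat D a b c d e) = true

theorem exists_branch (D : ℕ → ℕ → ℕ → ℕ → ℝ) (n : ℕ) (T : CaseTree) (p : List (ℕ × ℕ))
    (hp : Follows D p) (hT : T.labelsLT n = true) :
    ∃ b < n, ∃ p' ∈ T.branches b p, Follows D p' := by
  induction T generalizing p with
  | leaf c =>
    rw [CaseTree.labelsLT, Nat.blt_eq] at hT
    exact ⟨c, hT, p, by simp [CaseTree.branches], hp⟩
  | node a m l r hl hr =>
    rw [CaseTree.labelsLT, Bool.and_eq_true] at hT
    by_cases hm : ∀ q ∈ [(a, m)], ∀ a b c d e, a < b → b < c → c < d → d < e → e < 11 →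
        wt5 a b c d e - 14 = q.1 → q.2.testBit (pat D a b c d e) = true
    · obtain ⟨b, hb, p', hp', h⟩ := hl ((a, m) :: p)
        (fun q hq => (List.mem_cons.mp hq).elim (fun h => hm q (by simp [h])) (hp q)) hT.1
      exact ⟨b, hb, p', List.mem_append_left _ hp', h⟩
    · push Not at hm
      obtain ⟨q, hq, s, t, u, v, w, h1, h2, h3, h4, h5, h6, h7⟩ := hm
      obtain rfl := List.mem_singleton.mp hq
      have hf : Follows D ((a, Nat.xor m 4294967295) :: p) := by
        intro q hq
        rcases List.mem_cons.mp hq with rfl | hq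
        · intro s' t' u' v' w' h1' h2' h3' h4' h5' h6'
          have e1 := (fits_or_hole h1 h2 h3 h4 h5).1
          have e2 := (fits_or_hole h1' h2' h3' h4' h5').1
          obtain ⟨rfl, rfl, rfl, rfl, rfl⟩ := wt5_injective h1 h2 h3 h4 h5 h1' h2' h3' h4' h5'
            (by simp only at h6 h6'; omega)
          refine (Nat.testBit_xor _ _ _).trans ?_
          rw [show (4294967295 : ℕ) = 2 ^ 32 - 1 by norm_num, Nat.testBit_two_pow_sub_one,
            Bool.eq_false_iff.mpr h7]
          simp [pat_lt]
        · exact hp q hq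
      obtain ⟨b, hb, p', hp', h⟩ := hr _ hf hT.2
      exact ⟨b, hb, p', List.mem_append_right _ hp', h⟩

theorem testBit_pred_two_pow {n i : ℕ} (hi : i < n) :
    (Nat.pred (Nat.pow 2 n)).testBit i = true :=
  (Nat.testBit_two_pow_sub_one n i).trans (by simpa using hi)

set_option exponentiation.threshold 700 in
theorem branchLane_testBit {z x i : ℕ} {p : List (ℕ × ℕ)} (hi : i < 622)
    (hx : x.testBit i = true) (hp : ∀ q ∈ p, i = q.1 → q.2.testBit z = true) :
    (branchLane z x p).testBit i = true := by
  induction p with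
  | nil => exact hx
  | cons q p ih =>
    have ih := ih fun q hq => hp q (by simp [hq])
    change (bif Nat.testBit q.2 z then branchLane z x p else Nat.land (branchLane z x p)
      (Nat.xor (Nat.pred (Nat.pow 2 622)) (Nat.shiftLeft 1 q.1))).testBit i = true
    cases hz : Nat.testBit q.2 z with
    | true => exact ih
    | false =>
      refine testBit_land ih ((Nat.testBit_xor _ _ _).trans ?_)
      have hq : i ≠ q.1 := fun h => by simp [hp q (by simp) h] at hz
      have h1 : (Nat.shiftLeft 1 q.1).testBit i = false := by
        change (1 <<< q.1).testBit i = false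
        rw [Nat.one_shiftLeft, Nat.testBit_two_pow]
        simpa using hq.symm
      rw [h1, testBit_pred_two_pow hi]
      rfl

/-- The vertices `a`, `b`, `c` span a face. -/
def face (a b c : ℕ) : Bool := Nat.testBit faceBits (a + 11 * b + 121 * c)

/-- The pattern `z` of the points `a`, `b`, `c`, `d`, `e` is not acyclic or forces the segment
spanned by two of these points to pierce a face spanned by the other three. -/
def bad (a b c d e z : ℕ) : Bool :=
  match z ^^^ 10 with
  | 0 | 31 => true
  | 3 | 28 => face c d e
  | 5 | 26 => face b d e
  | 9 | 22 => face b c e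
  | 17 | 14 => face b c d
  | 6 | 25 => face a d e
  | 10 | 21 => face a c e
  | 18 | 13 => face a c d
  | 12 | 19 => face a b e
  | 20 | 11 => face a b d
  | 24 | 7 => face a b c
  | _ => false

theorem rootLanes_check : (fives.all fun (a, b, c, d, e) => (List.range 32).all fun z =>
    Nat.testBit (rootLanes.getD z 0) (wt5 a b c d e - 14) || (bad a b c d e z ||
      (Nat.beq d 3 && !Nat.testBit z 4))) = true := by
  decide +kernel

theorem initLanes_admits {D : ℕ → ℕ → ℕ → ℕ → ℝ}
    (hD : ∀ a b c d e, a < b → b < c → c < d → d < e → e < 11 →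
      bad a b c d e (pat D a b c d e) = false) (h0 : 0 < D 0 1 2 3)
    {P : List (List (ℕ × ℕ))} {l : ℕ} (hl : l < P.length) (hp : Follows D P[l]) :
    Admits D l (initLanes P) := by
  intro a b c d e hab hbc hcd hde he
  have hz := pat_lt D a b c d e
  have root := List.all_eq_true.mp (List.all_eq_true.mp rootLanes_check _
    (mem_fives hab hbc hcd hde he)) _ (List.mem_range.mpr hz)
  simp only [hD a b c d e hab hbc hcd hde he, Bool.false_or, Bool.or_eq_true, Bool.and_eq_true,
    Nat.beq_eq] at root
  have hW := (fits_or_hole hab hbc hcd hde he).1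
  rw [initLanes, List.getD_eq_getElem _ _ (by simpa using hz), List.getElem_map,
    List.getElem_range]
  refine testBit_shiftLeft_add (i := 622 * l + (wt5 a b c d e - 14)) (pack_testBit ?_) (by omega)
  rw [List.getD_eq_getElem _ _ (by simpa using hl), List.getElem_map]
  refine branchLane_testBit (wt5_sub_lt hab hbc hcd hde he) (root.resolve_right fun h => ?_)
    fun q hq h => hp q hq a b c d e hab hbc hcd hde he h
  have h4 : chi D a b c d = true := by
    have : a = 0 ∧ b = 1 ∧ c = 2 ∧ d = 3 := by omega
    simp [this, chi, h0]
  have h5 : ∀ p q r s t : Bool, s = true →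
      Nat.testBit (t.toNat + 2 * p.toNat + 4 * q.toNat + 8 * r.toNat + 16 * s.toNat) 4 = true := by
    decide
  rw [pat, h5 _ _ _ _ _ h4] at h
  simp at h

theorem refute_eq_false {D : ℕ → ℕ → ℕ → ℕ → ℝ} (h : IsChirotope D)
    (hD : ∀ a b c d e, a < b → b < c → c < d → d < e → e < 11 →
      bad a b c d e (pat D a b c d e) = false) (h0 : 0 < D 0 1 2 3)
    {P : List (List (ℕ × ℕ))} {p : List (ℕ × ℕ)} (hP : p ∈ P) (hp : Follows D p) (n : ℕ) :
    refute n P = false := by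
  obtain ⟨l, hl, rfl⟩ := List.getElem_of_mem hP
  simp only [refute, strict_eq, withMask_eq]
  exact strictList_of_admits (initLanes_admits hD h0 hl hp) fun L s hL =>
    iter_of_admits h hl n hL fun L s hL => allZero_of_admits hL s

theorem labelsLT_caseTree : caseTree.labelsLT 6 = true := by decide +kernel

/-- No chirotope on eleven points avoids piercing the faces. -/
theorem core (D : ℕ → ℕ → ℕ → ℕ → ℝ) (h : IsChirotope D)
    (hD : ∀ a b c d e, a < b → b < c → c < d → d < e → e < 11 →
      bad a b c d e (pat D a b c d e) = false) (h0 : 0 < D 0 1 2 3) : False := by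
  obtain ⟨b, hb, p, hP, hp⟩ := exists_branch D 6 caseTree [] (by simp [Follows])
    labelsLT_caseTree
  have key := refute_eq_false h hD h0 hP hp
  interval_cases b
  · exact Bool.false_ne_true ((key 8).symm.trans refute_batch_zero)
  · exact Bool.false_ne_true ((key 10).symm.trans refute_batch_one)
  · exact Bool.false_ne_true ((key 13).symm.trans refute_batch_two)
  · exact Bool.false_ne_true ((key 17).symm.trans refute_batch_three)
  · exact Bool.false_ne_true ((key 22).symm.trans refute_batch_four)
  · exact Bool.false_ne_true ((key 34).symm.trans refute_batch_five)

/-- The orientation of four points with coordinates `X`, `Y`, `Z`. -/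
def orient (X Y Z : ℕ → ℝ) (a b c d : ℕ) : ℝ :=
  (X b - X a) * ((Y c - Y a) * (Z d - Z a) - (Z c - Z a) * (Y d - Y a)) -
  (Y b - Y a) * ((X c - X a) * (Z d - Z a) - (Z c - Z a) * (X d - X a)) +
  (Z b - Z a) * ((X c - X a) * (Y d - Y a) - (Y c - Y a) * (X d - X a))

theorem orient_gp (X Y Z : ℕ → ℝ) (a b c d e f : ℕ) :
    orient X Y Z a b c d * orient X Y Z a b e f - orient X Y Z a b c e * orient X Y Z a b d f +
      orient X Y Z a b c f * orient X Y Z a b d e = 0 := by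
  unfold orient
  generalize X b - X a = x1, X c - X a = x2, X d - X a = x3, X e - X a = x4, X f - X a = x5,
    Y b - Y a = y1, Y c - Y a = y2, Y d - Y a = y3, Y e - Y a = y4, Y f - Y a = y5,
    Z b - Z a = z1, Z c - Z a = z2, Z d - Z a = z3, Z e - Z a = z4, Z f - Z a = z5
  ring

theorem orient_sum (X Y Z : ℕ → ℝ) (α β γ u : ℝ) (a b c d e : ℕ) :
    orient X Y Z b c d e * (α * X a + β * Y a + γ * Z a - u) +
      -orient X Y Z a c d e * (α * X b + β * Y b + γ * Z b - u) +
      orient X Y Z a b d e * (α * X c + β * Y c + γ * Z c - u) +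
      -orient X Y Z a b c e * (α * X d + β * Y d + γ * Z d - u) +
      orient X Y Z a b c d * (α * X e + β * Y e + γ * Z e - u) = 0 := by
  unfold orient
  ring

/-- `x` is positive or negative according to `s`. -/
def HasSign (s : Bool) (x : ℝ) : Prop :=
  bif s then 0 < x else x < 0

theorem hasSign_chi {D : ℕ → ℕ → ℕ → ℕ → ℝ} {a b c d : ℕ} (h : D a b c d ≠ 0) :
    HasSign (chi D a b c d) (D a b c d) := by
  classical
  rcases lt_or_gt_of_ne h with h' | h' <;> simp [HasSign, chi, h', h'.le]

theorem HasSign.neg {s : Bool} {x : ℝ} (h : HasSign s x) : HasSign (!s) (-x) := by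
  cases s <;> simpa [HasSign] using h

theorem HasSign.of_eq {s t : Bool} {x : ℝ} (h : HasSign s x) (e : s = t) : HasSign t x :=
  e ▸ h

theorem HasSign.mul_neg {s : Bool} {x y : ℝ} (h : HasSign s x) (hy : y < 0) :
    HasSign (!s) (x * y) := by
  cases s
  · exact mul_pos_of_neg_of_neg h hy
  · exact mul_neg_of_pos_of_neg h hy

theorem HasSign.mul_pos {s : Bool} {x y : ℝ} (h : HasSign s x) (hy : 0 < y) :
    HasSign s (x * y) := by
  cases s
  · exact mul_neg_of_neg_of_pos h hy
  · exact _root_.mul_pos h hy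

theorem HasSign.add_ne_zero {s : Bool} {x₀ x₁ x₂ x₃ x₄ : ℝ} (h₀ : HasSign s x₀)
    (h₁ : HasSign s x₁) (h₂ : HasSign s x₂) (h₃ : HasSign s x₃) (h₄ : HasSign s x₄) :
    x₀ + x₁ + x₂ + x₃ + x₄ ≠ 0 := by
  cases s <;> simp only [HasSign, cond_true, cond_false] at * <;> intro h <;> linarith

/-- A plane separates the points `p`, `q` from the points `a`, `b`, `c`. -/
def Separated (X Y Z : ℕ → ℝ) (p q a b c : ℕ) : Prop :=
  ∃ α β γ u, α * X p + β * Y p + γ * Z p - u < 0 ∧ α * X q + β * Y q + γ * Z q - u < 0 ∧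
    0 < α * X a + β * Y a + γ * Z a - u ∧ 0 < α * X b + β * Y b + γ * Z b - u ∧
    0 < α * X c + β * Y c + γ * Z c - u

theorem bad_cases (a b c d e : ℕ) (c0 c1 c2 c3 c4 : Bool)
    (h : bad a b c d e (c0.toNat + 2 * c1.toNat + 4 * c2.toNat + 8 * c3.toNat + 16 * c4.toNat) =
      true) : (c1 = !c0 ∧ c2 = c0 ∧ c3 = !c0 ∧ c4 = c0) ∨
    (face c d e = true ∧ (!c1) = c0 ∧ c2 = !c0 ∧ (!c3) = !c0 ∧ c4 = !c0) ∨
    (face b d e = true ∧ c2 = c0 ∧ (!c1) = !c0 ∧ (!c3) = !c0 ∧ c4 = !c0) ∨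
    (face b c e = true ∧ (!c3) = c0 ∧ (!c1) = !c0 ∧ c2 = !c0 ∧ c4 = !c0) ∨
    (face b c d = true ∧ c4 = c0 ∧ (!c1) = !c0 ∧ c2 = !c0 ∧ (!c3) = !c0) ∨
    (face a d e = true ∧ c2 = (!c1) ∧ c0 = !(!c1) ∧ (!c3) = !(!c1) ∧ c4 = !(!c1)) ∨
    (face a c e = true ∧ (!c3) = (!c1) ∧ c0 = !(!c1) ∧ c2 = !(!c1) ∧ c4 = !(!c1)) ∨
    (face a c d = true ∧ c4 = (!c1) ∧ c0 = !(!c1) ∧ c2 = !(!c1) ∧ (!c3) = !(!c1)) ∨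
    (face a b e = true ∧ (!c3) = c2 ∧ c0 = !c2 ∧ (!c1) = !c2 ∧ c4 = !c2) ∨
    (face a b d = true ∧ c4 = c2 ∧ c0 = !c2 ∧ (!c1) = !c2 ∧ (!c3) = !c2) ∨
    (face a b c = true ∧ c4 = (!c3) ∧ c0 = !(!c3) ∧ (!c1) = !(!c3) ∧ c2 = !(!c3)) := by
  revert h
  cases c0 <;> cases c1 <;> cases c2 <;> cases c3 <;> cases c4 <;> simp [bad]

theorem isChirotope_orient {X Y Z : ℕ → ℝ} (hne : ∀ a b c d, a < 11 → b < 11 → c < 11 → d < 11 →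
    [a, b, c, d].Nodup → orient X Y Z a b c d ≠ 0) : IsChirotope (orient X Y Z) where
  swap₁ a b c d := by unfold orient; ring
  swap₂ a b c d := by unfold orient; ring
  swap₃ a b c d := by unfold orient; ring
  gp := orient_gp X Y Z
  ne_zero := hne
  acyc a b c d e ha hb hc hd he hn := by
    have n (p q r s : ℕ) (hp : p < 11) (hq : q < 11) (hr : r < 11) (hs : s < 11)
      (hl : [p, q, r, s].Sublist [a, b, c, d, e]) :=
        hasSign_chi (hne p q r s hp hq hr hs (hn.sublist hl))
    have S0 := n b c d e ‹_› ‹_› ‹_› ‹_› (by simp)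
    have S1 := (n a c d e ‹_› ‹_› ‹_› ‹_› (by simp)).neg
    have S2 := n a b d e ‹_› ‹_› ‹_› ‹_› (by simp)
    have S3 := (n a b c e ‹_› ‹_› ‹_› ‹_› (by simp)).neg
    have S4 := n a b c d ‹_› ‹_› ‹_› ‹_› (by simp)
    have key := orient_sum X Y Z 0 0 0 (-1) a b c d e
    simp only [zero_mul, add_zero, sub_neg_eq_add, zero_add, mul_one] at key
    have spec : ∀ c0 c1 c2 c3 c4 : Bool,
        (c0.toNat + 2 * c1.toNat + 4 * c2.toNat + 8 * c3.toNat + 16 * c4.toNat = 10 ∨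
          c0.toNat + 2 * c1.toNat + 4 * c2.toNat + 8 * c3.toNat + 16 * c4.toNat = 21) →
        (!c1) = c0 ∧ c2 = c0 ∧ (!c3) = c0 ∧ c4 = c0 := by decide
    rw [← not_or]
    intro h
    obtain ⟨h1, h2, h3, h4⟩ := spec _ _ _ _ _ h
    exact HasSign.add_ne_zero S0 (h1 ▸ S1) (h2 ▸ S2) (h3 ▸ S3) (h4 ▸ S4) key

theorem bad_eq_false_of_separated {X Y Z : ℕ → ℝ} (hne : ∀ a b c d, a < 11 → b < 11 → c < 11 →
      d < 11 → [a, b, c, d].Nodup → orient X Y Z a b c d ≠ 0)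
    (hsep : ∀ p q a b c, p < q → q < 11 → a < b → b < c → c < 11 → [p, q, a, b, c].Nodup →
      face a b c = true → Separated X Y Z p q a b c)
    {a b c d e : ℕ} (hab : a < b) (hbc : b < c) (hcd : c < d) (hde : d < e) (he : e < 11) :
    bad a b c d e (pat (orient X Y Z) a b c d e) = false := by
  have hn : [a, b, c, d, e].Nodup := by simp; omega
  rw [← Bool.not_eq_true]
  intro h
  have n (p q r s : ℕ) (hp : p < 11) (hq : q < 11) (hr : r < 11) (hs : s < 11)
    (hl : [p, q, r, s].Sublist [a, b, c, d, e]) :=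
      hasSign_chi (hne p q r s hp hq hr hs (hn.sublist hl))
  have S0 := n b c d e (by omega) (by omega) (by omega) (by omega) (by simp)
  have S1 := (n a c d e (by omega) (by omega) (by omega) (by omega) (by simp)).neg
  have S2 := n a b d e (by omega) (by omega) (by omega) (by omega) (by simp)
  have S3 := (n a b c e (by omega) (by omega) (by omega) (by omega) (by simp)).neg
  have S4 := n a b c d (by omega) (by omega) (by omega) (by omega) (by simp)
  have key (α β γ u : ℝ) := orient_sum X Y Z α β γ u a b c d e
  rcases bad_cases a b c d e _ _ _ _ _ h with h' | h' | h' | h' | h' | h' | h' | h' | h' | h' | h'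
  · have := (isChirotope_orient hne).acyc a b c d e (by omega) (by omega) (by omega) (by omega)
      he hn
    have spec : ∀ c0 c1 c2 c3 c4 : Bool, (c1 = !c0 ∧ c2 = c0 ∧ c3 = !c0 ∧ c4 = c0) →
        (c0.toNat + 2 * c1.toNat + 4 * c2.toNat + 8 * c3.toNat + 16 * c4.toNat = 10 ∨
          c0.toNat + 2 * c1.toNat + 4 * c2.toNat + 8 * c3.toNat + 16 * c4.toNat = 21) := by decide
    exact not_or.mpr this (spec _ _ _ _ _ h')
  · obtain ⟨hf, e1, e2, e3, e4⟩ := h'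
    obtain ⟨α, β, γ, u, g1, g2, g3, g4, g5⟩ := hsep a b c d e (by omega) (by omega) (by omega)
      (by omega) (by omega) (by simp; omega) hf
    exact HasSign.add_ne_zero (S0.mul_neg g1) ((S1.of_eq e1).mul_neg g2) ((S2.of_eq e2).mul_pos g3)
      ((S3.of_eq e3).mul_pos g4) ((S4.of_eq e4).mul_pos g5) (key α β γ u)
  · obtain ⟨hf, e1, e2, e3, e4⟩ := h'
    obtain ⟨α, β, γ, u, g1, g2, g3, g4, g5⟩ := hsep a c b d e (by omega) (by omega) (by omega)
      (by omega) (by omega) (by simp; omega) hf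
    exact HasSign.add_ne_zero (S0.mul_neg g1) ((S1.of_eq e2).mul_pos g3) ((S2.of_eq e1).mul_neg g2)
      ((S3.of_eq e3).mul_pos g4) ((S4.of_eq e4).mul_pos g5) (key α β γ u)
  · obtain ⟨hf, e1, e2, e3, e4⟩ := h'
    obtain ⟨α, β, γ, u, g1, g2, g3, g4, g5⟩ := hsep a d b c e (by omega) (by omega) (by omega)
      (by omega) (by omega) (by simp; omega) hf
    exact HasSign.add_ne_zero (S0.mul_neg g1) ((S1.of_eq e2).mul_pos g3) ((S2.of_eq e3).mul_pos g4)
      ((S3.of_eq e1).mul_neg g2) ((S4.of_eq e4).mul_pos g5) (key α β γ u)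
  · obtain ⟨hf, e1, e2, e3, e4⟩ := h'
    obtain ⟨α, β, γ, u, g1, g2, g3, g4, g5⟩ := hsep a e b c d (by omega) (by omega) (by omega)
      (by omega) (by omega) (by simp; omega) hf
    exact HasSign.add_ne_zero (S0.mul_neg g1) ((S1.of_eq e2).mul_pos g3) ((S2.of_eq e3).mul_pos g4)
      ((S3.of_eq e4).mul_pos g5) ((S4.of_eq e1).mul_neg g2) (key α β γ u)
  · obtain ⟨hf, e1, e2, e3, e4⟩ := h'
    obtain ⟨α, β, γ, u, g1, g2, g3, g4, g5⟩ := hsep b c a d e (by omega) (by omega) (by omega)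
      (by omega) (by omega) (by simp; omega) hf
    exact HasSign.add_ne_zero ((S0.of_eq e2).mul_pos g3) (S1.mul_neg g1) ((S2.of_eq e1).mul_neg g2)
      ((S3.of_eq e3).mul_pos g4) ((S4.of_eq e4).mul_pos g5) (key α β γ u)
  · obtain ⟨hf, e1, e2, e3, e4⟩ := h'
    obtain ⟨α, β, γ, u, g1, g2, g3, g4, g5⟩ := hsep b d a c e (by omega) (by omega) (by omega)
      (by omega) (by omega) (by simp; omega) hf
    exact HasSign.add_ne_zero ((S0.of_eq e2).mul_pos g3) (S1.mul_neg g1) ((S2.of_eq e3).mul_pos g4)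
      ((S3.of_eq e1).mul_neg g2) ((S4.of_eq e4).mul_pos g5) (key α β γ u)
  · obtain ⟨hf, e1, e2, e3, e4⟩ := h'
    obtain ⟨α, β, γ, u, g1, g2, g3, g4, g5⟩ := hsep b e a c d (by omega) (by omega) (by omega)
      (by omega) (by omega) (by simp; omega) hf
    exact HasSign.add_ne_zero ((S0.of_eq e2).mul_pos g3) (S1.mul_neg g1) ((S2.of_eq e3).mul_pos g4)
      ((S3.of_eq e4).mul_pos g5) ((S4.of_eq e1).mul_neg g2) (key α β γ u)
  · obtain ⟨hf, e1, e2, e3, e4⟩ := h'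
    obtain ⟨α, β, γ, u, g1, g2, g3, g4, g5⟩ := hsep c d a b e (by omega) (by omega) (by omega)
      (by omega) (by omega) (by simp; omega) hf
    exact HasSign.add_ne_zero ((S0.of_eq e2).mul_pos g3) ((S1.of_eq e3).mul_pos g4) (S2.mul_neg g1)
      ((S3.of_eq e1).mul_neg g2) ((S4.of_eq e4).mul_pos g5) (key α β γ u)
  · obtain ⟨hf, e1, e2, e3, e4⟩ := h'
    obtain ⟨α, β, γ, u, g1, g2, g3, g4, g5⟩ := hsep c e a b d (by omega) (by omega) (by omega)
      (by omega) (by omega) (by simp; omega) hf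
    exact HasSign.add_ne_zero ((S0.of_eq e2).mul_pos g3) ((S1.of_eq e3).mul_pos g4) (S2.mul_neg g1)
      ((S3.of_eq e4).mul_pos g5) ((S4.of_eq e1).mul_neg g2) (key α β γ u)
  · obtain ⟨hf, e1, e2, e3, e4⟩ := h'
    obtain ⟨α, β, γ, u, g1, g2, g3, g4, g5⟩ := hsep d e a b c (by omega) (by omega) (by omega)
      (by omega) (by omega) (by simp; omega) hf
    exact HasSign.add_ne_zero ((S0.of_eq e2).mul_pos g3) ((S1.of_eq e3).mul_pos g4) ((S2.of_eq e4).mul_pos g5)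
      (S3.mul_neg g1) ((S4.of_eq e1).mul_neg g2) (key α β γ u)

/-- Eleven points in general position such that every edge is separated from every disjoint face
do not exist. -/
theorem not_separated {X Y Z : ℕ → ℝ} (hne : ∀ a b c d, a < 11 → b < 11 → c < 11 →
      d < 11 → [a, b, c, d].Nodup → orient X Y Z a b c d ≠ 0)
    (hsep : ∀ p q a b c, p < q → q < 11 → a < b → b < c → c < 11 → [p, q, a, b, c].Nodup →
      face a b c = true → Separated X Y Z p q a b c) : False := by
  have pos {X : ℕ → ℝ} (hne : ∀ a b c d, a < 11 → b < 11 → c < 11 →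
      d < 11 → [a, b, c, d].Nodup → orient X Y Z a b c d ≠ 0)
      (hsep : ∀ p q a b c, p < q → q < 11 → a < b → b < c → c < 11 → [p, q, a, b, c].Nodup →
        face a b c = true → Separated X Y Z p q a b c) : ¬0 < orient X Y Z 0 1 2 3 :=
    core _ (isChirotope_orient hne) fun _ _ _ _ _ => bad_eq_false_of_separated hne hsep
  have neg (a b c d : ℕ) : orient (fun i => -X i) Y Z a b c d = -orient X Y Z a b c d := by
    unfold orient
    ring
  rcases lt_or_gt_of_ne (hne 0 1 2 3 (by norm_num) (by norm_num) (by norm_num) (by norm_num)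
    (by decide)) with h | h
  · refine pos (X := fun i => -X i) (fun a b c d ha hb hc hd hn => ?_)
      (fun p q a b c h1 h2 h3 h4 h5 h6 h7 => ?_) (by rw [neg]; exact neg_pos.mpr h)
    · rw [neg]
      exact neg_ne_zero.mpr (hne a b c d ha hb hc hd hn)
    · obtain ⟨α, β, γ, u, h⟩ := hsep p q a b c h1 h2 h3 h4 h5 h6 h7
      exact ⟨-α, β, γ, u, by simpa only [neg_mul_neg] using h⟩
  · exact pos hne hsep h

open Filter Topology in
/-- Moving points along the moment curve brings them into general position. -/
theorem eventually_orient_ne_zero (X Y Z : ℕ → ℝ) {a b c d : ℕ} (h : [a, b, c, d].Nodup) :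
    ∀ᶠ ε : ℝ in 𝓝[≠] 0, orient (fun i => X i + ε * i) (fun i => Y i + ε * i ^ 2)
      (fun i => Z i + ε * i ^ 3) a b c d ≠ 0 := by
  set F : ℝ → ℝ := fun ε => orient (fun i => X i + ε * i) (fun i => Y i + ε * i ^ 2)
    (fun i => Z i + ε * i ^ 3) a b c d with hF
  have han : AnalyticOnNhd ℝ F Set.univ := fun x _ => by
    rw [hF]
    unfold orient
    fun_prop
  refine (han 0 trivial).eventually_eq_zero_or_eventually_ne_zero.resolve_left fun h0 => ?_
  have hz : F = 0 := han.eq_of_eventuallyEq (fun x _ => analyticAt_const) h0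
  have hdiff : F 3 - 3 * F 2 + 3 * F 1 - F 0 = 6 * (((b : ℝ) - a) * (c - a) * (d - a) *
      (c - b) * (d - b) * (d - c)) := by
    simp only [hF, orient]
    ring
  simp only [hz, Pi.zero_apply] at hdiff
  have sub_ne {i j : ℕ} (hij : i ≠ j) : (j : ℝ) - i ≠ 0 :=
    sub_ne_zero.mpr (by exact_mod_cast hij.symm)
  simp only [List.nodup_cons, List.mem_cons, List.not_mem_nil, or_false, not_or] at h
  have := mul_ne_zero (mul_ne_zero (mul_ne_zero (mul_ne_zero (mul_ne_zero (sub_ne h.1.1)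
    (sub_ne h.1.2.1)) (sub_ne h.1.2.2)) (sub_ne h.2.1.1)) (sub_ne h.2.1.2)) (sub_ne h.2.2.1)
  exact this (by linarith)

open Filter Topology in
/-- Separation persists under small movements. -/
theorem Separated.eventually {X Y Z : ℕ → ℝ} {p q a b c : ℕ} (h : Separated X Y Z p q a b c) :
    ∀ᶠ ε : ℝ in 𝓝 0, Separated (fun i => X i + ε * i) (fun i => Y i + ε * i ^ 2)
      (fun i => Z i + ε * i ^ 3) p q a b c := by
  obtain ⟨α, β, γ, u, h1, h2, h3, h4, h5⟩ := h
  have ht (i : ℕ) : Tendsto (fun ε : ℝ => α * (X i + ε * i) + β * (Y i + ε * i ^ 2) +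
      γ * (Z i + ε * i ^ 3) - u) (𝓝 0) (𝓝 (α * X i + β * Y i + γ * Z i - u)) := by
    have hc : Continuous fun ε : ℝ => α * (X i + ε * i) + β * (Y i + ε * i ^ 2) +
      γ * (Z i + ε * i ^ 3) - u := by fun_prop
    simpa using hc.tendsto 0
  filter_upwards [(ht p).eventually_lt_const h1, (ht q).eventually_lt_const h2,
    (ht a).eventually_const_lt h3, (ht b).eventually_const_lt h4,
    (ht c).eventually_const_lt h5] with ε e1 e2 e3 e4 e5
  exact ⟨α, β, γ, u, e1, e2, e3, e4, e5⟩

open Filter Topology in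
/-- Eleven points such that every edge is separated from every disjoint face do not exist, even
if the points are not in general position. -/
theorem not_forall_separated (X Y Z : ℕ → ℝ) (hsep : ∀ p q a b c, p < q → q < 11 → a < b → b < c →
    c < 11 → [p, q, a, b, c].Nodup → face a b c = true → Separated X Y Z p q a b c) : False := by
  have h1 : ∀ᶠ ε : ℝ in 𝓝[≠] 0, ∀ a b c d : Fin 11, [(a : ℕ), ↑b, ↑c, ↑d].Nodup →
      orient (fun i => X i + ε * i) (fun i => Y i + ε * i ^ 2)
        (fun i => Z i + ε * i ^ 3) a b c d ≠ 0 := by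
    simp only [eventually_all]
    exact fun a b c d => eventually_orient_ne_zero X Y Z
  have h2 : ∀ᶠ ε : ℝ in 𝓝[≠] 0, ∀ p q a b c : Fin 11, p < q → a < b → b < c →
      [(p : ℕ), ↑q, ↑a, ↑b, ↑c].Nodup → face a b c = true →
      Separated (fun i => X i + ε * i) (fun i => Y i + ε * i ^ 2)
        (fun i => Z i + ε * i ^ 3) p q a b c := by
    simp only [eventually_all]
    exact fun p q a b c h1 h2 h3 h4 h5 =>
      ((hsep p q a b c h1 q.2 h2 h3 c.2 h4 h5).eventually).filter_mono nhdsWithin_le_nhds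
  obtain ⟨ε, e1, e2⟩ := (h1.and h2).exists
  exact not_separated (fun a b c d ha hb hc hd => e1 ⟨a, ha⟩ ⟨b, hb⟩ ⟨c, hc⟩ ⟨d, hd⟩)
    fun p q a b c h1 h2 h3 h4 h5 => e2 ⟨p, h1.trans h2⟩ ⟨q, h2⟩ ⟨a, (h3.trans h4).trans h5⟩
      ⟨b, h4.trans h5⟩ ⟨c, h5⟩ h1 h3 h4

/-- Disjoint convex hulls of finite sets are separated by a plane. -/
theorem separated_of_disjoint {f : ℕ → EuclideanSpace ℝ (Fin 3)} {p q a b c : ℕ}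
    (h : Disjoint (convexHull ℝ (f '' {p, q})) (convexHull ℝ (f '' {a, b, c}))) :
    Separated (fun i => f i 0) (fun i => f i 1) (fun i => f i 2) p q a b c := by
  have cpt (s : Set ℕ) (hs : s.Finite) : IsCompact (convexHull ℝ (f '' s)) :=
    (hs.image f).isCompact_convexHull ℝ
  obtain ⟨φ, u, v, h1, h2, h3⟩ := geometric_hahn_banach_compact_closed (convex_convexHull ℝ _)
    (cpt {p, q} (by simp)) (convex_convexHull ℝ _) (cpt {a, b, c} (by simp)).isClosed h
  have hφ (x : EuclideanSpace ℝ (Fin 3)) : φ (EuclideanSpace.basisFun _ ℝ 0) * x 0 +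
      φ (EuclideanSpace.basisFun _ ℝ 1) * x 1 + φ (EuclideanSpace.basisFun _ ℝ 2) * x 2 = φ x := by
    conv_rhs => rw [← (EuclideanSpace.basisFun _ ℝ).sum_repr x]
    simp [Fin.sum_univ_three, mul_comm]
  have mem (i : ℕ) (s : Set ℕ) (hi : i ∈ s) : f i ∈ convexHull ℝ (f '' s) :=
    subset_convexHull ℝ _ ⟨i, hi, rfl⟩
  refine ⟨φ (EuclideanSpace.basisFun _ ℝ 0), φ (EuclideanSpace.basisFun _ ℝ 1),
    φ (EuclideanSpace.basisFun _ ℝ 2), u, ?_⟩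
  simp only [hφ, sub_neg, sub_pos]
  exact ⟨h1 _ (mem p _ (by simp)), h1 _ (mem q _ (by simp)), h2.trans (h3 _ (mem a _ (by simp))),
    h2.trans (h3 _ (mem b _ (by simp))), h2.trans (h3 _ (mem c _ (by simp)))⟩

/-- The vertices of an oriented triangle. -/
def tri (t : ℕ × ℕ × ℕ) : Finset ℕ := {t.1, t.2.1, t.2.2}

/-- The triangles of a list of oriented triangles. -/
def triangles (O : List (ℕ × ℕ × ℕ)) : Finset (Finset ℕ) := (O.map tri).toFinset

theorem mem_triangles {O : List (ℕ × ℕ × ℕ)} {S : Finset ℕ} :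
    S ∈ triangles O ↔ ∃ t ∈ O, tri t = S := by
  simp [triangles]

/-- Triangles on the vertices `0, …, 10` which do not embed in three-space. -/
def coreList : List (ℕ × ℕ × ℕ) := [
    (1, 2, 3), (1, 3, 6), (1, 4, 9), (1, 5, 10), (1, 6, 0), (2, 4, 5), (2, 5, 9), (2, 7, 10),
    (2, 10, 0), (3, 4, 8), (3, 9, 0), (4, 6, 10), (4, 7, 0), (5, 7, 8), (6, 7, 9), (6, 8, 0),
    (6, 9, 10), (2, 1, 7), (4, 1, 8), (5, 1, 0), (7, 1, 9), (8, 1, 10), (3, 2, 9), (4, 2, 6),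
    (8, 2, 0), (4, 3, 5), (5, 3, 10), (6, 3, 7), (7, 3, 8), (10, 3, 0), (7, 4, 10), (9, 4, 0),
    (6, 5, 8), (7, 5, 0), (9, 8, 10)]

/-- The cone, with apex `11`, over the boundary of the core. -/
def coneList : List (ℕ × ℕ × ℕ) := [
    (11, 2, 8), (11, 5, 6), (11, 8, 9), (2, 11, 6), (5, 11, 9)]

theorem exists_core_of_face : ∀ a b c : Fin 11, a < b → b < c → face a b c = true →
    {(a : ℕ), (b : ℕ), (c : ℕ)} ∈ triangles coreList := by
  decide +kernel

theorem exists_core_edge : ∀ p q : Fin 11, p < q →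
    ∃ S ∈ triangles coreList, (p : ℕ) ∈ S ∧ (q : ℕ) ∈ S := by
  decide +kernel

/-- Surfaces containing the core have no polyhedral realization. -/
theorem not_admitsPolyRealization {K : Finset (Finset ℕ)} (hK : triangles coreList ⊆ K) :
    ¬AdmitsPolyRealization K := by
  rintro ⟨f, -, hf⟩
  refine not_forall_separated (fun i => f i 0) (fun i => f i 1) (fun i => f i 2)
    fun p q a b c h1 h2 h3 h4 h5 hn hface => separated_of_disjoint ?_
  obtain ⟨S, hS, hp, hq⟩ := exists_core_edge ⟨p, h1.trans h2⟩ ⟨q, h2⟩ h1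
  have hT := exists_core_of_face ⟨a, (h3.trans h4).trans h5⟩ ⟨b, h4.trans h5⟩ ⟨c, h5⟩ h3 h4 hface
  have hd : ({p, q} : Finset ℕ) ∩ {a, b, c} = ∅ := by
    simp only [List.nodup_cons, List.mem_cons, List.not_mem_nil, or_false, not_or] at hn
    ext x
    simp only [mem_inter, mem_insert, mem_singleton, notMem_empty, iff_false]
    omega
  have key := hf {p, q} {a, b, c} ⟨by simp, S, hK hS, by simp [insert_subset_iff, *]⟩
    ⟨by simp, _, hK hT, subset_rfl⟩
  rw [hd] at key
  rw [Set.disjoint_iff_inter_eq_empty]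
  simpa using key

/-- Repeatedly adding all elements related to a previous one. -/
def grow {α : Type*} [DecidableEq α] (P : Finset α) (r : α → α → Prop) [DecidableRel r] :
    ℕ → Finset α → Finset α
  | 0, R => R
  | n + 1, R => grow P r n (R ∪ P.filter fun B => ∃ A ∈ R, r A B)

theorem reflTransGen_of_mem_grow {α : Type*} [DecidableEq α] {P : Finset α} {r : α → α → Prop}
    [DecidableRel r] {x y : α} (n : ℕ) {R : Finset α} (hR : ∀ z ∈ R, Relation.ReflTransGen r x z)
    (h : y ∈ grow P r n R) : Relation.ReflTransGen r x y := by
  induction n generalizing R with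
  | zero => exact hR y h
  | succ n ih =>
    refine ih (fun z hz => ?_) h
    rcases mem_union.mp hz with hz | hz
    · exact hR z hz
    · obtain ⟨-, A, hA, hAz⟩ := mem_filter.mp hz
      exact (hR A hA).tail hAz

theorem reflTransGen_of_subset_grow {α : Type*} [DecidableEq α] {P Q : Finset α}
    {r : α → α → Prop} [DecidableRel r] [Std.Symm r] (n : ℕ)
    (h : ∃ x ∈ P, Q ⊆ grow P r n {x}) {y z : α} (hy : y ∈ Q) (hz : z ∈ Q) :
    Relation.ReflTransGen r y z := by
  obtain ⟨x, -, h⟩ := h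
  have hx (w : α) (hw : w ∈ Q) : Relation.ReflTransGen r x w :=
    reflTransGen_of_mem_grow n (by simp [Relation.ReflTransGen.refl]) (h hw)
  exact (symm (r := Relation.ReflTransGen r) (hx y hy)).trans (hx z hz)

/-- Adjacency of triangles of `K`. -/
def Adj (K : Finset (Finset ℕ)) (A B : Finset ℕ) : Prop :=
  A ∈ K ∧ B ∈ K ∧ (A ∩ B).card = 2

/-- Adjacency of triangles of `K` through the vertex `v`. -/
def AdjAt (K : Finset (Finset ℕ)) (v : ℕ) (A B : Finset ℕ) : Prop :=
  A ∈ K ∧ B ∈ K ∧ v ∈ A ∧ v ∈ B ∧ (A ∩ B).card = 2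

instance (K : Finset (Finset ℕ)) : DecidableRel (Adj K) := fun A B =>
  decidable_of_iff ((A ∩ B).card = 2 ∧ A ∈ K ∧ B ∈ K) (by unfold Adj; tauto)

instance (K : Finset (Finset ℕ)) (v : ℕ) : DecidableRel (AdjAt K v) := fun A B =>
  decidable_of_iff (v ∈ A ∧ v ∈ B ∧ (A ∩ B).card = 2 ∧ A ∈ K ∧ B ∈ K) (by unfold AdjAt; tauto)

instance (K : Finset (Finset ℕ)) : Std.Symm (Adj K) :=
  ⟨fun A B ⟨h1, h2, h3⟩ => ⟨h2, h1, inter_comm A B ▸ h3⟩⟩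

instance (K : Finset (Finset ℕ)) (v : ℕ) : Std.Symm (AdjAt K v) :=
  ⟨fun A B ⟨h1, h2, h3, h4, h5⟩ => ⟨h2, h1, h4, h3, inter_comm A B ▸ h5⟩⟩

/-- Double counting of the edges of a closed surface. -/
theorem two_mul_card_edgesOf {K : Finset (Finset ℕ)} (h3 : ∀ T ∈ K, T.card = 3)
    (h2 : ∀ e : Finset ℕ, e.card = 2 → (∃ T ∈ K, e ⊆ T) →
      (K.filter fun T => e ⊆ T).card = 2) : 2 * (edgesOf K).card = 3 * K.card := by
  have mem {e : Finset ℕ} : e ∈ edgesOf K ↔ e.card = 2 ∧ ∃ T ∈ K, e ⊆ T := by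
    simp only [edgesOf, mem_biUnion, mem_powersetCard]
    tauto
  have key := sum_card_bipartiteAbove_eq_sum_card_bipartiteBelow (s := edgesOf K) (t := K)
    (fun e T : Finset ℕ => e ⊆ T)
  have h2' (e) (he : e ∈ edgesOf K) := h2 e (mem.mp he).1 (mem.mp he).2
  have h3' (T) (hT : T ∈ K) : ((edgesOf K).filter fun e => e ⊆ T).card = 3 := by
    have : ((edgesOf K).filter fun e => e ⊆ T) = T.powersetCard 2 := by
      ext e
      simp only [mem_filter, mem, mem_powersetCard]
      exact ⟨fun h => ⟨h.2, h.1.1⟩, fun h => ⟨⟨h.2, T, hT, h.1⟩, h.1⟩⟩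
    rw [this, card_powersetCard, h3 T hT]
    rfl
  unfold bipartiteAbove bipartiteBelow at key
  rw [sum_congr rfl h2', sum_congr rfl h3'] at key
  simpa [mul_comm] using key

/-- The seven-vertex torus without one of its triangles. -/
def torusPatch : List (ℕ × ℕ × ℕ) := [
  (1, 2, 3), (0, 3, 4), (0, 4, 2), (3, 2, 5), (3, 5, 4), (2, 4, 6), (2, 6, 5),
  (4, 5, 1), (4, 1, 6), (5, 6, 0), (5, 0, 1), (6, 1, 3), (6, 3, 0)]

/-- The subdivision of a triangle by an interior vertex. -/
def conePatch : List (ℕ × ℕ × ℕ) := [(0, 1, 3), (1, 2, 3), (2, 0, 3)]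

/-- The oriented triangles `O` on the vertices `i < m` form a surface with boundary the oriented
triangle `(0, 1, 2)` and no face inside this triangle. -/
structure IsPatch (m : ℕ) (O : List (ℕ × ℕ × ℕ)) : Prop where
  card : ∀ t ∈ O, (tri t).card = 3
  lt : ∀ t ∈ O, ∀ i ∈ tri t, i < m
  new : ∀ t ∈ O, ∃ i ∈ tri t, 3 ≤ i
  cover : ∀ i < m, ∃ t ∈ O, i ∈ tri t
  boundary : ∀ i < 3, ∀ j < 3, i ≠ j → ((triangles O).filter fun S => {i, j} ⊆ S).card = 1
  interior : ∀ t ∈ O, ∀ i ∈ tri t, ∀ j ∈ tri t, i ≠ j → 3 ≤ j →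
    ((triangles O).filter fun S => {i, j} ⊆ S).card = 2
  link : ∀ i < m, ∃ S ∈ triangles O,
    (triangles O).filter (i ∈ ·) ⊆ grow (triangles O) (AdjAt (triangles O) i) 6 {S}
  connected : ∃ S ∈ triangles O, triangles O ⊆ grow (triangles O) (Adj (triangles O)) 6 {S}
  coherent : ∀ t₁ ∈ O, ∀ t₂ ∈ O, tri t₁ ≠ tri t₂ → ∀ d ∈ dedges t₁, d.1 ∈ tri t₂ → d.2 ∈ tri t₂ →
    (d.2, d.1) ∈ dedges t₂
  boundary_out : ∀ t ∈ O, ∀ d ∈ dedges t, d.1 < 3 → d.2 < 3 → d ∈ dedges (0, 1, 2)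
  boundary_in : ∀ t ∈ O, ∀ d ∈ dedges (0, 1, 2), d.1 ∈ tri t → d.2 ∈ tri t → d ∈ dedges t

theorem isPatch_conePatch : IsPatch 4 conePatch := by
  constructor <;> decide +kernel

theorem isPatch_torusPatch : IsPatch 7 torusPatch := by
  constructor <;> decide +kernel

/-- A certificate for the oriented triangles `O` to form a closed surface. -/
theorem isCombSurface_of_list {n g : ℕ} {O : List (ℕ × ℕ × ℕ)} (hO : triangles O ≠ ∅)
    (h3 : ∀ T ∈ triangles O, T.card = 3 ∧ T ⊆ range n)
    (hcov : ∀ v < n, ∃ T ∈ triangles O, v ∈ T)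
    (h2 : ∀ i < n, ∀ j < n, i ≠ j → (∃ T ∈ triangles O, {i, j} ⊆ T) →
      ((triangles O).filter fun T => {i, j} ⊆ T).card = 2)
    (hlink : ∀ v < n, ∃ S ∈ triangles O,
      (triangles O).filter (v ∈ ·) ⊆ grow (triangles O) (AdjAt (triangles O) v) 6 {S})
    (hconn : ∃ S ∈ triangles O, triangles O ⊆ grow (triangles O) (Adj (triangles O)) 8 {S})
    (hcoh : ∀ t₁ ∈ O, ∀ t₂ ∈ O, tri t₁ ≠ tri t₂ →
      ∀ d ∈ dedges t₁, d.1 ∈ tri t₂ → d.2 ∈ tri t₂ → (d.2, d.1) ∈ dedges t₂)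
    (hcard : 2 * n + 4 * g = 4 + (triangles O).card) :
    IsCombSurface (range n) (triangles O) g := by
  have h2' : ∀ e : Finset ℕ, e.card = 2 → (∃ T ∈ triangles O, e ⊆ T) →
      ((triangles O).filter fun T => e ⊆ T).card = 2 := by
    intro e he hT
    obtain ⟨i, j, hij, rfl⟩ := card_eq_two.mp he
    obtain ⟨T, hT, hs⟩ := id hT
    have := hs.trans (h3 T hT).2
    simp only [insert_subset_iff, singleton_subset_iff, mem_range] at this
    exact h2 i this.1 j this.2 hij ⟨T, hT, hs⟩
  have htwo := two_mul_card_edgesOf (fun T hT => (h3 T hT).1) h2'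
  choose! ω hω hω' using fun S (hS : S ∈ triangles O) => mem_triangles.mp hS
  refine ⟨nonempty_iff_ne_empty.mpr hO, h3, fun v hv => hcov v (mem_range.mp hv), h2', ?_, ?_, ?_,
    ?_⟩
  · intro v hv T₁ h1 T₂ h2 hv1 hv2
    exact reflTransGen_of_subset_grow (r := AdjAt _ v) 6 (hlink v (mem_range.mp hv))
      (mem_filter.mpr ⟨h1, hv1⟩) (mem_filter.mpr ⟨h2, hv2⟩)
  · intro T₁ h1 T₂ h2
    exact reflTransGen_of_subset_grow (r := Adj _) 8 hconn h1 h2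
  · refine ⟨ω, hω', fun T₁ h1 T₂ h2 hne a b _ ha hb hab => ?_⟩
    refine hcoh _ (hω T₁ h1) _ (hω T₂ h2) ?_ _ hab ?_ ?_
    · rwa [hω' T₁ h1, hω' T₂ h2]
    · rw [hω' T₂ h2]
      exact (mem_inter.mp ha).2
    · rw [hω' T₂ h2]
      exact (mem_inter.mp hb).2
  · rw [card_range]
    omega

theorem isCombSurface_base : IsCombSurface (range 12) (triangles (coneList ++ coreList)) 5 := by
  apply isCombSurface_of_list <;> decide +kernel

/-- Paths avoiding `T` through a set `Q` of substitutes. -/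
theorem reflTransGen_substitute {α : Type*} {r r' : α → α → Prop} [Std.Symm r] [Std.Symm r'] {T : α}
    {Q : α → Prop} (h₁ : ∀ A B, r A B → A ≠ T → B ≠ T → r' A B)
    (h₂ : ∀ x y, Q x → Q y → Relation.ReflTransGen r' x y)
    (h₃ : ∀ A, r A T → A ≠ T → ∃ x, Q x ∧ r' A x) {A B : α} (h : Relation.ReflTransGen r A B)
    {a b : α} (ha : A ≠ T ∧ a = A ∨ A = T ∧ Q a) (hb : B ≠ T ∧ b = B ∨ B = T ∧ Q b) :
    Relation.ReflTransGen r' a b := by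
  induction h generalizing b with
  | refl =>
    rcases ha with ⟨h, rfl⟩ | ⟨rfl, ha⟩ <;> rcases hb with ⟨h', rfl⟩ | ⟨h', hb⟩
    · rfl
    · exact absurd h' h
    · exact absurd rfl h'
    · exact h₂ _ _ ha hb
  | @tail B C _ hBC ih =>
    by_cases hB : B = T
    · subst hB
      rcases hb with ⟨hC, rfl⟩ | ⟨hC, hb⟩
      · obtain ⟨x, hx, hr⟩ := h₃ _ (symm hBC) hC
        exact (ih (.inr ⟨rfl, hx⟩)).tail (symm hr)
      · exact ih (.inr ⟨rfl, hb⟩)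
    · have := ih (b := B) (.inl ⟨hB, rfl⟩)
      rcases hb with ⟨hC, rfl⟩ | ⟨rfl, hb⟩
      · exact this.tail (h₁ _ _ hBC hB hC)
      · obtain ⟨x, hx, hr⟩ := h₃ _ hBC hB
        exact (this.tail hr).trans (h₂ _ _ hx hb)

/-- The image of an oriented triangle. -/
def mapTri (ι : ℕ → ℕ) (t : ℕ × ℕ × ℕ) : ℕ × ℕ × ℕ := (ι t.1, ι t.2.1, ι t.2.2)

theorem tri_mapTri (ι : ℕ → ℕ) (t : ℕ × ℕ × ℕ) : tri (mapTri ι t) = (tri t).image ι := by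
  simp [tri, mapTri, image_insert]

theorem mem_dedges_mapTri {ι : ℕ → ℕ} {t : ℕ × ℕ × ℕ} {x y : ℕ} :
    (x, y) ∈ dedges (mapTri ι t) ↔ ∃ d ∈ dedges t, ι d.1 = x ∧ ι d.2 = y := by
  simp [dedges, mapTri, eq_comm]

/-- The triangles of a patch, placed by `ι`. -/
def place (ι : ℕ → ℕ) (O : List (ℕ × ℕ × ℕ)) : Finset (Finset ℕ) :=
  (triangles O).image (image ι)

theorem mem_place {ι : ℕ → ℕ} {O : List (ℕ × ℕ × ℕ)} {S : Finset ℕ} :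
    S ∈ place ι O ↔ ∃ t ∈ O, tri (mapTri ι t) = S := by
  simp [place, mem_triangles, tri_mapTri]

theorem card_filter_place {ι : ℕ → ℕ} (hι : Function.Injective ι) (O : List (ℕ × ℕ × ℕ))
    (i j : ℕ) : ((place ι O).filter fun S => {ι i, ι j} ⊆ S).card =
      ((triangles O).filter fun S => {i, j} ⊆ S).card := by
  rw [place, filter_image, card_image_of_injective _ (image_injective hι)]
  congr 1
  ext S
  simp [insert_subset_iff, hι.eq_iff]

theorem reflTransGen_place {ι : ℕ → ℕ} (hι : Function.Injective ι) {O : List (ℕ × ℕ × ℕ)}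
    {K : Finset (Finset ℕ)} (hK : place ι O ⊆ K) {A B : Finset ℕ}
    (h : Relation.ReflTransGen (Adj (triangles O)) A B) :
    Relation.ReflTransGen (Adj K) (A.image ι) (B.image ι) :=
  h.lift _ fun A B ⟨hA, hB, h⟩ => ⟨hK (mem_image_of_mem _ hA), hK (mem_image_of_mem _ hB), by
    rwa [← image_inter _ _ hι, card_image_of_injective _ hι]⟩

theorem reflTransGen_place_at {ι : ℕ → ℕ} (hι : Function.Injective ι) {O : List (ℕ × ℕ × ℕ)}
    {K : Finset (Finset ℕ)} (hK : place ι O ⊆ K) {A B : Finset ℕ} {i : ℕ}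
    (h : Relation.ReflTransGen (AdjAt (triangles O) i) A B) :
    Relation.ReflTransGen (AdjAt K (ι i)) (A.image ι) (B.image ι) :=
  h.lift _ fun A B ⟨hA, hB, hiA, hiB, h⟩ => ⟨hK (mem_image_of_mem _ hA), hK (mem_image_of_mem _ hB),
    mem_image_of_mem _ hiA, mem_image_of_mem _ hiB, by
      rwa [← image_inter _ _ hι, card_image_of_injective _ hι]⟩

section attach

variable {m g : ℕ} {O : List (ℕ × ℕ × ℕ)} {ι : ℕ → ℕ} {V : Finset ℕ} {K : Finset (Finset ℕ)}
  {T : Finset ℕ}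

theorem exists_of_mem_place {S : Finset ℕ} {x : ℕ} (hP : IsPatch m O) (hS : S ∈ place ι O)
    (hx : x ∈ S) : ∃ i < m, ι i = x := by
  obtain ⟨t, ht, rfl⟩ := mem_place.mp hS
  rw [tri_mapTri] at hx
  obtain ⟨i, hi, rfl⟩ := mem_image.mp hx
  exact ⟨i, hP.lt t ht i hi, rfl⟩

theorem exists_new_of_mem_place {S : Finset ℕ} (hP : IsPatch m O) (hS : S ∈ place ι O)
    (hV : ∀ i, ι i ∈ V ↔ i < 3) : ∃ x ∈ S, x ∉ V := by
  obtain ⟨t, ht, rfl⟩ := mem_place.mp hS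
  obtain ⟨i, hi, h3⟩ := hP.new t ht
  rw [tri_mapTri]
  exact ⟨ι i, mem_image_of_mem _ hi, by rw [hV]; omega⟩

theorem disjoint_place (hP : IsPatch m O) (hV : ∀ i, ι i ∈ V ↔ i < 3) (h3 : ∀ S ∈ K, S ⊆ V) :
    Disjoint K (place ι O) := by
  rw [disjoint_left]
  intro S hS hS'
  obtain ⟨x, hx, hx'⟩ := exists_new_of_mem_place hP hS' hV
  exact hx' (h3 S hS hx)

theorem mem_face_iff (hT : T = (range 3).image ι) (hι : Function.Injective ι) {i : ℕ} :
    ι i ∈ T ↔ i < 3 := by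
  rw [hT, hι.mem_finset_image, mem_range]

theorem card_edge_attach (hP : IsPatch m O) (hι : Function.Injective ι)
    (h3 : ∀ S ∈ K, S.card = 3 ∧ S ⊆ V) (hK : ∀ e : Finset ℕ, e.card = 2 → (∃ S ∈ K, e ⊆ S) →
      (K.filter fun S => e ⊆ S).card = 2) (hTK : T ∈ K) (hT : T = (range 3).image ι)
    (hV : ∀ i, ι i ∈ V ↔ i < 3) (e : Finset ℕ) (he : e.card = 2)
    (hS : ∃ S ∈ K.erase T ∪ place ι O, e ⊆ S) :
    ((K.erase T ∪ place ι O).filter fun S => e ⊆ S).card = 2 := by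
  have hd : Disjoint (K.erase T) (place ι O) :=
    disjoint_of_subset_left (erase_subset _ _) (disjoint_place hP hV fun S hS => (h3 S hS).2)
  rw [filter_union, card_union_of_disjoint (disjoint_filter_filter hd), filter_erase]
  obtain ⟨x, y, hxy, rfl⟩ := card_eq_two.mp he
  by_cases heT : {x, y} ⊆ T
  · rw [card_erase_of_mem (mem_filter.mpr ⟨hTK, heT⟩), hK _ he ⟨T, hTK, heT⟩]
    simp only [hT, insert_subset_iff, singleton_subset_iff, mem_image, mem_range] at heT
    obtain ⟨⟨i, hi, rfl⟩, j, hj, rfl⟩ := heT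
    rw [card_filter_place hι, hP.boundary i hi j hj (fun h => hxy (congrArg ι h))]
  · rw [erase_eq_of_notMem (by simp [heT])]
    by_cases heV : {x, y} ⊆ V
    · have hno : ∀ S ∈ place ι O, ¬{x, y} ⊆ S := by
        intro S hSP hsub
        simp only [insert_subset_iff, singleton_subset_iff] at hsub heV heT
        obtain ⟨i, -, rfl⟩ := exists_of_mem_place hP hSP hsub.1
        obtain ⟨j, -, rfl⟩ := exists_of_mem_place hP hSP hsub.2
        simp only [hV, mem_face_iff hT hι] at heV heT
        exact heT heV
      obtain ⟨S, hS, hsub⟩ := hS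
      rcases mem_union.mp hS with hS | hS
      · rw [hK _ he ⟨S, mem_of_mem_erase hS, hsub⟩, filter_false_of_mem hno, card_empty]
      · exact absurd hsub (hno S hS)
    · have hno : ∀ S ∈ K, ¬{x, y} ⊆ S := fun S hS hsub => heV (hsub.trans (h3 S hS).2)
      rw [filter_false_of_mem hno, card_empty, zero_add]
      obtain ⟨S, hS, hsub⟩ := hS
      rcases mem_union.mp hS with hS | hS
      · exact absurd hsub (hno S (mem_of_mem_erase hS))
      obtain ⟨t, ht, rfl⟩ := mem_place.mp hS
      simp only [tri_mapTri, insert_subset_iff, singleton_subset_iff, mem_image] at hsub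
      obtain ⟨⟨i, hi, rfl⟩, j, hj, rfl⟩ := hsub
      have hij : i ≠ j := fun h => hxy (congrArg ι h)
      simp only [insert_subset_iff, singleton_subset_iff, hV] at heV
      rw [card_filter_place hι]
      by_cases h3j : 3 ≤ j
      · exact hP.interior t ht i hi j hj hij h3j
      · rw [pair_comm]
        exact hP.interior t ht j hj i hi hij.symm (by omega)

theorem exists_adj_place (hP : IsPatch m O) (hι : Function.Injective ι)
    (h3 : ∀ S ∈ K, S.card = 3 ∧ S ⊆ V) (hT : T = (range 3).image ι)
    (hV : ∀ i, ι i ∈ V ↔ i < 3) {A : Finset ℕ} (hA : A ∈ K) (h : (A ∩ T).card = 2) :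
    ∃ S ∈ place ι O, A ∩ T ⊆ S ∧ (A ∩ S).card = 2 := by
  obtain ⟨x, y, hxy, he⟩ := card_eq_two.mp h
  have heT : {x, y} ⊆ T := he ▸ inter_subset_right
  simp only [hT, insert_subset_iff, singleton_subset_iff, mem_image, mem_range] at heT
  obtain ⟨⟨i, hi, rfl⟩, j, hj, rfl⟩ := heT
  have hc := card_filter_place hι O i j
  rw [hP.boundary i hi j hj (fun h => hxy (congrArg ι h))] at hc
  obtain ⟨S, hS⟩ := card_pos.mp (hc ▸ Nat.one_pos)
  obtain ⟨hS, hsub⟩ := mem_filter.mp hS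
  refine ⟨S, hS, he ▸ hsub, ?_⟩
  obtain ⟨t, ht, rfl⟩ := id (mem_place.mp hS)
  have hScard : (tri (mapTri ι t)).card = 3 := by
    rw [tri_mapTri, card_image_of_injective _ hι, hP.card t ht]
  have hle : 2 ≤ (A ∩ tri (mapTri ι t)).card := by
    rw [← h]
    exact card_le_card (subset_inter inter_subset_left (he ▸ hsub))
  have hlt : (A ∩ tri (mapTri ι t)).card < (tri (mapTri ι t)).card := by
    refine card_lt_card ⟨inter_subset_right, fun hsub => ?_⟩
    obtain ⟨z, hz, hz'⟩ := exists_new_of_mem_place hP hS hV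
    exact hz' ((h3 A hA).2 (mem_inter.mp (hsub hz)).1)
  omega

theorem link_attach (hP : IsPatch m O) (hι : Function.Injective ι)
    (h3 : ∀ S ∈ K, S.card = 3 ∧ S ⊆ V) (hK : ∀ v ∈ V, ∀ A ∈ K, ∀ B ∈ K, v ∈ A → v ∈ B →
      Relation.ReflTransGen (AdjAt K v) A B) (hTK : T ∈ K) (hT : T = (range 3).image ι)
    (hV : ∀ i, ι i ∈ V ↔ i < 3) {v : ℕ} {A B : Finset ℕ} (hA : A ∈ K.erase T ∪ place ι O)
    (hB : B ∈ K.erase T ∪ place ι O) (hvA : v ∈ A) (hvB : v ∈ B) :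
    Relation.ReflTransGen (AdjAt (K.erase T ∪ place ι O) v) A B := by
  have hplace (x y) (hx : x ∈ place ι O ∧ v ∈ x) (hy : y ∈ place ι O ∧ v ∈ y) :
      Relation.ReflTransGen (AdjAt (K.erase T ∪ place ι O) v) x y := by
    obtain ⟨i, hi, rfl⟩ := exists_of_mem_place hP hx.1 hx.2
    obtain ⟨X, hX, rfl⟩ := mem_image.mp hx.1
    obtain ⟨Y, hY, rfl⟩ := mem_image.mp hy.1
    refine reflTransGen_place_at hι subset_union_right
      (reflTransGen_of_subset_grow 6 (hP.link i hi) (mem_filter.mpr ⟨hX, ?_⟩)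
        (mem_filter.mpr ⟨hY, ?_⟩))
    · exact hι.mem_finset_image.mp hx.2
    · exact hι.mem_finset_image.mp hy.2
  by_cases hv : v ∈ V
  · have rep {A : Finset ℕ} (hA : A ∈ K.erase T ∪ place ι O) (hvA : v ∈ A) :
        ∃ A' ∈ K, v ∈ A' ∧ (A' ≠ T ∧ A = A' ∨ A' = T ∧ A ∈ place ι O ∧ v ∈ A) := by
      rcases mem_union.mp hA with h | h
      · exact ⟨A, mem_of_mem_erase h, hvA, .inl ⟨ne_of_mem_erase h, rfl⟩⟩
      · refine ⟨T, hTK, ?_, .inr ⟨rfl, h, hvA⟩⟩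
        obtain ⟨i, hi, rfl⟩ := exists_of_mem_place hP h hvA
        rwa [mem_face_iff hT hι, ← hV]
    obtain ⟨A', hA', hvA', hA⟩ := rep hA hvA
    obtain ⟨B', hB', hvB', hB⟩ := rep hB hvB
    refine reflTransGen_substitute ?_ hplace ?_ (hK v hv A' hA' B' hB' hvA' hvB') hA hB
    · rintro C D ⟨h1, h2, h3⟩ hC hD
      exact ⟨mem_union_left _ (mem_erase.mpr ⟨hC, h1⟩), mem_union_left _ (mem_erase.mpr ⟨hD, h2⟩),
        h3⟩
    · rintro C ⟨h1, -, h4, h5, h6⟩ hC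
      obtain ⟨S, hS, hsub, hcard⟩ := exists_adj_place hP hι h3 hT hV h1 h6
      have hvS := hsub (mem_inter.mpr ⟨h4, h5⟩)
      exact ⟨S, ⟨hS, hvS⟩, mem_union_left _ (mem_erase.mpr ⟨hC, h1⟩), mem_union_right _ hS, h4,
        hvS, hcard⟩
  · have mem {A : Finset ℕ} (hA : A ∈ K.erase T ∪ place ι O) (hvA : v ∈ A) :
        A ∈ place ι O ∧ v ∈ A :=
      ⟨(mem_union.mp hA).resolve_left fun h => hv ((h3 A (mem_of_mem_erase h)).2 hvA), hvA⟩
    exact hplace A B (mem hA hvA) (mem hB hvB)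

theorem connected_attach (hP : IsPatch m O) (hι : Function.Injective ι)
    (h3 : ∀ S ∈ K, S.card = 3 ∧ S ⊆ V) (hK : ∀ A ∈ K, ∀ B ∈ K,
      Relation.ReflTransGen (Adj K) A B) (hTK : T ∈ K) (hT : T = (range 3).image ι)
    (hV : ∀ i, ι i ∈ V ↔ i < 3) {A B : Finset ℕ} (hA : A ∈ K.erase T ∪ place ι O)
    (hB : B ∈ K.erase T ∪ place ι O) :
    Relation.ReflTransGen (Adj (K.erase T ∪ place ι O)) A B := by
  have hplace (x y) (hx : x ∈ place ι O) (hy : y ∈ place ι O) :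
      Relation.ReflTransGen (Adj (K.erase T ∪ place ι O)) x y := by
    obtain ⟨X, hX, rfl⟩ := mem_image.mp hx
    obtain ⟨Y, hY, rfl⟩ := mem_image.mp hy
    exact reflTransGen_place hι subset_union_right
      (reflTransGen_of_subset_grow 6 hP.connected hX hY)
  have rep {A : Finset ℕ} (hA : A ∈ K.erase T ∪ place ι O) :
      ∃ A' ∈ K, (A' ≠ T ∧ A = A' ∨ A' = T ∧ A ∈ place ι O) := by
    rcases mem_union.mp hA with h | h
    · exact ⟨A, mem_of_mem_erase h, .inl ⟨ne_of_mem_erase h, rfl⟩⟩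
    · exact ⟨T, hTK, .inr ⟨rfl, h⟩⟩
  obtain ⟨A', hA', hA⟩ := rep hA
  obtain ⟨B', hB', hB⟩ := rep hB
  refine reflTransGen_substitute ?_ hplace ?_ (hK A' hA' B' hB') hA hB
  · rintro C D ⟨h1, h2, h3⟩ hC hD
    exact ⟨mem_union_left _ (mem_erase.mpr ⟨hC, h1⟩), mem_union_left _ (mem_erase.mpr ⟨hD, h2⟩),
      h3⟩
  · rintro C ⟨h1, -, h2⟩ hC
    obtain ⟨S, hS, -, hcard⟩ := exists_adj_place hP hι h3 hT hV h1 h2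
    exact ⟨S, hS, mem_union_left _ (mem_erase.mpr ⟨hC, h1⟩), mem_union_right _ hS, hcard⟩

end attach

theorem isCombSurface_attach {m g g' : ℕ} {O : List (ℕ × ℕ × ℕ)} {ι : ℕ → ℕ} {V : Finset ℕ}
    {K : Finset (Finset ℕ)} {T : Finset ℕ} {ω : Finset ℕ → ℕ × ℕ × ℕ} (hP : IsPatch m O)
    (hι : Function.Injective ι) (hS : IsCombSurface V K g) (hω : ∀ S ∈ K, tri (ω S) = S)
    (hω' : ∀ S ∈ K, ∀ S' ∈ K, S ≠ S' → ∀ a b : ℕ, a ≠ b → a ∈ S ∩ S' → b ∈ S ∩ S' →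
      (a, b) ∈ dedges (ω S) → (b, a) ∈ dedges (ω S')) (hTK : T ∈ K)
    (hT : ω T = mapTri ι (0, 1, 2)) (hV : ∀ i, ι i ∈ V ↔ i < 3)
    (hcard : (triangles O).card + 4 * g = 2 * (m - 3) + 1 + 4 * g') :
    IsCombSurface (V ∪ (Ico 3 m).image ι) (K.erase T ∪ place ι O) g' := by
  obtain ⟨-, h3, hcov, h2, hlink, hconn, -, heuler⟩ := hS
  have hTι : T = (range 3).image ι := by
    rw [← hω T hTK, hT, tri_mapTri]
    rfl
  have hd := disjoint_place (K := K) hP hV fun S hS => (h3 S hS).2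
  have hsub {x : ℕ} {S : Finset ℕ} (hS : S ∈ place ι O) (hx : x ∈ S) (hxV : x ∈ V) : x ∈ T := by
    obtain ⟨i, hi, rfl⟩ := exists_of_mem_place hP hS hx
    rwa [mem_face_iff hTι hι, ← hV]
  have h3' : ∀ S ∈ K.erase T ∪ place ι O, S.card = 3 ∧ S ⊆ V ∪ (Ico 3 m).image ι := by
    intro S hS
    rcases mem_union.mp hS with hS | hS
    · have := h3 S (mem_of_mem_erase hS)
      exact ⟨this.1, this.2.trans subset_union_left⟩
    · refine ⟨?_, fun x hx => ?_⟩
      · obtain ⟨t, ht, rfl⟩ := mem_place.mp hS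
        rw [tri_mapTri, card_image_of_injective _ hι, hP.card t ht]
      · obtain ⟨i, hi, rfl⟩ := exists_of_mem_place hP hS hx
        rw [mem_union, hV, hι.mem_finset_image, mem_Ico]
        omega
  have hplaced {i : ℕ} (hi : i < m) : ∃ S ∈ K.erase T ∪ place ι O, ι i ∈ S := by
    obtain ⟨t, ht, hit⟩ := hP.cover i hi
    exact ⟨_, mem_union_right _ (mem_place.mpr ⟨t, ht, rfl⟩), by
      rw [tri_mapTri]
      exact mem_image_of_mem _ hit⟩
  have hm : 3 < m := by
    obtain ⟨S, hS, -⟩ := hP.connected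
    obtain ⟨t, ht, -⟩ := mem_triangles.mp hS
    obtain ⟨i, hi, h⟩ := hP.new t ht
    exact h.trans_lt (hP.lt t ht i hi)
  have h2' := card_edge_attach hP hι h3 h2 hTK hTι hV
  refine ⟨?_, h3', ?_, h2', fun v hv A hA B hB hvA hvB =>
    link_attach hP hι h3 hlink hTK hTι hV hA hB hvA hvB,
    fun A hA B hB => connected_attach hP hι h3 hconn hTK hTι hV hA hB, ?_, ?_⟩
  · obtain ⟨S, hS, -⟩ := hplaced (i := 0) (by omega)
    exact ⟨S, hS⟩
  · intro v hv
    have old (hvT : v ∈ T) : ∃ S ∈ K.erase T ∪ place ι O, v ∈ S := by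
      rw [hTι] at hvT
      obtain ⟨i, hi, rfl⟩ := mem_image.mp hvT
      exact hplaced ((mem_range.mp hi).trans hm)
    rcases mem_union.mp hv with hv | hv
    · obtain ⟨S, hS, hvS⟩ := hcov v hv
      by_cases hST : S = T
      · exact old (hST ▸ hvS)
      · exact ⟨S, mem_union_left _ (mem_erase.mpr ⟨hST, hS⟩), hvS⟩
    · obtain ⟨i, hi, rfl⟩ := mem_image.mp hv
      exact hplaced (mem_Ico.mp hi).2
  · choose! τ hτ hτ' using fun S (hS : S ∈ place ι O) => mem_place.mp hS
    obtain ⟨σ, hσ, hσ'⟩ : ∃ σ : Finset ℕ → ℕ × ℕ × ℕ, (∀ S ∈ place ι O, σ S = mapTri ι (τ S)) ∧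
        ∀ S ∈ K.erase T, σ S = ω S := by
      refine ⟨fun S => if S ∈ place ι O then mapTri ι (τ S) else ω S, fun S hS => if_pos hS,
        fun S hS => if_neg (disjoint_left.mp hd (mem_of_mem_erase hS))⟩
    refine ⟨σ, fun S hS => ?_, ?_⟩
    · rcases mem_union.mp hS with hS | hS
      · rw [hσ' S hS]
        exact hω S (mem_of_mem_erase hS)
      · rw [hσ S hS]
        exact hτ' S hS
    have mem_iff {S : Finset ℕ} (hS : S ∈ place ι O) {i : ℕ} : ι i ∈ S ↔ i ∈ tri (τ S) := by
      conv_lhs => rw [← hτ' S hS]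
      rw [tri_mapTri, hι.mem_finset_image]
    intro A hA B hB hAB x y hxy hx hy hd'
    rw [mem_inter] at hx hy
    rcases mem_union.mp hA with hA | hA <;> rcases mem_union.mp hB with hB | hB
    · rw [hσ' A hA] at hd'
      rw [hσ' B hB]
      exact hω' A (mem_of_mem_erase hA) B (mem_of_mem_erase hB) hAB x y hxy (mem_inter.mpr hx)
        (mem_inter.mpr hy) hd'
    · rw [hσ' A hA] at hd'
      rw [hσ B hB]
      have hA3 := (h3 A (mem_of_mem_erase hA)).2
      have := hω' A (mem_of_mem_erase hA) T hTK (ne_of_mem_erase hA) x y hxy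
        (mem_inter.mpr ⟨hx.1, hsub hB hx.2 (hA3 hx.1)⟩)
        (mem_inter.mpr ⟨hy.1, hsub hB hy.2 (hA3 hy.1)⟩) hd'
      rw [hT, mem_dedges_mapTri] at this
      obtain ⟨d, hd, rfl, rfl⟩ := this
      exact mem_dedges_mapTri.mpr ⟨d, hP.boundary_in _ (hτ B hB) d hd ((mem_iff hB).mp hy.2)
        ((mem_iff hB).mp hx.2), rfl, rfl⟩
    · rw [hσ A hA] at hd'
      rw [hσ' B hB]
      have hB3 := (h3 B (mem_of_mem_erase hB)).2
      have hxT := hsub hA hx.1 (hB3 hx.2)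
      have hyT := hsub hA hy.1 (hB3 hy.2)
      refine hω' T hTK B (mem_of_mem_erase hB) (ne_of_mem_erase hB).symm x y hxy
        (mem_inter.mpr ⟨hxT, hx.2⟩) (mem_inter.mpr ⟨hyT, hy.2⟩) ?_
      obtain ⟨d, hd, rfl, rfl⟩ := mem_dedges_mapTri.mp hd'
      rw [hT]
      exact mem_dedges_mapTri.mpr ⟨d, hP.boundary_out _ (hτ A hA) d hd
        ((mem_face_iff hTι hι).mp hxT) ((mem_face_iff hTι hι).mp hyT), rfl, rfl⟩
    · rw [hσ A hA] at hd'
      rw [hσ B hB]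
      obtain ⟨d, hd, rfl, rfl⟩ := mem_dedges_mapTri.mp hd'
      refine mem_dedges_mapTri.mpr ⟨(d.2, d.1), hP.coherent _ (hτ A hA) _ (hτ B hB) (fun h => ?_)
        d hd ((mem_iff hB).mp hx.2) ((mem_iff hB).mp hy.2), rfl, rfl⟩
      rw [← hτ' A hA, ← hτ' B hB, tri_mapTri, tri_mapTri, h] at hAB
      exact hAB rfl
  · have e1 := two_mul_card_edgesOf (fun S hS => (h3 S hS).1) h2
    have e2 := two_mul_card_edgesOf (fun S hS => (h3' S hS).1) h2'
    have e3 : (K.erase T ∪ place ι O).card = K.card - 1 + (triangles O).card := by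
      rw [card_union_of_disjoint (disjoint_of_subset_left (erase_subset _ _) hd),
        card_erase_of_mem hTK, place, card_image_of_injective _ (image_injective hι)]
    have e4 : (V ∪ (Ico 3 m).image ι).card = V.card + (m - 3) := by
      rw [card_union_of_disjoint, card_image_of_injective _ hι, Nat.card_Ico]
      rw [disjoint_right]
      intro x hx
      obtain ⟨i, hi, rfl⟩ := mem_image.mp hx
      rw [hV]
      have := (mem_Ico.mp hi).1
      omega
    have e5 : 0 < K.card := card_pos.mpr ⟨T, hTK⟩
    omega

/-- Surfaces of genus `g` with `n` vertices, containing the core and another triangle. -/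
def HasExtension (g n : ℕ) : Prop :=
  ∃ (V : Finset ℕ) (K : Finset (Finset ℕ)), IsCombSurface V K g ∧ V.card = n ∧
    triangles coreList ⊆ K ∧ ∃ T ∈ K, T ∉ triangles coreList

theorem hasExtension_five : HasExtension 5 12 :=
  ⟨_, _, isCombSurface_base, card_range 12, fun S hS => by
    obtain ⟨t, ht, rfl⟩ := mem_triangles.mp hS
    exact mem_triangles.mpr ⟨t, List.mem_append_right _ ht, rfl⟩, {11, 2, 8}, by decide +kernel⟩

theorem HasExtension.attach {g g' n m : ℕ} {O : List (ℕ × ℕ × ℕ)} (h : HasExtension g n)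
    (hP : IsPatch m O) (hcard : (triangles O).card + 4 * g = 2 * (m - 3) + 1 + 4 * g') :
    HasExtension g' (n + (m - 3)) := by
  obtain ⟨V, K, hS, rfl, hcore, T, hTK, hTcore⟩ := h
  obtain ⟨-, h3, -, -, -, -, ⟨ω, hω, hω'⟩, -⟩ := id hS
  obtain ⟨N, hN⟩ : ∃ N, ∀ v ∈ V, v < N :=
    ⟨V.sup id + 1, fun v hv => Nat.lt_succ_of_le (le_sup (f := id) hv)⟩
  obtain ⟨⟨a, b, c⟩, hωT⟩ : ∃ t, ω T = t := ⟨_, rfl⟩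
  have hTω : {a, b, c} = T := by
    rw [← hω T hTK, hωT]
  have hTV := (h3 T hTK).2
  have hne := (h3 T hTK).1
  rw [← hTω] at hTV hne
  rw [card_triple_eq_three_iff] at hne
  simp only [insert_subset_iff, singleton_subset_iff] at hTV
  have ha := hN a hTV.1
  have hb := hN b hTV.2.1
  have hc := hN c hTV.2.2
  let ι : ℕ → ℕ := fun i => if i = 0 then a else if i = 1 then b else if i = 2 then c else N + i
  have hι : Function.Injective ι := by
    intro i j hij
    simp only [ι] at hij
    split_ifs at hij <;> omega
  have hV (i : ℕ) : ι i ∈ V ↔ i < 3 := by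
    simp only [ι]
    split_ifs with h0 h1 h2
    · simp [h0, hTV]
    · simp [h1, hTV]
    · simp [h2, hTV]
    · refine iff_of_false (fun h => ?_) (by omega)
      have := hN _ h
      omega
  have hnew {S : Finset ℕ} (hS : S ∈ place ι O) : S ∉ triangles coreList := fun hSc => by
    obtain ⟨x, hx, hxV⟩ := exists_new_of_mem_place hP hS hV
    exact hxV ((h3 S (hcore hSc)).2 hx)
  refine ⟨_, _, isCombSurface_attach hP hι hS hω hω' hTK hωT hV hcard, ?_, ?_, ?_⟩
  · rw [card_union_of_disjoint, card_image_of_injective _ hι, Nat.card_Ico]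
    rw [disjoint_right]
    intro x hx
    obtain ⟨i, hi, rfl⟩ := mem_image.mp hx
    rw [hV]
    have := (mem_Ico.mp hi).1
    omega
  · exact fun S hS => mem_union_left _ (mem_erase.mpr ⟨fun h => hTcore (h ▸ hS), hcore hS⟩)
  · obtain ⟨S, hS, -⟩ := hP.connected
    have := mem_image_of_mem (image ι) hS
    exact ⟨_, mem_union_right _ this, hnew this⟩

theorem exists_hasExtension {g : ℕ} (hg : 5 ≤ g) (N : ℕ) : ∃ n > N, HasExtension g n := by
  have base : ∃ n, HasExtension g n := by
    induction g, hg using Nat.le_induction with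
    | base => exact ⟨12, hasExtension_five⟩
    | succ g _ ih =>
      obtain ⟨n, h⟩ := ih
      refine ⟨n + (7 - 3), h.attach isPatch_torusPatch ?_⟩
      have : (triangles torusPatch).card = 13 := by decide +kernel
      omega
  obtain ⟨n, h⟩ := base
  have add (k : ℕ) : HasExtension g (n + k) := by
    induction k with
    | zero => exact h
    | succ k ih =>
      refine ih.attach isPatch_conePatch ?_
      have : (triangles conePatch).card = 3 := by decide +kernel
      omega
  exact ⟨n + (N + 1), by omega, add _⟩

end

/-- For every genus `g ≥ 5` and every bound `N` there is a combinatorial closed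
orientable surface of genus `g` with more than `N` vertices and no polyhedral
realization in ℝ³; in particular, for each `g ≥ 5` there are infinitely many
pairwise distinct non-realizable triangulated surfaces of genus `g`. -/
theorem infinitely_many_nonrealizable (g : ℕ) (hg : 5 ≤ g) :
    (∀ N : ℕ, ∃ (V : Finset ℕ) (K : Finset (Finset ℕ)),
      IsCombSurface V K g ∧ N < V.card ∧ ¬ AdmitsPolyRealization K) ∧
    {K : Finset (Finset ℕ) |
      (∃ V : Finset ℕ, IsCombSurface V K g) ∧ ¬ AdmitsPolyRealization K}.Infinite := by
  have key (N : ℕ) : ∃ (V : Finset ℕ) (K : Finset (Finset ℕ)),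
      IsCombSurface V K g ∧ N < V.card ∧ ¬ AdmitsPolyRealization K := by
    obtain ⟨n, hn, V, K, hS, rfl, hcore, -⟩ := exists_hasExtension hg N
    exact ⟨V, K, hS, hn, not_admitsPolyRealization hcore⟩
  refine ⟨key, fun hfin => ?_⟩
  obtain ⟨N, hN⟩ := (hfin.image fun K => (vertsOf K).card).bddAbove
  obtain ⟨V, K, hS, hn, hK⟩ := key N
  have hV : vertsOf K = V := by
    ext v
    simp only [vertsOf, mem_biUnion, id]
    exact ⟨fun ⟨T, hT, hv⟩ => (hS.2.1 T hT).2 hv, hS.2.2.1 v⟩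
  have : (vertsOf K).card ≤ N := hN ⟨K, ⟨⟨V, hS⟩, hK⟩, rfl⟩
  rw [hV] at this
  omega
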